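/- Let l ≥ 5 and let 0 < h₁ < h₂ < … < h_l be integers. Let 0 < ρ ≤ 1/2 be a real number with 2ρ(l−1) > 1. Then the set S' of all natural numbers N for which there exists R ∈ ℕ with |N − R²| ≤ R^{1/2−ρ} and such that for each i with 1 ≤ i ≤ l there exists a natural number nᵢ with (R − hᵢ)² + nᵢ² = N, is finite. -/

import Mathlib

section

open MvPolynomial Finset

/-- The weighted `l1` norm of a polynomial: the sum of `ν c * wt ^ e` over its terms `c x ^ e`. -/
noncomputable def wnorm {σ R : Type*} [CommRing R] (ν : RingSeminorm R) (wt : σ → ℝ)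
    (p : MvPolynomial σ R) : ℝ :=
  ∑ e ∈ p.support, ν (coeff e p) * e.prod fun i k => wt i ^ k

section wnorm
variable {σ R : Type*} [CommRing R] {ν : RingSeminorm R} {wt : σ → ℝ}

lemma wprod_nonneg (hw : ∀ i, 0 ≤ wt i) (e : σ →₀ ℕ) : 0 ≤ e.prod fun i k => wt i ^ k :=
  Finset.prod_nonneg fun i _ => pow_nonneg (hw i) _

lemma wprod_add (e f : σ →₀ ℕ) : ((e + f).prod fun i k => wt i ^ k) =
    (e.prod fun i k => wt i ^ k) * f.prod fun i k => wt i ^ k := by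
  classical
  exact Finsupp.prod_add_index' (by simp) (fun i a b => pow_add _ _ _)

lemma wnorm_nonneg (hw : ∀ i, 0 ≤ wt i) (p : MvPolynomial σ R) : 0 ≤ wnorm ν wt p :=
  Finset.sum_nonneg fun e _ => mul_nonneg (apply_nonneg ν _) (wprod_nonneg hw e)

lemma wnorm_eq_sum {p : MvPolynomial σ R} {s : Finset (σ →₀ ℕ)} (hs : p.support ⊆ s) :
    wnorm ν wt p = ∑ e ∈ s, ν (coeff e p) * e.prod fun i k => wt i ^ k :=
  Finset.sum_subset hs fun e _ he => by
    rw [notMem_support_iff.mp he, map_zero, zero_mul]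

lemma le_wnorm (hw : ∀ i, 0 ≤ wt i) (p : MvPolynomial σ R) (e : σ →₀ ℕ) :
    (ν (coeff e p) * e.prod fun i k => wt i ^ k) ≤ wnorm ν wt p := by
  by_cases he : e ∈ p.support
  · exact Finset.single_le_sum (f := fun e => ν (coeff e p) * e.prod fun i k => wt i ^ k)
      (fun e _ => mul_nonneg (apply_nonneg ν _) (wprod_nonneg hw e)) he
  · rw [notMem_support_iff.mp he, map_zero, zero_mul]; exact wnorm_nonneg hw p

@[simp] lemma wnorm_zero : wnorm ν wt (0 : MvPolynomial σ R) = 0 := by simp [wnorm]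

lemma wnorm_monomial (e : σ →₀ ℕ) (c : R) :
    wnorm ν wt (monomial e c) = ν c * e.prod fun i k => wt i ^ k := by
  classical
  rw [wnorm_eq_sum (s := {e}) support_monomial_subset]; simp

lemma wnorm_C (c : R) : wnorm ν wt (C c) = ν c := by
  rw [C_apply, wnorm_monomial]; simp

lemma wnorm_add_le (hw : ∀ i, 0 ≤ wt i) (p q : MvPolynomial σ R) :
    wnorm ν wt (p + q) ≤ wnorm ν wt p + wnorm ν wt q := by
  classical
  rw [wnorm_eq_sum (s := p.support ∪ q.support) support_add,
    wnorm_eq_sum (p := p) (s := p.support ∪ q.support) subset_union_left,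
    wnorm_eq_sum (p := q) (s := p.support ∪ q.support) subset_union_right, ← sum_add_distrib]
  refine sum_le_sum fun e _ => ?_
  rw [coeff_add, ← add_mul]
  exact mul_le_mul_of_nonneg_right (map_add_le_add ν _ _) (wprod_nonneg hw e)

lemma wnorm_sum_le (hw : ∀ i, 0 ≤ wt i) {ι : Type*} (s : Finset ι) (f : ι → MvPolynomial σ R) :
    wnorm ν wt (∑ i ∈ s, f i) ≤ ∑ i ∈ s, wnorm ν wt (f i) :=
  Finset.le_sum_of_subadditive _ wnorm_zero.le (wnorm_add_le hw) s f

lemma wnorm_mul_le (hw : ∀ i, 0 ≤ wt i) (p q : MvPolynomial σ R) :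
    wnorm ν wt (p * q) ≤ wnorm ν wt p * wnorm ν wt q := by
  have h : p * q = ∑ e ∈ p.support, ∑ f ∈ q.support,
      monomial (e + f) (coeff e p * coeff f q) := by
    conv_lhs => rw [p.as_sum, q.as_sum, sum_mul_sum]
    simp [monomial_mul]
  rw [h]
  refine (wnorm_sum_le hw _ _).trans ?_
  rw [wnorm, wnorm, sum_mul_sum]
  refine sum_le_sum fun e _ => (wnorm_sum_le hw _ _).trans (sum_le_sum fun f _ => ?_)
  rw [wnorm_monomial, wprod_add, mul_mul_mul_comm]
  exact mul_le_mul_of_nonneg_right (map_mul_le_mul ν _ _)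
    (mul_nonneg (wprod_nonneg hw e) (wprod_nonneg hw f))

lemma wnorm_one_le (h1 : ν 1 ≤ 1) : wnorm ν wt (1 : MvPolynomial σ R) ≤ 1 := by
  rw [← C_1, wnorm_C]; exact h1

lemma wnorm_prod_le (h1 : ν 1 ≤ 1) (hw : ∀ i, 0 ≤ wt i) {ι : Type*} (s : Finset ι)
    (f : ι → MvPolynomial σ R) :
    wnorm ν wt (∏ i ∈ s, f i) ≤ ∏ i ∈ s, wnorm ν wt (f i) := by
  classical
  induction s using Finset.induction_on with
  | empty => simpa using wnorm_one_le h1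
  | insert a s ha ih =>
    rw [prod_insert ha, prod_insert ha]
    exact (wnorm_mul_le hw _ _).trans (mul_le_mul_of_nonneg_left ih (wnorm_nonneg hw _))

lemma wnorm_pow_le (h1 : ν 1 ≤ 1) (hw : ∀ i, 0 ≤ wt i) (p : MvPolynomial σ R) (n : ℕ) :
    wnorm ν wt (p ^ n) ≤ wnorm ν wt p ^ n := by
  simpa using wnorm_prod_le h1 hw (range n) (fun _ => p)

/-- The norm of the result of a substitution. -/
lemma wnorm_aeval_le {τ S : Type*} [CommRing S] [Algebra S R] {μ : RingSeminorm S}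
    (h1 : ν 1 ≤ 1) (hμ : ∀ c, ν (algebraMap S R c) ≤ μ c) (hw : ∀ i, 0 ≤ wt i)
    (f : τ → MvPolynomial σ R) (u : τ → ℝ) (hf : ∀ j, wnorm ν wt (f j) ≤ u j)
    (p : MvPolynomial τ S) :
    wnorm ν wt (aeval f p) ≤ wnorm μ u p := by
  have h : aeval f p = ∑ e ∈ p.support,
      C (algebraMap S R (coeff e p)) * ∏ i ∈ e.support, f i ^ e i := by
    rw [aeval_def, eval₂_eq]; rfl
  rw [h]
  refine (wnorm_sum_le hw _ _).trans (sum_le_sum fun e _ => ?_)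
  refine (wnorm_mul_le hw _ _).trans ?_
  rw [wnorm_C]
  refine mul_le_mul (hμ _) ?_ (wnorm_nonneg hw _) (apply_nonneg μ _)
  refine (wnorm_prod_le h1 hw _ _).trans (prod_le_prod (fun i _ => wnorm_nonneg hw _) fun i _ => ?_)
  exact (wnorm_pow_le h1 hw _ _).trans (pow_le_pow_left₀ (wnorm_nonneg hw _) (hf i) _)

end wnorm

section mtaylor
variable {σ R : Type*} [CommRing R]

/-- Expansion of a polynomial around a point. -/
noncomputable def mtaylor (x : σ → R) : MvPolynomial σ R →ₐ[R] MvPolynomial σ R :=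
  aeval fun i => X i + C (x i)

lemma pderiv_mtaylor (x : σ → R) (h : σ) (p : MvPolynomial σ R) :
    pderiv h (mtaylor x p) = mtaylor x (pderiv h p) := by
  classical
  induction p using MvPolynomial.induction_on with
  | C a => simp [mtaylor]
  | add p q hp hq => simp [hp, hq]
  | mul_X p i hp =>
    simp only [map_mul, pderiv_mul, hp, map_add]
    by_cases hi : i = h
    · subst hi; simp [mtaylor]
    · simp [mtaylor, pderiv_X_of_ne hi]

lemma mtaylor_ne_zero (x : σ → R) {p : MvPolynomial σ R} (hp : p ≠ 0) : mtaylor x p ≠ 0 := by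
  have h : (mtaylor (fun i => - x i)).comp (mtaylor x) = AlgHom.id R _ := by
    ext i : 1; simp [mtaylor]
  intro h0
  apply hp
  have := congrArg (fun f => f p) h
  simpa [h0] using this.symm

end mtaylor

section hasse
variable {σ R : Type*} [Fintype σ] [CommRing R]

/-- Product of binomial coefficients of two exponent vectors. -/
def mchoose (e d : σ →₀ ℕ) : ℕ := ∏ i, (e i).choose (d i)

lemma mchoose_eq_zero {e d : σ →₀ ℕ} (h : ¬ d ≤ e) : mchoose e d = 0 := by
  simp only [Finsupp.le_def, not_forall, not_le] at h
  obtain ⟨i, hi⟩ := h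
  exact prod_eq_zero (mem_univ i) (Nat.choose_eq_zero_of_lt hi)

/-- The Hasse derivative of a polynomial in several variables. -/
noncomputable def hasse (d : σ →₀ ℕ) (p : MvPolynomial σ R) : MvPolynomial σ R :=
  ∑ e ∈ p.support, monomial (e - d) ((mchoose e d : R) * coeff e p)

lemma coeff_hasse (d m : σ →₀ ℕ) (p : MvPolynomial σ R) :
    coeff m (hasse d p) = (mchoose (m + d) d : R) * coeff (m + d) p := by
  classical
  rw [hasse, coeff_sum, Finset.sum_eq_single (m + d)]
  · simp [coeff_monomial]
  · intro e _ he
    rw [coeff_monomial]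
    split_ifs with h
    · rw [mchoose_eq_zero, Nat.cast_zero, zero_mul]
      intro hd
      exact he (by rw [← h, tsub_add_cancel_of_le hd])
    · rfl
  · intro h
    rw [notMem_support_iff.mp h]; simp

lemma hasse_zero (p : MvPolynomial σ R) : hasse 0 p = p := by
  ext m; simp [coeff_hasse, mchoose]

lemma hasse_sum {ι : Type*} (s : Finset ι) (d : σ →₀ ℕ) (f : ι → MvPolynomial σ R) :
    hasse d (∑ i ∈ s, f i) = ∑ i ∈ s, hasse d (f i) := by
  ext m; simp [coeff_hasse, coeff_sum, mul_sum]

lemma hasse_map {S : Type*} [CommRing S] (f : R →+* S) (d : σ →₀ ℕ) (p : MvPolynomial σ R) :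
    hasse d (map f p) = map f (hasse d p) := by
  ext m; simp [coeff_hasse, coeff_map]

lemma mchoose_succ (m d : σ →₀ ℕ) (h : σ) :
    ((m h + 1) * mchoose (m + Finsupp.single h 1 + d) d : ℕ) =
      (d h + 1) * mchoose (m + (d + Finsupp.single h 1)) (d + Finsupp.single h 1) := by
  classical
  unfold mchoose
  rw [← mul_prod_erase univ _ (mem_univ h), ← mul_prod_erase univ _ (mem_univ h), ← mul_assoc,
    ← mul_assoc]
  congr 1
  · simp only [Finsupp.add_apply, Finsupp.single_eq_same]
    have := Nat.choose_succ_right_eq (m h + (d h + 1)) (d h)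
    rw [show m h + 1 + d h = m h + (d h + 1) by ring]
    rw [show m h + (d h + 1) - d h = m h + 1 by omega] at this
    linarith
  · refine prod_congr rfl fun i hi => ?_
    have : h ≠ i := (ne_of_mem_erase hi).symm
    simp [Finsupp.single_eq_of_ne, this.symm]

lemma pderiv_hasse (d : σ →₀ ℕ) (h : σ) (p : MvPolynomial σ R) :
    pderiv h (hasse d p) = ((d h + 1 : ℕ) : R) • hasse (d + Finsupp.single h 1) p := by
  ext m
  rw [coeff_pderiv, coeff_hasse, coeff_smul, coeff_hasse, smul_eq_mul, ← mul_assoc, ← Nat.cast_mul,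
    ← mchoose_succ, add_right_comm m, add_assoc m d]
  push_cast; ring

lemma degreeOf_hasse_le (d : σ →₀ ℕ) (p : MvPolynomial σ R) (h : σ) :
    degreeOf h (hasse d p) ≤ degreeOf h p := by
  rw [degreeOf_le_iff]
  intro m hm
  rw [mem_support_iff, coeff_hasse] at hm
  have := monomial_le_degreeOf h (mem_support_iff.mpr (right_ne_zero_of_mul hm))
  simp at this; omega

lemma hasse_mtaylor [IsDomain R] [CharZero R] (x : σ → R) (d : σ →₀ ℕ) (p : MvPolynomial σ R) :
    hasse d (mtaylor x p) = mtaylor x (hasse d p) := by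
  classical
  induction hn : d.degree generalizing d with
  | zero =>
    rw [Finsupp.degree_eq_zero_iff] at hn; simp [hn, hasse_zero]
  | succ n ih =>
    have : ∃ h, d h ≠ 0 := by
      by_contra! hc
      have : d = 0 := Finsupp.ext hc
      simp [this] at hn
    obtain ⟨h, hh⟩ := this
    obtain ⟨d, rfl⟩ : ∃ d', d = d' + Finsupp.single h 1 :=
      ⟨d - Finsupp.single h 1, (tsub_add_cancel_of_le (by simp; omega)).symm⟩
    have hd : d.degree = n := by simpa using hn
    have h1 := pderiv_hasse d h (mtaylor x p)
    rw [ih d hd, pderiv_mtaylor, pderiv_hasse, map_smul] at h1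
    exact (smul_right_injective _ (Nat.cast_ne_zero.mpr (Nat.succ_ne_zero (d h))) h1).symm

lemma coeff_mtaylor_hasse [IsDomain R] [CharZero R] (x : σ → R) (d m : σ →₀ ℕ)
    (p : MvPolynomial σ R) :
    coeff m (mtaylor x (hasse d p)) = (mchoose (m + d) d : R) * coeff (m + d) (mtaylor x p) := by
  rw [← hasse_mtaylor, coeff_hasse]

lemma wnorm_hasse_le {ν : RingSeminorm R} (hν : ν 1 ≤ 1) (d : σ →₀ ℕ) (p : MvPolynomial σ R)
    (r : σ → ℕ) (hr : ∀ h, degreeOf h p ≤ r h) :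
    wnorm ν (fun _ => 1) (hasse d p) ≤ 2 ^ (∑ h, r h) * wnorm ν (fun _ => 1) p := by
  have hnat : ∀ n : ℕ, ν (n : R) ≤ n := by
    intro n
    induction n with
    | zero => simp
    | succ n ih => push_cast; exact (map_add_le_add ν _ _).trans (add_le_add ih hν)
  refine (wnorm_sum_le (by simp) _ _).trans ?_
  rw [wnorm, mul_sum]
  refine sum_le_sum fun e he => ?_
  rw [wnorm_monomial]
  have hch : mchoose e d ≤ 2 ^ (∑ h, r h) := by
    rw [← prod_pow_eq_pow_sum]
    exact prod_le_prod' fun i _ => (Nat.choose_le_two_pow _ _).trans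
      (Nat.pow_le_pow_right (by norm_num) ((monomial_le_degreeOf i he).trans (hr i)))
  simp only [one_pow, Finsupp.prod_fun_one, mul_one]
  refine (map_mul_le_mul ν _ _).trans (mul_le_mul_of_nonneg_right
    ((hnat _).trans ?_) (apply_nonneg ν _))
  exact_mod_cast hch

end hasse

end

section

open MvPolynomial Finset
open scoped MonomialOrder

/-- The generalized Wronskian criterion, for a family of higher derivations `D` generated by
derivations whose constants are the scalars. -/
theorem exists_wronskian_ne_zero {K A σ : Type*} [Field K] [CommRing A] [IsDomain A] [Algebra K A]
    (D : (σ →₀ ℕ) → A → A) (δ : σ → Derivation K A A) (c : (σ →₀ ℕ) → σ → K)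
    (hD : ∀ p, D 0 p = p) (hδ : ∀ d h p, δ h (D d p) = c d h • D (d + Finsupp.single h 1) p)
    (hconst : ∀ a b : A, a ≠ 0 → (∀ h, a * δ h b = b * δ h a) → ∃ t : K, b = t • a)
    (s : ℕ) (φ : Fin s → A) (hφ : LinearIndependent K φ) :
    ∃ d : Fin s → σ →₀ ℕ, (∀ i, (d i).degree ≤ i) ∧
      (Matrix.of fun i j => D (d i) (φ j)).det ≠ 0 := by
  induction s with
  | zero => exact ⟨Fin.elim0, fun i => i.elim0, by simp⟩
  | succ s ih =>
    obtain ⟨d, hd, hdet⟩ := ih (fun i => φ i.castSucc)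
      (hφ.comp _ (Fin.castSucc_injective s))
    by_contra! hcon
    let N : Matrix (Fin s) (Fin (s + 1)) A := Matrix.of fun i j => D (d i) (φ j)
    let C : Fin (s + 1) → A := fun j => (-1) ^ (s + j : ℕ) * (N.submatrix id j.succAbove).det
    have hClast : C (Fin.last s) ≠ 0 := by
      simp only [C, Fin.val_last, ← two_mul, pow_mul, neg_one_sq, one_pow, one_mul]
      convert hdet using 2
      ext i j; simp [N, Fin.succAbove_last]
    have hE : ∀ e : σ →₀ ℕ, e.degree ≤ s → ∑ j, C j * D e (φ j) = 0 := by
      intro e he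
      have h0 := hcon (Fin.snoc d e) (fun i => by
        refine Fin.lastCases ?_ (fun i => ?_) i
        · simpa using he
        · simpa using hd i)
      rw [Matrix.det_succ_row _ (Fin.last s)] at h0
      rw [← h0]
      refine sum_congr rfl fun j _ => ?_
      simp only [C, N, Fin.val_last, Matrix.of_apply, Fin.snoc_last, Fin.succAbove_last]
      rw [mul_right_comm]
      congr 2
      ext i k; simp
    have hE' : ∀ h, ∀ e : σ →₀ ℕ, e.degree + 1 ≤ s → ∑ j, δ h (C j) * D e (φ j) = 0 := by
      intro h e he
      have h1 := congrArg (δ h) (hE e (by omega))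
      simp only [map_sum, Derivation.leibniz, hδ, smul_eq_mul, map_zero, sum_add_distrib] at h1
      have h2 : ∑ j, C j * c e h • D (e + Finsupp.single h 1) (φ j) = 0 := by
        rw [← smul_zero (c e h), ← hE (e + Finsupp.single h 1) (by simpa using he), smul_sum]
        exact sum_congr rfl fun j _ => mul_smul_comm _ _ _
      rw [h2, zero_add] at h1
      rw [← h1]
      exact sum_congr rfl fun j _ => mul_comm _ _
    have hprop : ∀ j : Fin (s + 1), ∀ h,
        C (Fin.last s) * δ h (C j) = C j * δ h (C (Fin.last s)) := by
      intro j h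
      refine Fin.lastCases rfl (fun j => ?_) j
      have key : (Matrix.of fun i j => D (d i) (φ (Fin.castSucc j))).mulVec
          (fun j : Fin s => C (Fin.last s) * δ h (C j.castSucc)
            - C j.castSucc * δ h (C (Fin.last s))) = 0 := by
        ext i
        have e1 := hE (d i) ((hd i).trans i.2.le)
        have e2 := hE' h (d i) (by have := hd i; have := i.2; omega)
        rw [Fin.sum_univ_castSucc] at e1 e2
        simp only [Matrix.mulVec, dotProduct, Matrix.of_apply, Pi.zero_apply, mul_sub,
          sum_sub_distrib]
        have e3 : ∑ x : Fin s, D (d i) (φ x.castSucc) * (C (Fin.last s) * δ h (C x.castSucc))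
            = C (Fin.last s) * ∑ x : Fin s, δ h (C x.castSucc) * D (d i) (φ x.castSucc) := by
          rw [mul_sum]; exact sum_congr rfl fun x _ => by ring
        have e4 : ∑ x : Fin s, D (d i) (φ x.castSucc) * (C x.castSucc * δ h (C (Fin.last s)))
            = δ h (C (Fin.last s)) * ∑ x : Fin s, C x.castSucc * D (d i) (φ x.castSucc) := by
          rw [mul_sum]; exact sum_congr rfl fun x _ => by ring
        rw [e3, e4]
        linear_combination C (Fin.last s) * e2 - δ h (C (Fin.last s)) * e1
      exact sub_eq_zero.mp (congrFun (Matrix.eq_zero_of_mulVec_eq_zero hdet key) j)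
    choose t ht using fun j => hconst _ _ hClast (hprop j)
    have h0 := hE 0 (by simp)
    simp only [hD] at h0
    have h1 : C (Fin.last s) * ∑ j, t j • φ j = 0 := by
      rw [mul_sum, ← h0]
      refine sum_congr rfl fun j _ => ?_
      conv_rhs => rw [ht j]
      simp
    have h2 := (mul_eq_zero.mp h1).resolve_left hClast
    have h3 := Fintype.linearIndependent_iff.mp hφ t h2 (Fin.last s)
    apply hClast
    rw [ht (Fin.last s), h3, zero_smul]

lemma MvPolynomial.exists_smul_of_pderiv {σ K : Type*} [Field K] [CharZero K] [Finite σ]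
    (a b : MvPolynomial σ K) (ha : a ≠ 0) (h : ∀ i, a * pderiv i b = b * pderiv i a) :
    ∃ t : K, b = t • a := by
  classical
  have := Fintype.ofFinite σ
  let e : σ ≃ Fin (Fintype.card σ) := Fintype.equivFin σ
  let _ : LinearOrder σ := LinearOrder.lift' e e.injective
  let m : MonomialOrder σ := MonomialOrder.lex
  let t := coeff (m.degree a) b / m.leadingCoeff a
  have hla : m.leadingCoeff a ≠ 0 := m.leadingCoeff_ne_zero_iff.mpr ha
  refine ⟨t, sub_eq_zero.mp ?_⟩
  set c := b - t • a with hc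
  have hc0 : coeff (m.degree a) c = 0 := by
    have : coeff (m.degree a) a = m.leadingCoeff a := rfl
    simp [hc, t, this, hla]
  have h' : ∀ i, a * (X i * pderiv i c) = c * (X i * pderiv i a) := by
    intro i
    rw [hc, map_sub, Derivation.map_smul, mul_sub, mul_sub, sub_mul]
    simp only [smul_eq_C_mul]
    linear_combination X i * h i
  by_contra hne
  have hlc : m.leadingCoeff c ≠ 0 := m.leadingCoeff_ne_zero_iff.mpr hne
  have hX : ∀ (i : σ) (p : MvPolynomial σ K) (k), coeff k (X i * pderiv i p) = k i * coeff k p := by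
    intro i p k
    rw [coeff_X_mul']
    split_ifs with hk
    · rw [coeff_pderiv, tsub_add_cancel_of_le (by simpa [Nat.one_le_iff_ne_zero] using hk)]
      have : 1 ≤ k i := by simpa [Nat.one_le_iff_ne_zero] using hk
      simp [Nat.cast_sub this]; ring
    · simp at hk; simp [hk]
  have hdeg : ∀ (i : σ) (p : MvPolynomial σ K),
      m.degree (X i * pderiv i p) ≼[m] m.degree p := by
    intro i p
    rw [m.degree_le_iff]
    intro k hk
    rw [mem_support_iff, hX] at hk
    exact m.le_degree (mem_support_iff.mpr (right_ne_zero_of_mul hk))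
  have heq : m.degree c = m.degree a := by
    ext i
    have h1 := congrArg (coeff (m.degree a + m.degree c)) (h' i)
    rw [m.coeff_mul_of_add_of_degree_le le_rfl (hdeg i c), add_comm,
      m.coeff_mul_of_add_of_degree_le le_rfl (hdeg i a), hX, hX] at h1
    have h2 : ((m.degree c i : K) - m.degree a i) *
        (m.leadingCoeff a * m.leadingCoeff c) = 0 := by
      unfold MonomialOrder.leadingCoeff
      linear_combination h1
    have h3 := (mul_eq_zero.mp h2).resolve_right (mul_ne_zero hla hlc)
    exact_mod_cast sub_eq_zero.mp h3
  exact hlc (by rw [MonomialOrder.leadingCoeff, heq, hc0])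

lemma Polynomial.exists_smul_of_derivative {K : Type*} [Field K] [CharZero K]
    (a b : Polynomial K) (ha : a ≠ 0) (h : a * b.derivative = b * a.derivative) :
    ∃ t : K, b = t • a := by
  let e := uniqueAlgEquiv K Unit
  have hp : ∀ (i : Unit) (p : Polynomial K), pderiv i (e.symm p) = e.symm p.derivative := by
    intro i p
    have hX : e.symm Polynomial.X = MvPolynomial.X i := by
      rw [AlgEquiv.symm_apply_eq]
      exact (MvPolynomial.eval₂_X Polynomial.C (fun _ => Polynomial.X) i).symm
    induction p using Polynomial.induction_on' with
    | add p q hp hq => simp only [map_add, hp, hq]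
    | monomial n c =>
      rw [Polynomial.derivative_monomial, ← Polynomial.smul_X_eq_monomial,
        ← Polynomial.smul_X_eq_monomial, map_smul e.symm, map_smul e.symm, map_pow e.symm,
        map_pow e.symm, hX, Derivation.map_smul, pderiv_pow, pderiv_X_self, mul_smul]
      congr 1
      rw [mul_one, Nat.cast_smul_eq_nsmul, nsmul_eq_mul]
  have hne : e.symm a ≠ 0 := fun h0 => ha (by simpa using congrArg e h0)
  obtain ⟨t, ht⟩ := MvPolynomial.exists_smul_of_pderiv (e.symm a) (e.symm b) hne fun i => by
    rw [hp, hp, ← map_mul, ← map_mul, h]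
  exact ⟨t, e.symm.injective (by rw [ht, map_smul])⟩

theorem MvPolynomial.exists_wronskian {σ K : Type*} [Field K] [CharZero K] [Fintype σ]
    {s : ℕ} (φ : Fin s → MvPolynomial σ K) (hφ : LinearIndependent K φ) :
    ∃ d : Fin s → σ →₀ ℕ, (∀ i, (d i).degree ≤ i) ∧
      (Matrix.of fun i j => hasse (d i) (φ j)).det ≠ 0 :=
  exists_wronskian_ne_zero hasse (fun i => pderiv i) (fun d h => ((d h + 1 : ℕ) : K)) hasse_zero
    pderiv_hasse (fun a b ha h => MvPolynomial.exists_smul_of_pderiv a b ha h) s φ hφ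

theorem Polynomial.exists_wronskian {K : Type*} [Field K] [CharZero K]
    {s : ℕ} (φ : Fin s → Polynomial K) (hφ : LinearIndependent K φ) :
    ∃ d : Fin s → ℕ, (∀ i, d i ≤ i) ∧
      (Matrix.of fun i j => Polynomial.hasseDeriv (d i) (φ j)).det ≠ 0 := by
  have hδ : ∀ (d : Unit →₀ ℕ) (_ : Unit) (p : Polynomial K),
      Polynomial.derivative' (Polynomial.hasseDeriv (d ()) p) =
        ((d () + 1 : ℕ) : K) • Polynomial.hasseDeriv (d () + 1) p := by
    intro d _ p
    ext n
    change (Polynomial.derivative _).coeff n = _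
    simp only [Polynomial.coeff_derivative, Polynomial.hasseDeriv_coeff, Polynomial.coeff_smul,
      smul_eq_mul]
    have := Nat.choose_succ_right_eq (n + (d () + 1)) (d ())
    rw [show n + (d () + 1) - d () = n + 1 by omega] at this
    have h2 : (((n + (d () + 1)).choose (d () + 1) : K)) * (d () + 1)
      = ((n + (d () + 1)).choose (d ()) : K) * (n + 1) := by exact_mod_cast this
    rw [show n + 1 + d () = n + (d () + 1) by ring]
    push_cast
    linear_combination (-(p.coeff (n + (d () + 1)))) * h2
  obtain ⟨d, hd, h⟩ := exists_wronskian_ne_zero (σ := Unit)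
    (fun d p => Polynomial.hasseDeriv (d ()) p)
    (fun _ => Polynomial.derivative') (fun d _ => ((d () + 1 : ℕ) : K)) (fun p => by simp)
    (fun d h p => by simpa using hδ d h p)
    (fun a b ha h => Polynomial.exists_smul_of_derivative a b ha (h ())) s φ hφ
  exact ⟨fun i => d i (), fun i => by simpa [Finsupp.degree_eq_sum] using hd i, h⟩

end

section

open MvPolynomial Finset

section tensor
variable {n : ℕ} {K : Type*} [CommRing K]

/-- Product of a polynomial in the last `n` variables and one in the first variable. -/
noncomputable def tens (φ : MvPolynomial (Fin n) K) (ψ : Polynomial K) :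
    MvPolynomial (Fin (n + 1)) K := rename Fin.succ φ * Polynomial.aeval (X 0) ψ

lemma coeff_tens (φ : MvPolynomial (Fin n) K) (ψ : Polynomial K) (a : ℕ) (m : Fin n →₀ ℕ) :
    coeff (Finsupp.cons a m) (tens φ ψ) = coeff m φ * ψ.coeff a := by
  have h : finSuccEquiv K n (Polynomial.aeval (X 0) ψ) = ψ.map C := by
    induction ψ using Polynomial.induction_on' with
    | add p q hp hq => simp only [map_add, hp, hq, Polynomial.map_add]
    | monomial k c =>
      rw [Polynomial.aeval_monomial, map_mul, map_pow, finSuccEquiv_X_zero, Polynomial.map_monomial,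
        ← Polynomial.C_mul_X_pow_eq_monomial]
      congr 1
      exact finSuccEquiv_apply (R := K) n (C c) |>.trans (by simp)
  have h2 : finSuccEquiv K n (rename Fin.succ φ) = Polynomial.C φ := by
    induction φ using MvPolynomial.induction_on with
    | C a => simp [finSuccEquiv_apply]
    | add p q hp hq => simp only [map_add, hp, hq]
    | mul_X p i hp => rw [map_mul, map_mul, hp, rename_X, finSuccEquiv_X_succ, map_mul]
  rw [← finSuccEquiv_coeff_coeff, tens, map_mul, h2, h, Polynomial.coeff_C_mul,
    Polynomial.coeff_map, mul_comm, coeff_C_mul, mul_comm]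

lemma ext_cons {p q : MvPolynomial (Fin (n + 1)) K}
    (h : ∀ a m, coeff (Finsupp.cons a m) p = coeff (Finsupp.cons a m) q) : p = q := by
  ext e
  rw [← Finsupp.cons_tail e]; exact h _ _

lemma cons_add_cons (a b : ℕ) (m d : Fin n →₀ ℕ) :
    Finsupp.cons a m + Finsupp.cons b d = Finsupp.cons (a + b) (m + d) := by
  ext i; refine Fin.cases ?_ (fun i => ?_) i <;> simp

lemma mchoose_cons (a b : ℕ) (m d : Fin n →₀ ℕ) :
    mchoose (Finsupp.cons a m) (Finsupp.cons b d) = a.choose b * mchoose m d := by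
  simp [mchoose, Fin.prod_univ_succ]

lemma hasse_tens (φ : MvPolynomial (Fin n) K) (ψ : Polynomial K) (b : ℕ) (d : Fin n →₀ ℕ) :
    hasse (Finsupp.cons b d) (tens φ ψ) = tens (hasse d φ) (Polynomial.hasseDeriv b ψ) := by
  refine ext_cons fun a m => ?_
  rw [coeff_hasse, cons_add_cons, coeff_tens, coeff_tens, coeff_hasse, Polynomial.hasseDeriv_coeff,
    mchoose_cons]
  push_cast; ring

lemma mtaylor_tens (x : Fin (n + 1) → K) (φ : MvPolynomial (Fin n) K) (ψ : Polynomial K) :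
    mtaylor x (tens φ ψ) = tens (mtaylor (fun i => x i.succ) φ) (Polynomial.taylor (x 0) ψ) := by
  rw [tens, tens, map_mul]
  congr 1
  · induction φ using MvPolynomial.induction_on with
    | C a => simp [mtaylor]
    | add p q hp hq => simp only [map_add, hp, hq]
    | mul_X p i hp =>
      simp only [map_mul, hp]
      simp [mtaylor]
  · rw [← Polynomial.aeval_algHom_apply]
    induction ψ using Polynomial.induction_on' with
    | add p q hp hq => simp only [map_add, hp, hq]
    | monomial k c =>
      rw [Polynomial.taylor_monomial, Polynomial.aeval_monomial]
      simp [mtaylor]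

lemma exists_eq_sum_tens {K : Type*} [Field K] (p : MvPolynomial (Fin (n + 1)) K) (r : ℕ)
    (hr : degreeOf 0 p ≤ r) : ∃ s ≤ r + 1, ∃ (φ : Fin s → MvPolynomial (Fin n) K)
      (ψ : Fin s → Polynomial K), LinearIndependent K φ ∧ LinearIndependent K ψ ∧
        p = ∑ k, tens (φ k) (ψ k) := by
  classical
  let q := finSuccEquiv K n p
  have hq : q.natDegree ≤ r := by rw [natDegree_finSuccEquiv]; exact hr
  let c : Fin (r + 1) → MvPolynomial (Fin n) K := fun i => q.coeff i
  let M := Submodule.span K (Set.range c)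
  have hfin : Module.Finite K M := FiniteDimensional.span_of_finite K (Set.finite_range c)
  let b := Module.finBasis K M
  have hc : ∀ i, c i ∈ M := fun i => Submodule.subset_span ⟨i, rfl⟩
  let l : Fin (r + 1) → Fin (Module.finrank K M) → K := fun i k => b.repr ⟨c i, hc i⟩ k
  let ψ : Fin (Module.finrank K M) → Polynomial K :=
    fun k => ∑ i : Fin (r + 1), Polynomial.monomial i (l i k)
  have hψ : ∀ k (a : ℕ), (ψ k).coeff a = if h : a < r + 1 then l ⟨a, h⟩ k else 0 := by
    intro k a
    simp only [ψ, Polynomial.finsetSum_coeff, Polynomial.coeff_monomial]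
    split_ifs with h
    · rw [Finset.sum_eq_single ⟨a, h⟩]
      · simp
      · exact fun j _ hj => if_neg fun h1 => hj (Fin.ext h1)
      · simp
    · exact Finset.sum_eq_zero fun i _ => if_neg (by omega)
  refine ⟨Module.finrank K M, (finrank_range_le_card (R := K) c).trans (by simp), fun k => b k, ψ,
    b.linearIndependent.map' M.subtype M.ker_subtype, ?_, ?_⟩
  · rw [Fintype.linearIndependent_iff]
    intro μ hμ
    let f : M →ₗ[K] K := b.constr K μ
    have hf : f = 0 := by
      have h0 : ∀ i, f ⟨c i, hc i⟩ = 0 := by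
        intro i
        have := congrArg (fun p => Polynomial.coeff p i) hμ
        simp only [Polynomial.finsetSum_coeff, Polynomial.coeff_smul, hψ, Polynomial.coeff_zero,
          dif_pos i.2, smul_eq_mul] at this
        rw [← this, Module.Basis.constr_apply_fintype]
        exact sum_congr rfl fun k _ => by simp [l, Module.Basis.equivFun_apply, mul_comm]
      ext ⟨x, hx⟩
      induction hx using Submodule.span_induction with
      | mem x h => obtain ⟨i, rfl⟩ := h; exact h0 i
      | zero => exact map_zero f
      | add x y hx hy h1 h2 =>
        have := map_add f ⟨x, hx⟩ ⟨y, hy⟩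
        rw [h1, h2] at this; simpa using this
      | smul a x hx h1 =>
        have := map_smul f a ⟨x, hx⟩
        rw [h1] at this; simpa using this
    intro k
    have : f (b k) = μ k := b.constr_basis K μ k
    rw [← this, hf]; rfl
  · refine ext_cons fun a m => ?_
    rw [coeff_sum, ← finSuccEquiv_coeff_coeff]
    simp only [coeff_tens, hψ]
    split_ifs with h
    · have e1 : c ⟨a, h⟩ = ∑ k, l ⟨a, h⟩ k • (b k : MvPolynomial (Fin n) K) := by
        have := congrArg Subtype.val (b.sum_repr ⟨c ⟨a, h⟩, hc _⟩)
        exact this.symm.trans (by rw [Submodule.coe_sum]; rfl)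
      change coeff m (c ⟨a, h⟩) = _
      rw [e1, coeff_sum]
      exact sum_congr rfl fun k _ => by rw [coeff_smul, smul_eq_mul, mul_comm]
    · rw [Polynomial.coeff_eq_zero_of_natDegree_lt (p := finSuccEquiv K n p)
        (lt_of_le_of_lt hq (by omega))]
      simp

end tensor

/-- Vanishing at `x` of all Taylor coefficients of weight less than `t`. -/
def IndGE {σ : Type*} [Fintype σ] (x : σ → ℚ) (w : σ → ℝ) (t : ℝ) (p : MvPolynomial σ ℚ) : Prop :=
  ∀ J : σ →₀ ℕ, ∑ h, J h * w h < t → coeff J (mtaylor x p) = 0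

section IndGE
variable {σ : Type*} [Fintype σ] {x : σ → ℚ} {w : σ → ℝ} {t u : ℝ} {p q : MvPolynomial σ ℚ}

lemma IndGE.mono (h : IndGE x w t p) (hu : u ≤ t) : IndGE x w u p :=
  fun J hJ => h J (hJ.trans_le hu)

lemma IndGE.of_nonpos (hw : ∀ h, 0 ≤ w h) (ht : t ≤ 0) : IndGE x w t p :=
  fun _ hJ => absurd hJ (not_lt.mpr (ht.trans
    (Finset.sum_nonneg fun h _ => mul_nonneg (Nat.cast_nonneg _) (hw h))))

lemma IndGE.mul (hp : IndGE x w t p) (hq : IndGE x w u q) : IndGE x w (t + u) (p * q) := by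
  classical
  intro J hJ
  rw [map_mul, coeff_mul]
  refine Finset.sum_eq_zero fun ab hab => ?_
  rw [HasAntidiagonal.mem_antidiagonal] at hab
  have : ∑ h, (J h : ℝ) * w h = ∑ h, ab.1 h * w h + ∑ h, ab.2 h * w h := by
    rw [← hab, ← sum_add_distrib]
    exact sum_congr rfl fun h _ => by simp [add_mul]
  rcases lt_or_ge (∑ h, (ab.1 h : ℝ) * w h) t with h1 | h1
  · rw [hp _ h1, zero_mul]
  · rw [hq _ (by linarith), mul_zero]

lemma IndGE.prod (hw : ∀ h, 0 ≤ w h) {ι : Type*} (s : Finset ι) (f : ι → MvPolynomial σ ℚ)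
    (t : ι → ℝ) (hf : ∀ i ∈ s, IndGE x w (t i) (f i)) :
    IndGE x w (∑ i ∈ s, t i) (∏ i ∈ s, f i) := by
  classical
  induction s using Finset.induction_on with
  | empty => exact IndGE.of_nonpos hw (by simp)
  | insert a s ha ih =>
    rw [sum_insert ha, prod_insert ha]
    exact (hf a (mem_insert_self _ _)).mul (ih fun i hi => hf i (mem_insert_of_mem hi))

lemma IndGE.sum {ι : Type*} (s : Finset ι) (f : ι → MvPolynomial σ ℚ)
    (hf : ∀ i ∈ s, IndGE x w t (f i)) : IndGE x w t (∑ i ∈ s, f i) := by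
  intro J hJ
  rw [map_sum, coeff_sum]
  exact Finset.sum_eq_zero fun i hi => hf i hi J hJ

lemma IndGE.hasse (hp : IndGE x w t p) (d : σ →₀ ℕ) :
    IndGE x w (t - ∑ h, d h * w h) (_root_.hasse d p) := by
  intro J hJ
  rw [coeff_mtaylor_hasse, hp, mul_zero]
  simp only [Finsupp.add_apply, Nat.cast_add, add_mul, sum_add_distrib]
  linarith

end IndGE

/-- The sum of the absolute values of the coefficients. -/
noncomputable def L1 {σ : Type*} (p : MvPolynomial σ ℤ) : ℝ :=
  wnorm (normRingSeminorm ℤ) (fun _ => 1) p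

lemma normRingSeminorm_int (a : ℤ) : normRingSeminorm ℤ a = |(a : ℝ)| := by
  rw [← Int.norm_eq_abs]; rfl

lemma abs_coeff_le_L1 {σ : Type*} (p : MvPolynomial σ ℤ) (e : σ →₀ ℕ) :
    |((coeff e p : ℤ) : ℝ)| ≤ L1 p := by
  have := le_wnorm (ν := normRingSeminorm ℤ) (wt := fun _ : σ => (1 : ℝ)) (by simp) p e
  simpa [normRingSeminorm_int, L1] using this

lemma one_le_L1 {σ : Type*} {p : MvPolynomial σ ℤ} (hp : p ≠ 0) : 1 ≤ L1 p := by
  obtain ⟨e, he⟩ := ne_zero_iff.mp hp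
  refine le_trans ?_ (abs_coeff_le_L1 p e)
  exact_mod_cast Int.one_le_abs he

lemma L1_eq_sum {σ : Type*} (p : MvPolynomial σ ℤ) :
    L1 p = ∑ e ∈ p.support, |((coeff e p : ℤ) : ℝ)| := by
  simp [L1, wnorm, normRingSeminorm_int]

lemma L1_slice_le {n : ℕ} (p : MvPolynomial (Fin (n + 1)) ℤ) (a : ℕ) :
    L1 ((finSuccEquiv ℤ n p).coeff a) ≤ L1 p := by
  classical
  rw [L1_eq_sum, L1_eq_sum]
  simp only [finSuccEquiv_coeff_coeff]
  rw [← sum_image (s := ((finSuccEquiv ℤ n p).coeff a).support) (g := Finsupp.cons a)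
    (f := fun e => |((coeff e p : ℤ) : ℝ)|) (fun x _ y _ h => Finsupp.cons_right_injective a h)]
  refine sum_le_sum_of_subset_of_nonneg ?_ fun _ _ _ => abs_nonneg _
  intro e he
  obtain ⟨m, hm, rfl⟩ := mem_image.mp he
  rwa [mem_support_iff, ← finSuccEquiv_coeff_coeff, ← mem_support_iff]

lemma L1_det_le {σ : Type*} {s : ℕ} (M : Matrix (Fin s) (Fin s) (MvPolynomial σ ℤ)) (B : ℝ)
    (hM : ∀ i j, L1 (M i j) ≤ B) : L1 M.det ≤ s.factorial * B ^ s := by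
  have h1 : (normRingSeminorm ℤ) 1 ≤ 1 := by simp [normRingSeminorm_int]
  have hw : ∀ i : σ, (0 : ℝ) ≤ (fun _ => 1) i := by simp
  rw [Matrix.det_apply']
  refine (wnorm_sum_le hw _ _).trans ?_
  calc _ ≤ ∑ _ : Equiv.Perm (Fin s), B ^ s := by
        refine sum_le_sum fun τ _ => (wnorm_mul_le hw _ _).trans ?_
        have h2 : wnorm (normRingSeminorm ℤ) (fun _ : σ => (1 : ℝ))
            (((Equiv.Perm.sign τ : ℤ) : MvPolynomial σ ℤ)) ≤ 1 := by
          rw [← map_intCast (C : ℤ →+* MvPolynomial σ ℤ), wnorm_C, normRingSeminorm_int]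
          rcases Int.units_eq_one_or (Equiv.Perm.sign τ) with h | h <;> simp [h]
        have h3 := (wnorm_prod_le (ν := normRingSeminorm ℤ) h1 hw univ (fun i => M (τ i) i)).trans
          (prod_le_prod (fun i _ => wnorm_nonneg hw _) fun i _ => hM (τ i) i)
        rw [prod_const, card_univ, Fintype.card_fin] at h3
        calc _ ≤ 1 * B ^ s := mul_le_mul h2 h3 (wnorm_nonneg hw _) zero_le_one
          _ = B ^ s := one_mul _
    _ = s.factorial * B ^ s := by simp [Fintype.card_perm]

lemma degreeOf_det_le {σ : Type*} {s : ℕ} (M : Matrix (Fin s) (Fin s) (MvPolynomial σ ℤ)) (h : σ)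
    (r : ℕ) (hM : ∀ i j, degreeOf h (M i j) ≤ r) : degreeOf h M.det ≤ s * r := by
  rw [Matrix.det_apply']
  refine (degreeOf_sum_le _ _ _).trans (Finset.sup_le fun τ _ => ?_)
  refine (degreeOf_mul_le _ _ _).trans ?_
  rw [← map_intCast (C : ℤ →+* MvPolynomial σ ℤ), degreeOf_C, zero_add]
  refine (degreeOf_prod_le _ _ _).trans ((sum_le_sum fun i _ => hM _ _).trans ?_)
  simp

/-- The order of vanishing of an integer polynomial at a rational point of large height. -/
lemma exists_taylor_coeff_ne_zero (V : Polynomial ℤ) (hV : V ≠ 0) (x : ℚ) :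
    ∃ k : ℕ, ((x.den : ℤ) ^ k ∣ V.leadingCoeff) ∧
      (Polynomial.taylor x (V.map (Int.castRingHom ℚ))).coeff k ≠ 0 := by
  set Vq := V.map (Int.castRingHom ℚ) with hVq
  have hVq0 : Vq ≠ 0 := (Polynomial.map_ne_zero_iff (Int.cast_injective)).mpr hV
  refine ⟨Vq.rootMultiplicity x, ?_, ?_⟩
  · set k := Vq.rootMultiplicity x
    let l : Polynomial ℤ := Polynomial.C (x.den : ℤ) * Polynomial.X - Polynomial.C x.num
    have hl : l.IsPrimitive := by
      rw [Polynomial.isPrimitive_iff_isUnit_of_C_dvd]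
      intro r hr
      rw [Polynomial.C_dvd_iff_dvd_coeff] at hr
      have h0 := hr 0
      have h1 := hr 1
      simp only [l, Polynomial.coeff_sub, Polynomial.mul_coeff_zero, Polynomial.coeff_X_zero,
        mul_zero, zero_sub, Polynomial.coeff_C_zero, dvd_neg] at h0
      simp only [l, Polynomial.coeff_sub, Polynomial.coeff_C_mul, Polynomial.coeff_X_one,
        mul_one, Polynomial.coeff_C_succ, sub_zero] at h1
      have hc : IsCoprime x.num (x.den : ℤ) := by
        rw [Int.isCoprime_iff_gcd_eq_one]; exact x.reduced
      exact hc.isUnit_of_dvd' h0 h1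
    have hlk : (l ^ k).IsPrimitive := by
      induction k with
      | zero => simp [Polynomial.isPrimitive_one]
      | succ k ih => rw [pow_succ]; exact ih.mul hl
    have hlmap : l.map (Int.castRingHom ℚ) =
        Polynomial.C (x.den : ℚ) * (Polynomial.X - Polynomial.C x) := by
      simp only [l, Polynomial.map_sub, Polynomial.map_mul, Polynomial.map_C, Polynomial.map_X,
        mul_sub, ← Polynomial.C_mul]
      congr 2
      simp [Rat.den_mul_eq_num]
    have hdvd : (l ^ k).map (algebraMap ℤ ℚ) ∣ V.map (algebraMap ℤ ℚ) := by
      change (l ^ k).map (Int.castRingHom ℚ) ∣ Vq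
      rw [Polynomial.map_pow, hlmap, mul_pow, ← Polynomial.C_pow]
      have hu : IsUnit (Polynomial.C ((x.den : ℚ) ^ k)) :=
        Polynomial.isUnit_C.mpr (by simp)
      rw [hu.mul_left_dvd]
      exact Polynomial.pow_rootMultiplicity_dvd Vq x
    have h2 := Polynomial.leadingCoeff_dvd_leadingCoeff
      (hlk.dvd_of_fraction_map_dvd_fraction_map hdvd)
    have hlc : l.leadingCoeff = x.den := by
      have hd : (x.den : ℤ) ≠ 0 := by simp
      have : l = Polynomial.C (x.den : ℤ) * Polynomial.X + Polynomial.C (-x.num) := by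
        simp [l, sub_eq_add_neg]
      rw [this, Polynomial.leadingCoeff_linear hd]
    rwa [Polynomial.leadingCoeff_pow, hlc] at h2
  · have h := Polynomial.pow_mul_divByMonic_rootMultiplicity_eq Vq x
    have h2 := Polynomial.eval_divByMonic_pow_rootMultiplicity_ne_zero x hVq0
    set k := Vq.rootMultiplicity x
    set g := Vq /ₘ (Polynomial.X - Polynomial.C x) ^ k
    have h3 : Polynomial.taylor x Vq = Polynomial.X ^ k * Polynomial.taylor x g := by
      conv_lhs => rw [← h]
      rw [Polynomial.taylor_mul, Polynomial.taylor_pow]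
      simp
    rw [h3]
    have := Polynomial.coeff_X_pow_mul (Polynomial.taylor x g) k 0
    rw [zero_add, Polynomial.taylor_coeff_zero] at this
    rwa [this]

lemma sum_max_ge (s r : ℕ) (ε : ℝ) (hε : 0 < ε) (hε1 : ε ≤ 1) (hr : 0 < r) (hs : s ≤ r + 1) :
    s * (ε ^ 2 / 32) ≤ ∑ i : Fin s, max 0 (ε / 2 - (i : ℕ) / r) := by
  have hr' : (0 : ℝ) < r := by exact_mod_cast hr
  rw [Fin.sum_univ_eq_sum_range (fun i => max 0 (ε / 2 - (i : ℝ) / r))]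
  set k := min s (⌊ε * r / 4⌋₊ + 1) with hk
  have hk1 : (s : ℝ) * (ε / 8) ≤ k := by
    rw [hk, Nat.cast_min, le_min_iff]
    have hs' : (s : ℝ) ≤ r + 1 := by exact_mod_cast hs
    have hr1 : (1 : ℝ) ≤ r := by exact_mod_cast hr
    constructor
    · nlinarith [Nat.cast_nonneg (α := ℝ) s]
    · have := Nat.lt_floor_add_one (ε * r / 4)
      push_cast
      nlinarith
  calc (s : ℝ) * (ε ^ 2 / 32) = (s * (ε / 8)) * (ε / 4) := by ring
    _ ≤ k * (ε / 4) := by gcongr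
    _ = ∑ _i ∈ range k, ε / 4 := by simp
    _ ≤ ∑ i ∈ range k, max 0 (ε / 2 - (i : ℝ) / r) := by
        refine sum_le_sum fun i hi => le_max_of_le_right ?_
        have h1 : i ≤ ⌊ε * r / 4⌋₊ := by
          have := mem_range.mp hi; have := min_le_right s (⌊ε * r / 4⌋₊ + 1); omega
        have h2 : (i : ℝ) ≤ ε * r / 4 := (Nat.le_floor_iff (by positivity)).mp h1
        have h3 : (i : ℝ) / r ≤ ε / 4 := by rw [div_le_iff₀ hr']; linarith
        linarith
    _ ≤ _ := by
        refine sum_le_sum_of_subset_of_nonneg (range_subset_range.mpr (min_le_left _ _)) ?_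
        exact fun _ _ _ => le_max_left _ _

/-- Determinants of Hasse derivatives of a sum of products split. -/
lemma det_hasse_eq_tens {n s : ℕ} (p : MvPolynomial (Fin (n + 1)) ℤ)
    (φ : Fin s → MvPolynomial (Fin n) ℚ) (ψ : Fin s → Polynomial ℚ)
    (hp : map (Int.castRingHom ℚ) p = ∑ k, tens (φ k) (ψ k)) (d : Fin s → Fin n →₀ ℕ)
    (j : Fin s → ℕ) :
    map (Int.castRingHom ℚ) (Matrix.of fun i i' => hasse (Finsupp.cons (j i) (d i')) p).det =
      tens (Matrix.of fun i k => hasse (d i) (φ k)).det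
        (Matrix.of fun i k => Polynomial.hasseDeriv (j i) (ψ k)).det := by
  let f : MvPolynomial (Fin n) ℚ →+* MvPolynomial (Fin (n + 1)) ℚ := (rename Fin.succ).toRingHom
  let g : Polynomial ℚ →+* MvPolynomial (Fin (n + 1)) ℚ :=
    (Polynomial.aeval (X 0 : MvPolynomial (Fin (n + 1)) ℚ)).toRingHom
  change _ = f _ * g _
  rw [RingHom.map_det, RingHom.map_det, RingHom.map_det, mul_comm, ← Matrix.det_transpose
    (f.mapMatrix _), ← Matrix.det_mul]
  congr 1
  ext1 i i'
  simp only [RingHom.mapMatrix_apply, Matrix.map_apply, Matrix.of_apply, Matrix.mul_apply,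
    Matrix.transpose_apply]
  rw [← hasse_map, hp, hasse_sum]
  refine sum_congr rfl fun k _ => ?_
  rw [hasse_tens, mul_comm]; rfl

lemma indGE_det {σ : Type*} [Fintype σ] {x : σ → ℚ} {w : σ → ℝ} (hw : ∀ h, 0 ≤ w h) {s : ℕ}
    (M : Matrix (Fin s) (Fin s) (MvPolynomial σ ℤ)) (t : Fin s → ℝ)
    (hM : ∀ i i', IndGE x w (t i) (map (Int.castRingHom ℚ) (M i i'))) :
    IndGE x w (∑ i, t i) (map (Int.castRingHom ℚ) M.det) := by
  rw [Matrix.det_apply', map_sum]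
  refine IndGE.sum _ _ fun τ _ => ?_
  rw [map_mul, map_prod, ← zero_add (∑ i, t i)]
  refine (IndGE.of_nonpos hw le_rfl).mul ?_
  rw [← Equiv.sum_comp τ t]
  exact IndGE.prod hw _ _ _ fun i _ => hM _ _

/-- The nonvanishing statement of Roth's lemma, in `N` variables. -/
def RothLemma (N : ℕ) : Prop :=
  ∀ ε : ℝ, 0 < ε → ∃ ω : ℝ, 0 < ω ∧ ∀ (r : Fin N → ℕ), (∀ i, 0 < r i) →
    (∀ i j, i < j → (r i : ℝ) ≤ ω * r j) → ∀ (x : Fin N → ℚ) (Z : ℝ), 0 < Z →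
    (∀ i, Z ≤ r i * Real.log (x i).den) → ∀ p : MvPolynomial (Fin N) ℤ, p ≠ 0 →
    (∀ i, degreeOf i p ≤ r i) → Real.log (L1 p) + ∑ i, (r i : ℝ) ≤ ω * Z →
    ∃ J : Fin N →₀ ℕ, ∑ i, (J i : ℝ) * (1 / r i) < ε ∧
      coeff J (mtaylor x (map (Int.castRingHom ℚ) p)) ≠ 0

lemma RothLemma.mono_eps {N : ℕ} (h : ∀ ε : ℝ, 0 < ε → ε ≤ 1 → ∃ ω : ℝ, 0 < ω ∧
    ∀ (r : Fin N → ℕ), (∀ i, 0 < r i) →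
    (∀ i j, i < j → (r i : ℝ) ≤ ω * r j) → ∀ (x : Fin N → ℚ) (Z : ℝ), 0 < Z →
    (∀ i, Z ≤ r i * Real.log (x i).den) → ∀ p : MvPolynomial (Fin N) ℤ, p ≠ 0 →
    (∀ i, degreeOf i p ≤ r i) → Real.log (L1 p) + ∑ i, (r i : ℝ) ≤ ω * Z →
    ¬ IndGE x (fun i => 1 / r i) ε (map (Int.castRingHom ℚ) p)) : RothLemma N := by
  intro ε hε
  obtain ⟨ω, hω, H⟩ := h (min ε 1) (lt_min hε one_pos) (min_le_right _ _)
  refine ⟨ω, hω, fun r h1 h2 x Z h3 h4 p h5 h6 h7 => ?_⟩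
  have := H r h1 h2 x Z h3 h4 p h5 h6 h7
  simp only [IndGE, not_forall] at this
  obtain ⟨J, hJ, hJ'⟩ := this
  exact ⟨J, hJ.trans_le (min_le_left _ _), hJ'⟩

lemma rothLemma_zero : RothLemma 0 := by
  intro ε hε
  refine ⟨1, one_pos, fun r _ _ x Z _ _ p hp _ _ => ⟨0, by simpa using hε, ?_⟩⟩
  have hx : map (Int.castRingHom ℚ) p ≠ 0 := by
    rw [Ne, map_eq_zero_iff _ (map_injective _ Int.cast_injective)]; exact hp
  obtain ⟨e, he⟩ := ne_zero_iff.mp (mtaylor_ne_zero x hx)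
  rwa [Subsingleton.elim e 0] at he

lemma log_L1_det_le {n s : ℕ} (p : MvPolynomial (Fin (n + 1)) ℤ) (hp : p ≠ 0)
    (r : Fin (n + 1) → ℕ) (hr : ∀ i, degreeOf i p ≤ r i) (hs : s ≤ r 0 + 1)
    (D : Fin s → Fin s → Fin (n + 1) →₀ ℕ)
    (hW : (Matrix.of fun i i' => hasse (D i i') p).det ≠ 0) :
    Real.log (L1 (Matrix.of fun i i' => hasse (D i i') p).det) ≤
      s * (Real.log (L1 p) + 2 * ∑ i, (r i : ℝ)) := by
  have h1 := L1_det_le (Matrix.of fun i i' => hasse (D i i') p) (2 ^ (∑ h, r h) * L1 p)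
    fun i j => wnorm_hasse_le (by simp [normRingSeminorm_int]) _ _ r hr
  have hL := one_le_L1 hp
  have h2 := Real.log_le_log (lt_of_lt_of_le one_pos (one_le_L1 hW)) h1
  have hf : (0 : ℝ) < s.factorial := by exact_mod_cast s.factorial_pos
  rw [Real.log_mul hf.ne' (by positivity), Real.log_pow,
    Real.log_mul (by positivity) (by positivity),
    Real.log_pow] at h2
  have h3 : Real.log s.factorial ≤ s * ∑ i, (r i : ℝ) := by
    rcases Nat.eq_zero_or_pos s with rfl | hs0
    · simp
    have h4 : Real.log s.factorial ≤ Real.log ((s : ℝ) ^ s) :=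
      Real.log_le_log hf (by exact_mod_cast s.factorial_le_pow)
    rw [Real.log_pow] at h4
    refine h4.trans (mul_le_mul_of_nonneg_left ?_ (Nat.cast_nonneg _))
    have h5 := Real.log_le_sub_one_of_pos (x := (s : ℝ)) (by exact_mod_cast hs0)
    have h6 : (s : ℝ) ≤ r 0 + 1 := by exact_mod_cast hs
    have h7 : (r 0 : ℝ) ≤ ∑ i, (r i : ℝ) :=
      single_le_sum (f := fun i => (r i : ℝ)) (fun i _ => Nat.cast_nonneg _) (mem_univ 0)
    linarith
  have h8 : Real.log 2 ≤ 1 := Real.log_two_lt_d9.le.trans (by norm_num)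
  have h9 : (0 : ℝ) ≤ ∑ i, (r i : ℝ) := sum_nonneg fun i _ => Nat.cast_nonneg _
  have h10 : (s : ℝ) * (((∑ h, r h : ℕ) : ℝ) * Real.log 2) ≤ s * ∑ i, (r i : ℝ) := by
    push_cast
    exact mul_le_mul_of_nonneg_left (mul_le_of_le_one_right h9 h8) (Nat.cast_nonneg _)
  linarith

lemma rothLemma_succ {N : ℕ} (ih : RothLemma N) : RothLemma (N + 1) := by
  refine RothLemma.mono_eps fun ε hε hε1 => ?_
  set η := ε ^ 2 / 32 with hη
  have hη0 : 0 < η := by positivity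
  obtain ⟨ω', hω', H⟩ := ih (η / 2) (by positivity)
  set ω := min (min (ω' / 4) (η / 8)) (ε / 2) with hω
  have hω0 : 0 < ω := by simp only [hω, lt_min_iff]; refine ⟨⟨?_, ?_⟩, ?_⟩ <;> positivity
  have hω1 : ω ≤ ω' / 4 := (min_le_left _ _).trans (min_le_left _ _)
  have hω2 : ω ≤ η / 8 := (min_le_left _ _).trans (min_le_right _ _)
  have hω3 : ω ≤ ε / 2 := min_le_right _ _
  refine ⟨ω, hω0, fun r hr hrr x Z hZ hxZ p hp hdeg hlog hind => ?_⟩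
  have hrpos : ∀ i, (0 : ℝ) < r i := fun i => by exact_mod_cast hr i
  have hpq : map (Int.castRingHom ℚ) p ≠ 0 := by
    rw [Ne, map_eq_zero_iff _ (map_injective _ Int.cast_injective)]; exact hp
  obtain ⟨s, hs, φ, ψ, hφ, hψ, hsum⟩ := exists_eq_sum_tens (map (Int.castRingHom ℚ) p) (r 0) (by
    exact (degreeOf_le_iff.2 fun m hm => (monomial_le_degreeOf 0
      (support_map_subset _ _ hm)).trans (hdeg 0)))
  have hs0 : 0 < s := by
    rcases Nat.eq_zero_or_pos s with rfl | h
    · simp at hsum; exact absurd hsum hpq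
    · exact h
  have hs0' : (0 : ℝ) < s := by exact_mod_cast hs0
  obtain ⟨d, hd, hU⟩ := MvPolynomial.exists_wronskian φ hφ
  obtain ⟨j, hj, hV⟩ := Polynomial.exists_wronskian ψ hψ
  have hW := det_hasse_eq_tens p φ ψ hsum d j
  set M := Matrix.of fun i i' => hasse (Finsupp.cons (j i) (d i')) p with hM
  set U := (Matrix.of fun i k => hasse (d i) (φ k)).det
  set V := (Matrix.of fun i k => Polynomial.hasseDeriv (j i) (ψ k)).det
  have hcW : ∀ a m, ((coeff (Finsupp.cons a m) M.det : ℤ) : ℚ) = coeff m U * V.coeff a := by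
    intro a m
    rw [← coeff_tens, ← hW, coeff_map]; rfl
  obtain ⟨m0, hm0⟩ := ne_zero_iff.mp hU
  obtain ⟨a0, ha0⟩ : ∃ a, V.coeff a ≠ 0 := by
    by_contra! hc; exact hV (Polynomial.ext (by simpa using hc))
  have hW0 : M.det ≠ 0 := by
    intro h
    have := hcW a0 m0
    rw [h] at this
    simp at this
    exact this.elim hm0 ha0
  have hlogW : Real.log (L1 M.det) ≤ s * (2 * ω * Z) := by
    refine (log_L1_det_le p hp r hdeg hs _ hW0).trans ?_
    have := Real.log_nonneg (one_le_L1 hp)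
    gcongr
    linarith
  have hsumr : ∑ i, (r i : ℝ) ≤ ω * Z := by
    have := Real.log_nonneg (one_le_L1 hp)
    linarith
  -- the index of the determinant is large
  have hindW : IndGE x (fun i => 1 / (r i : ℝ)) (s * η) (map (Int.castRingHom ℚ) M.det) := by
    have hw : ∀ i, 0 ≤ 1 / (r i : ℝ) := fun i => by positivity
    refine (indGE_det hw M (fun i => max 0 (ε / 2 - (i : ℕ) / r 0)) ?_).mono
      (sum_max_ge s (r 0) ε hε hε1 (hr 0) hs)
    intro i i'
    rcases max_cases 0 (ε / 2 - (i : ℕ) / (r 0 : ℝ)) with ⟨h, _⟩ | ⟨h, _⟩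
    · simp only [h]; exact IndGE.of_nonpos hw le_rfl
    simp only [h]
    have := hind.hasse (Finsupp.cons (j i) (d i'))
    rw [hasse_map] at this
    refine this.mono ?_
    rw [Fin.sum_univ_succ]
    simp only [Finsupp.cons_zero, Finsupp.cons_succ]
    have h1 : (j i : ℝ) * (1 / r 0) ≤ (i : ℕ) / r 0 := by
      rw [mul_one_div]; gcongr; exact_mod_cast hj i
    have h2 : ∑ k : Fin N, (d i' k : ℝ) * (1 / r k.succ) ≤ ω := by
      calc ∑ k : Fin N, (d i' k : ℝ) * (1 / r k.succ)
          ≤ ∑ k : Fin N, (d i' k : ℝ) * (ω / r 0) := by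
            refine sum_le_sum fun k _ => mul_le_mul_of_nonneg_left ?_ (Nat.cast_nonneg _)
            rw [div_le_div_iff₀ (hrpos _) (hrpos _), one_mul]
            exact hrr 0 k.succ (Fin.succ_pos k)
        _ = ((d i').degree : ℝ) * (ω / r 0) := by
            rw [← sum_mul, Finsupp.degree_eq_sum]; push_cast; rfl
        _ ≤ r 0 * (ω / r 0) := by
            gcongr
            have h5 := hd i'
            have h6 := i'.2
            omega
        _ = ω := mul_div_cancel₀ _ (hrpos 0).ne'
    linarith
  -- a nonvanishing coefficient in the last variables
  set P := (finSuccEquiv ℤ N M.det).coeff a0 with hP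
  have hPU : map (Int.castRingHom ℚ) P = C (V.coeff a0) * U := by
    ext m
    rw [coeff_map, coeff_C_mul, hP, finSuccEquiv_coeff_coeff]
    exact (hcW a0 m).trans (mul_comm _ _)
  have hP0 : P ≠ 0 := by
    intro h
    rw [h, map_zero] at hPU
    exact mul_ne_zero (by simpa using ha0) hU hPU.symm
  obtain ⟨J, hJ, hJ'⟩ := H (fun i => s * r i.succ) (fun i => Nat.mul_pos hs0 (hr _))
    (fun i i' hii => by
      have h1 := hrr i.succ i'.succ (Fin.succ_lt_succ_iff.mpr hii)
      push_cast
      have h2 : ω * (r i'.succ : ℝ) ≤ ω' * r i'.succ := by gcongr; linarith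
      nlinarith)
    (fun i => x i.succ) (s * Z) (by positivity)
    (fun i => by
      push_cast
      rw [mul_assoc]
      exact mul_le_mul_of_nonneg_left (hxZ i.succ) hs0'.le)
    P hP0 (fun i => by
      refine (degreeOf_coeff_finSuccEquiv _ _ _).trans (degreeOf_det_le _ _ _ fun k k' => ?_)
      exact (degreeOf_hasse_le _ _ _).trans (hdeg _))
    (by
      have h1 : Real.log (L1 P) ≤ s * (2 * ω * Z) :=
        (Real.log_le_log (lt_of_lt_of_le one_pos (one_le_L1 hP0)) (L1_slice_le _ _)).trans hlogW
      have h2 : ∑ i : Fin N, ((s * r i.succ : ℕ) : ℝ) ≤ s * (ω * Z) := by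
        push_cast
        rw [← mul_sum]
        refine mul_le_mul_of_nonneg_left (le_trans ?_ hsumr) hs0'.le
        rw [Fin.sum_univ_succ]
        linarith [hrpos 0]
      have h3 : 4 * ω * (s * Z) ≤ ω' * (s * Z) := by gcongr; linarith
      have h4 : 0 < ω * (s * Z) := by positivity
      linarith)
  -- a nonvanishing coefficient in the first variable
  let Q : Polynomial ℤ := ∑ a ∈ range ((finSuccEquiv ℤ N M.det).natDegree + 1),
    Polynomial.monomial a (coeff (Finsupp.cons a m0) M.det)
  have hQc : ∀ a, Q.coeff a = coeff (Finsupp.cons a m0) M.det := by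
    intro a
    simp only [Q, Polynomial.finsetSum_coeff, Polynomial.coeff_monomial]
    rw [Finset.sum_ite_eq']
    split_ifs with h
    · rfl
    · rw [← finSuccEquiv_coeff_coeff, Polynomial.coeff_eq_zero_of_natDegree_lt, coeff_zero]
      simpa using h
  have hQV : Q.map (Int.castRingHom ℚ) = Polynomial.C (coeff m0 U) * V := by
    ext a
    rw [Polynomial.coeff_map, hQc, Polynomial.coeff_C_mul]
    exact hcW a m0
  have hQ0 : Q ≠ 0 := by
    intro h
    rw [h, Polynomial.map_zero] at hQV
    exact mul_ne_zero (by simpa using hm0) hV hQV.symm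
  obtain ⟨k, hk1, hk2⟩ := exists_taylor_coeff_ne_zero Q hQ0 (x 0)
  have hk3 : (k : ℝ) * (1 / r 0) ≤ s * η / 4 := by
    have h1 : ((x 0).den : ℝ) ^ k ≤ L1 M.det := by
      refine le_trans ?_ (abs_coeff_le_L1 M.det (Finsupp.cons Q.natDegree m0))
      rw [← hQc]
      have := Int.le_of_dvd (abs_pos.mpr (Polynomial.leadingCoeff_ne_zero.mpr hQ0))
        ((dvd_abs _ _).mpr hk1)
      exact_mod_cast this
    have hden : (0 : ℝ) < (x 0).den := by exact_mod_cast (x 0).den_pos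
    have h2 := (Real.log_le_log (by positivity) h1).trans hlogW
    rw [Real.log_pow] at h2
    have h3 : (s : ℝ) * (2 * ω * Z) ≤ s * (2 * ω * (r 0 * Real.log (x 0).den)) := by
      gcongr; exact hxZ 0
    have h4 : 0 < Real.log (x 0).den := by
      have := hZ.trans_le (hxZ 0)
      exact (pos_iff_pos_of_mul_pos this).mp (hrpos 0)
    have h5 : (k : ℝ) ≤ s * (2 * ω) * r 0 := by
      refine le_of_mul_le_mul_right ?_ h4
      linarith
    rw [mul_one_div, div_le_iff₀ (hrpos 0)]
    refine h5.trans ?_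
    have : s * (2 * ω) ≤ s * η / 4 := by nlinarith
    exact mul_le_mul_of_nonneg_right this (hrpos 0).le
  rw [hPU, map_mul, mtaylor, aeval_C, algebraMap_eq, coeff_C_mul] at hJ'
  rw [hQV, Polynomial.taylor_mul, Polynomial.taylor_C, Polynomial.coeff_C_mul] at hk2
  have := hindW (Finsupp.cons k J) (by
    rw [Fin.sum_univ_succ]
    simp only [Finsupp.cons_zero, Finsupp.cons_succ]
    have h1 : ∑ i : Fin N, (J i : ℝ) * (1 / r i.succ) =
        s * ∑ i : Fin N, (J i : ℝ) * (1 / ((s * r i.succ : ℕ) : ℝ)) := by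
      rw [mul_sum]
      refine sum_congr rfl fun i _ => ?_
      have := hrpos i.succ
      push_cast; field_simp
    rw [h1]
    have h2 := mul_lt_mul_of_pos_left hJ hs0'
    have h3 : 0 < s * η := by positivity
    linarith)
  rw [hW, mtaylor_tens, coeff_tens] at this
  exact mul_ne_zero (right_ne_zero_of_mul hJ') (right_ne_zero_of_mul hk2) this

/-- **Roth's lemma**. -/
theorem rothLemma (N : ℕ) : RothLemma N := by
  induction N with
  | zero => exact rothLemma_zero
  | succ N ih => exact rothLemma_succ ih

lemma sum_sq_sum_le {ι : Type*} [Fintype ι] [DecidableEq ι] {κ : ι → Type*}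
    [∀ i, DecidableEq (κ i)] (S : ∀ i, Finset (κ i)) (g : ∀ i, κ i → ℝ) (B : ℝ)
    (h0 : ∀ i, ∑ x ∈ S i, g i x = 0) (hB : ∀ i, ∀ x ∈ S i, |g i x| ≤ B) :
    ∑ e ∈ Fintype.piFinset S, (∑ i, g i (e i)) ^ 2 ≤
      #(Fintype.piFinset S) * (Fintype.card ι * B ^ 2) := by
  have hcross : ∀ i j, i ≠ j → ∑ e ∈ Fintype.piFinset S, g i (e i) * g j (e j) = 0 := by
    intro i j hij
    have h := prod_univ_sum S
      (fun k x => (if k = i then g k x else 1) * (if k = j then g k x else 1))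
    simp only [prod_mul_distrib, prod_ite_eq', mem_univ, if_true] at h
    rw [← h]
    refine prod_eq_zero (mem_univ i) ?_
    simp [hij, h0]
  simp_rw [sq, sum_mul_sum]
  rw [sum_comm]
  have : ∀ i, ∑ e ∈ Fintype.piFinset S, ∑ j, g i (e i) * g j (e j) ≤
      #(Fintype.piFinset S) * B ^ 2 := by
    intro i
    rw [sum_comm, sum_eq_single i (fun j _ hj => hcross i j hj.symm) (by simp), ← nsmul_eq_mul]
    refine sum_le_card_nsmul _ _ _ fun e he => ?_
    rw [← sq, ← sq_abs]
    exact pow_le_pow_left₀ (abs_nonneg _) (hB i _ (Fintype.mem_piFinset.1 he i)) 2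
  refine (sum_le_card_nsmul _ _ _ fun i _ => this i).trans_eq ?_
  simp only [card_univ, nsmul_eq_mul, ← sq]; ring

lemma three_mul_sum_piAntidiag (r : ℕ) (k : Fin 3) :
    3 * ∑ f ∈ piAntidiag (univ : Finset (Fin 3)) r, (f k : ℝ) =
      r * #(piAntidiag (univ : Finset (Fin 3)) r) := by
  have hs : ∀ k', ∑ f ∈ piAntidiag (univ : Finset (Fin 3)) r, (f k' : ℝ) =
      ∑ f ∈ piAntidiag (univ : Finset (Fin 3)) r, (f k : ℝ) := by
    intro k'
    refine sum_equiv ((Equiv.swap k k').arrowCongr (Equiv.refl ℕ)) (fun f => ?_) fun f _ => ?_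
    · simp only [mem_piAntidiag, mem_univ, implies_true, and_true]
      rw [← Equiv.sum_comp (Equiv.swap k k')]
      simp [Equiv.arrowCongr]
    · simp [Equiv.arrowCongr]
  have : ∑ k', ∑ f ∈ piAntidiag (univ : Finset (Fin 3)) r, (f k' : ℝ) =
      r * #(piAntidiag (univ : Finset (Fin 3)) r) := by
    rw [sum_comm, mul_comm, ← nsmul_eq_mul]
    refine sum_eq_card_nsmul fun f hf => ?_
    have := (mem_piAntidiag.1 hf).1
    exact_mod_cast this
  rw [← this, sum_congr rfl fun k' _ => hs k']
  simp

lemma card_piAntidiag_three_le (r : ℕ) : #(piAntidiag (univ : Finset (Fin 3)) r) ≤ 4 ^ r := by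
  have : #(piAntidiag (univ : Finset (Fin 3)) r) ≤ (r + 1) * (r + 1) := by
    have : #(piAntidiag (univ : Finset (Fin 3)) r) ≤ #(range (r + 1) ×ˢ range (r + 1)) := by
      refine card_le_card_of_injOn (fun f => (f 0, f 1)) (fun f hf => ?_) fun f hf g hg hfg => ?_
      · have := (mem_piAntidiag.1 hf).1
        rw [Fin.sum_univ_three] at this
        simp only [coe_product, Set.mem_prod, mem_coe, mem_range]
        omega
      · have h1 := (mem_piAntidiag.1 hf).1
        have h2 := (mem_piAntidiag.1 hg).1
        rw [Fin.sum_univ_three] at h1 h2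
        simp only [Prod.mk.injEq] at hfg
        ext k; fin_cases k
        · exact hfg.1
        · exact hfg.2
        · simp; omega
    simpa using this
  refine this.trans ?_
  have h2 : r + 1 ≤ 2 ^ r := Nat.lt_two_pow_self
  calc (r + 1) * (r + 1) ≤ 2 ^ r * 2 ^ r := Nat.mul_le_mul h2 h2
    _ = 4 ^ r := by rw [← mul_pow]; norm_num

/-- Exponents of the monomials of multidegree `r`, in blocks of three variables. -/
noncomputable def multiExp {N : ℕ} (r : Fin N → ℕ) : Finset (Fin N × Fin 3 →₀ ℕ) :=
  (Fintype.piFinset fun h => piAntidiag (univ : Finset (Fin 3)) (r h)).map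
    ((Equiv.curry (Fin N) (Fin 3) ℕ).symm.trans Finsupp.equivFunOnFinite.symm).toEmbedding

lemma mem_multiExp {N : ℕ} {r : Fin N → ℕ} {e : Fin N × Fin 3 →₀ ℕ} :
    e ∈ multiExp r ↔ ∀ h, ∑ k, e (h, k) = r h := by
  simp only [multiExp, mem_map_equiv, Fintype.mem_piFinset, mem_piAntidiag, mem_univ,
    implies_true, and_true]
  rfl

lemma card_multiExp {N : ℕ} (r : Fin N → ℕ) : #(multiExp r) ≤ 4 ^ ∑ h, r h := by
  rw [multiExp, card_map, Fintype.card_piFinset, ← prod_pow_eq_pow_sum]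
  exact prod_le_prod' fun h _ => card_piAntidiag_three_le _

lemma multiExp_nonempty {N : ℕ} (r : Fin N → ℕ) : (multiExp r).Nonempty := by
  refine ⟨Finsupp.equivFunOnFinite.symm fun p => if p.2 = 0 then r p.1 else 0, ?_⟩
  simp [mem_multiExp]

lemma card_bad_le {N : ℕ} (hN : 0 < N) (r : Fin N → ℕ) (hr : ∀ h, 0 < r h) (c : Fin 3 → ℝ)
    (δ cm : ℝ) (hδ : 0 < δ) (hc : ∑ k, c k ≤ -δ) (hcm : ∀ k, |c k| ≤ cm) :
    (#{e ∈ multiExp r | -(N * δ / 6) < ∑ h, ∑ k, c k * (e (h, k) / r h)} : ℝ) * (N * δ ^ 2) ≤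
      144 * cm ^ 2 * #(multiExp r) := by
  have hcm0 : 0 ≤ cm := (abs_nonneg _).trans (hcm 0)
  set S : Fin N → Finset (Fin 3 → ℕ) := fun h => piAntidiag (univ : Finset (Fin 3)) (r h) with hS
  set g : Fin N → (Fin 3 → ℕ) → ℝ := fun h f => ∑ k, c k * (f k / r h) - (∑ k, c k) / 3 with hg
  have hr' : ∀ h, (0 : ℝ) < r h := fun h => by exact_mod_cast hr h
  have hsum1 : ∀ h, ∀ f ∈ S h, ∑ k, (f k : ℝ) / r h = 1 := by
    intro h f hf
    have := (mem_piAntidiag.1 hf).1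
    rw [← sum_div, ← this, Nat.cast_sum]
    refine div_self ?_
    rw [← Nat.cast_sum, this]; exact (hr' h).ne'
  have h0 : ∀ h, ∑ f ∈ S h, g h f = 0 := by
    intro h
    simp only [hg, sum_sub_distrib, sum_const, nsmul_eq_mul]
    rw [sum_comm]
    have : ∀ k, ∑ f ∈ S h, c k * ((f k : ℝ) / r h) = c k * (#(S h) / 3) := by
      intro k
      have h3 := three_mul_sum_piAntidiag (r h) k
      rw [← mul_sum, ← sum_div]
      congr 1
      have := (hr' h).ne'
      field_simp
      rw [mul_comm, h3]
    simp_rw [this, ← sum_mul]; ring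
  have hB : ∀ h, ∀ f ∈ S h, |g h f| ≤ 2 * cm := by
    intro h f hf
    have h1 : |∑ k, c k * ((f k : ℝ) / r h)| ≤ cm := by
      refine (abs_sum_le_sum_abs _ _).trans ?_
      calc ∑ k, |c k * ((f k : ℝ) / r h)| ≤ ∑ k, cm * ((f k : ℝ) / r h) := by
            refine sum_le_sum fun k _ => ?_
            have : (0 : ℝ) ≤ (f k : ℝ) / r h := by positivity
            rw [abs_mul, abs_of_nonneg this]
            exact mul_le_mul_of_nonneg_right (hcm k) this
        _ = cm := by rw [← mul_sum, hsum1 h f hf, mul_one]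
    have h2 : |(∑ k, c k) / 3| ≤ cm := by
      rw [Fin.sum_univ_three]
      have a := abs_le.1 (hcm 0); have b := abs_le.1 (hcm 1); have d := abs_le.1 (hcm 2)
      rw [abs_le]; constructor <;> linarith
    calc |g h f| ≤ _ := abs_sub _ _
      _ ≤ _ := by linarith
  have key := sum_sq_sum_le S g (2 * cm) h0 hB
  have hE : #(Fintype.piFinset S) = #(multiExp r) := by rw [multiExp, card_map]
  rw [hE, Fintype.card_fin] at key
  have hNp : (0 : ℝ) < N := by exact_mod_cast hN
  have hle : (#{e ∈ multiExp r | -(N * δ / 6) < ∑ h, ∑ k, c k * ((e (h, k) : ℝ) / r h)} : ℝ) *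
      (N * δ / 6) ^ 2 ≤ ∑ e ∈ Fintype.piFinset S, (∑ h, g h (e h)) ^ 2 := by
    have : ∑ e ∈ Fintype.piFinset S, (∑ h, g h (e h)) ^ 2 =
        ∑ e ∈ multiExp r, (∑ h, g h (fun k => e (h, k))) ^ 2 := by
      rw [multiExp, sum_map]; rfl
    rw [this, ← nsmul_eq_mul]
    refine (card_nsmul_le_sum _ _ _ fun e he => ?_).trans
      (sum_le_sum_of_subset_of_nonneg (filter_subset _ _) fun _ _ _ => sq_nonneg _)
    have he := (mem_filter.1 he).2
    refine pow_le_pow_left₀ (by positivity) ?_ 2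
    simp only [hg, sum_sub_distrib, sum_const, card_univ, Fintype.card_fin, nsmul_eq_mul]
    have : (N : ℝ) * ((∑ k, c k) / 3) ≤ N * (-δ / 3) := by gcongr
    linarith
  have := hle.trans key
  have e1 : (N * δ / 6 : ℝ) ^ 2 = N * δ ^ 2 * (N / 36) := by ring
  rw [e1, ← mul_assoc] at this
  refine le_of_mul_le_mul_right (this.trans_eq ?_) (by positivity : (0 : ℝ) < N / 36)
  ring

section lsub
variable {N : ℕ} {R S : Type*} [CommRing R] [CommRing S] [Algebra S R]

/-- Blockwise linear substitution. -/
noncomputable def lsub (M : Fin N → Matrix (Fin 3) (Fin 3) R) :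
    MvPolynomial (Fin N × Fin 3) S →ₐ[S] MvPolynomial (Fin N × Fin 3) R :=
  aeval fun p => ∑ k, monomial (Finsupp.single (p.1, k) 1) (M p.1 p.2 k)

lemma lsub_lsub (M M' : Fin N → Matrix (Fin 3) (Fin 3) R) (P : MvPolynomial (Fin N × Fin 3) S) :
    (lsub M' (lsub M P : MvPolynomial (Fin N × Fin 3) R) : MvPolynomial (Fin N × Fin 3) R) =
      lsub (fun h => M h * M' h) P := by
  suffices h : ((lsub M' : MvPolynomial (Fin N × Fin 3) R →ₐ[R] _).restrictScalars S).comp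
      (lsub M : MvPolynomial (Fin N × Fin 3) S →ₐ[S] _) = lsub (fun h => M h * M' h) from
    DFunLike.congr_fun h P
  refine algHom_ext fun p => ?_
  have hm : ∀ k a, (lsub M' (monomial (Finsupp.single (p.1, k) 1) a :
      MvPolynomial (Fin N × Fin 3) R) : MvPolynomial (Fin N × Fin 3) R) =
      ∑ l, monomial (Finsupp.single (p.1, l) 1) (a * M' p.1 k l) := by
    intro k a
    rw [lsub, aeval_monomial, Finsupp.prod_single_index (by simp), pow_one, algebraMap_eq, mul_sum]
    simp only [C_mul_monomial]
  simp only [AlgHom.comp_apply, AlgHom.restrictScalars_apply]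
  have h1 : (lsub M (X p : MvPolynomial (Fin N × Fin 3) S) : MvPolynomial (Fin N × Fin 3) R) =
      ∑ k, monomial (Finsupp.single (p.1, k) 1) (M p.1 p.2 k) := by rw [lsub, aeval_X]
  rw [h1, map_sum]
  simp only [hm]
  rw [sum_comm]
  simp only [lsub, aeval_X, Matrix.mul_apply, map_sum]

lemma support_lsub_subset (M : Fin N → Matrix (Fin 3) (Fin 3) R) {r : Fin N → ℕ}
    {P : MvPolynomial (Fin N × Fin 3) S} (hP : P.support ⊆ multiExp r) :
    (lsub M P : MvPolynomial (Fin N × Fin 3) R).support ⊆ multiExp r := by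
  classical
  have hwt : ∀ (h : Fin N) (e : Fin N × Fin 3 →₀ ℕ),
      Finsupp.weight (fun p : Fin N × Fin 3 => if p.1 = h then 1 else 0) e = ∑ k, e (h, k) := by
    intro h e
    rw [Finsupp.weight_apply, Finsupp.sum_fintype _ _ (by simp), Fintype.sum_prod_type,
      sum_eq_single h (fun b _ hb => by simp [hb]) (by simp)]
    simp
  intro e he
  rw [mem_multiExp]
  intro h
  set w : Fin N × Fin 3 → ℕ := fun p => if p.1 = h then 1 else 0 with hw
  have hom : IsWeightedHomogeneous w (lsub M P : MvPolynomial (Fin N × Fin 3) R) (r h) := by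
    rw [lsub, aeval_def, eval₂_eq]
    refine IsWeightedHomogeneous.sum _ _ _ fun d hd => ?_
    rw [MvPolynomial.algebraMap_apply]
    refine IsWeightedHomogeneous.C_mul ?_ _
    have h2 : ∑ p ∈ d.support, d p • w p = r h := by
      have := hwt h d
      rw [mem_multiExp.1 (hP hd) h, Finsupp.weight_apply] at this
      exact this
    rw [← h2]
    refine IsWeightedHomogeneous.prod _ _ _ fun p _ => IsWeightedHomogeneous.pow ?_ _
    refine IsWeightedHomogeneous.sum _ _ _ fun k _ => ?_
    refine isWeightedHomogeneous_monomial _ _ _ ?_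
    rw [Finsupp.weight_apply, Finsupp.sum_single_index (by simp)]
    simp [hw]
  rw [← hwt h e]
  exact hom (mem_support_iff.1 he)

lemma wnorm_lsub_le {ν : RingSeminorm R} {μ : RingSeminorm S} {wt u : Fin N × Fin 3 → ℝ}
    (h1 : ν 1 ≤ 1) (hμ : ∀ c, ν (algebraMap S R c) ≤ μ c) (hw : ∀ i, 0 ≤ wt i)
    (M : Fin N → Matrix (Fin 3) (Fin 3) R)
    (hu : ∀ h j, ∑ k, ν (M h j k) * wt (h, k) ≤ u (h, j)) (P : MvPolynomial (Fin N × Fin 3) S) :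
    wnorm ν wt (lsub M P : MvPolynomial (Fin N × Fin 3) R) ≤ wnorm μ u P := by
  refine wnorm_aeval_le h1 hμ hw _ u (fun p => ?_) P
  refine (wnorm_sum_le hw _ _).trans (le_trans (sum_le_sum fun k _ => ?_) (hu p.1 p.2))
  rw [wnorm_monomial, Finsupp.prod_single_index (by simp), pow_one]

end lsub

lemma prod_const_multiExp {N : ℕ} {r : Fin N → ℕ} {e : Fin N × Fin 3 →₀ ℕ} (he : e ∈ multiExp r)
    (s : ℝ) : (e.prod fun _ k => s ^ k) = s ^ ∑ h, r h := by
  rw [Finsupp.prod_fintype _ _ (by simp), prod_pow_eq_pow_sum, Fintype.sum_prod_type,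
    sum_congr rfl fun h _ => mem_multiExp.1 he h]

attribute [local instance] Matrix.linftyOpNormedRing Matrix.linftyOpNormedAlgebra in
lemma exists_ringSeminorm (O : Type*) [CommRing O] [Module.Free ℤ O] [Module.Finite ℤ O]
    [Nontrivial O] : ∃ (d : ℕ) (Λ : O →+* Matrix (Fin d) (Fin d) ℤ) (ν : RingSeminorm O),
      0 < d ∧ Function.Injective Λ ∧ ν 1 ≤ 1 ∧ (∀ c : ℤ, ν c ≤ |(c : ℝ)|) ∧
      ∀ x a b, |(Λ x a b : ℝ)| ≤ ν x := by
  classical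
  let b := Module.finBasis ℤ O
  have hd : 0 < Module.finrank ℤ O := Module.finrank_pos
  have : Nonempty (Fin (Module.finrank ℤ O)) := ⟨⟨0, hd⟩⟩
  let Λ : O →+* Matrix (Fin (Module.finrank ℤ O)) (Fin (Module.finrank ℤ O)) ℤ :=
    (Algebra.leftMulMatrix b).toRingHom
  let Φ : O →+* Matrix (Fin (Module.finrank ℤ O)) (Fin (Module.finrank ℤ O)) ℝ :=
    (Int.castRingHom ℝ).mapMatrix.comp Λ
  let ν : RingSeminorm O :=
    { toFun := fun x => ‖Φ x‖
      map_zero' := by simp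
      add_le' := fun x y => by rw [map_add]; exact norm_add_le _ _
      neg' := fun x => by rw [map_neg, norm_neg]
      mul_le' := fun x y => by rw [map_mul]; exact norm_mul_le _ _ }
  refine ⟨_, Λ, ν, hd, Algebra.leftMulMatrix_injective b, ?_, ?_, ?_⟩
  · change ‖Φ 1‖ ≤ 1
    rw [map_one, norm_one]
  · intro c
    change ‖Φ c‖ ≤ _
    rw [map_intCast, ← zsmul_one, ← Int.cast_smul_eq_zsmul ℝ, norm_smul, norm_one, mul_one,
      Real.norm_eq_abs]
  · intro x a b'
    change _ ≤ ‖Φ x‖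
    rw [Matrix.linfty_opNorm_def]
    have h1 : (|(Λ x a b' : ℝ)|) ≤ ((∑ j, ‖Φ x a j‖₊ : NNReal) : ℝ) := by
      push_cast
      refine le_trans (le_of_eq ?_) (single_le_sum (fun j _ => norm_nonneg (Φ x a j)) (mem_univ b'))
      rw [Real.norm_eq_abs]; rfl
    exact h1.trans (NNReal.coe_le_coe.2 (le_sup (f := fun i => ∑ j, ‖Φ x i j‖₊) (mem_univ a)))

attribute [local instance] Matrix.seminormedAddCommGroup in
lemma exists_auxiliary {O : Type*} [CommRing O] [Module.Free ℤ O] [Module.Finite ℤ O]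
    [Nontrivial O] (M : Matrix (Fin 3) (Fin 3) O) : ∃ D C : ℝ, 0 < D ∧ 1 ≤ C ∧
    ∀ (N : ℕ) (r : Fin N → ℕ) (bad : Finset (Fin N × Fin 3 →₀ ℕ)), D * #bad ≤ #(multiExp r) →
      ∃ P : MvPolynomial (Fin N × Fin 3) ℤ, P ≠ 0 ∧ P.support ⊆ multiExp r ∧
        L1 P ≤ C ^ ∑ h, r h ∧
        ∀ i ∈ bad, coeff i (lsub (fun _ => M) P : MvPolynomial (Fin N × Fin 3) O) = 0 := by
  classical
  obtain ⟨d, Λ, ν, hd, hΛ, hν1, hνc, hν⟩ := exists_ringSeminorm O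
  set s : ℝ := 1 + ∑ j, ∑ k, ν (M j k) with hs
  have hs1 : 1 ≤ s := by
    have : 0 ≤ ∑ j, ∑ k, ν (M j k) := sum_nonneg fun j _ => sum_nonneg fun k _ => apply_nonneg ν _
    linarith
  refine ⟨2 * d ^ 2, 16 * s, by positivity, by linarith, fun N r bad hbad => ?_⟩
  have hentry : ∀ e ∈ multiExp r, ∀ i, ν (coeff i
      (lsub (fun _ => M) (monomial e (1 : ℤ)) : MvPolynomial (Fin N × Fin 3) O)) ≤
      s ^ ∑ h, r h := by
    intro e he i
    have h1 := wnorm_lsub_le (S := ℤ) (ν := ν) (μ := normRingSeminorm ℤ) (wt := fun _ => 1)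
      (u := fun _ => s) hν1 (fun c => by
        simpa [normRingSeminorm_int] using hνc c) (fun _ => zero_le_one)
      (fun _ : Fin N => M) (fun h j => by
        simp only [mul_one]
        have : ∑ k, ν (M j k) ≤ ∑ j, ∑ k, ν (M j k) :=
          single_le_sum (f := fun j => ∑ k, ν (M j k))
            (fun j _ => sum_nonneg fun k _ => apply_nonneg ν _) (mem_univ j)
        linarith) (monomial e 1)
    rw [wnorm_monomial, prod_const_multiExp he] at h1
    have h2 := le_wnorm (ν := ν) (wt := fun _ => 1) (fun _ => zero_le_one)
      (lsub (fun _ => M) (monomial e (1 : ℤ)) : MvPolynomial (Fin N × Fin 3) O) i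
    simp only [one_pow, Finsupp.prod, prod_const_one, mul_one] at h2
    refine h2.trans (h1.trans_eq ?_)
    simp [normRingSeminorm_int]
  have hcard : (#(multiExp r) : ℝ) ≤ 4 ^ ∑ h, r h := by exact_mod_cast card_multiExp r
  have hEpos : 0 < #(multiExp r) := card_pos.2 (multiExp_nonempty r)
  rcases bad.eq_empty_or_nonempty with rfl | hne
  · obtain ⟨e, he⟩ := multiExp_nonempty r
    refine ⟨monomial e 1, by simp, support_monomial_subset.trans (by simpa), ?_, by simp⟩
    rw [L1, wnorm_monomial]
    simpa [normRingSeminorm_int] using one_le_pow₀ (by linarith : 1 ≤ 16 * s)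
  let A : Matrix (bad × Fin d × Fin d) (multiExp r) ℤ := fun i e =>
    Λ (coeff i.1.1 (lsub (fun _ => M) (monomial e.1 (1 : ℤ)) :
      MvPolynomial (Fin N × Fin 3) O)) i.2.1 i.2.2
  have hα : Fintype.card (bad × Fin d × Fin d) = #bad * d ^ 2 := by simp [sq]
  have hβ : Fintype.card (multiExp r) = #(multiExp r) := by simp
  have hαβ : 2 * (#bad * d ^ 2) ≤ #(multiExp r) := by
    have : (2 : ℝ) * (#bad * d ^ 2) ≤ #(multiExp r) := by linarith
    exact_mod_cast this
  have hbp : 0 < #bad * d ^ 2 := by have := card_pos.2 hne; positivity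
  obtain ⟨t, ht0, hAt, htn⟩ := Int.Matrix.exists_ne_zero_int_vec_norm_le A
    (by rw [hα, hβ]; omega) (by rw [hα]; exact hbp)
  have hA : ‖A‖ ≤ s ^ ∑ h, r h := by
    refine (Matrix.norm_le_iff (by positivity)).2 fun i e => ?_
    rw [Int.norm_eq_abs]
    exact (hν _ _ _).trans (hentry e.1 e.2 _)
  have htn' : ‖t‖ ≤ 4 ^ (∑ h, r h) * s ^ (∑ h, r h) := by
    refine htn.trans ?_
    have h1 : (1 : ℝ) ≤ Fintype.card (multiExp r) * max 1 ‖A‖ := by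
      rw [hβ]
      have : (1 : ℝ) ≤ #(multiExp r) := by exact_mod_cast hEpos
      exact one_le_mul_of_one_le_of_one_le this (le_max_left _ _)
    have h2 : ((Fintype.card (bad × Fin d × Fin d) : ℝ) /
        (Fintype.card (multiExp r) - Fintype.card (bad × Fin d × Fin d))) ≤ 1 := by
      rw [hα, hβ]
      have h3 : (2 : ℝ) * ((#bad * d ^ 2 : ℕ) : ℝ) ≤ #(multiExp r) := by exact_mod_cast hαβ
      have h4 : (0 : ℝ) < ((#bad * d ^ 2 : ℕ) : ℝ) := by exact_mod_cast hbp
      rw [div_le_one (by linarith)]; linarith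
    refine (Real.rpow_le_rpow_of_exponent_le h1 h2).trans ?_
    rw [Real.rpow_one, hβ]
    refine mul_le_mul hcard (max_le (one_le_pow₀ hs1) hA) (by positivity) (by positivity)
  set P : MvPolynomial (Fin N × Fin 3) ℤ := ∑ e : multiExp r, monomial e.1 (t e) with hP
  have hcoeff : ∀ e : multiExp r, coeff e.1 P = t e := by
    intro e
    rw [hP, coeff_sum, sum_eq_single e (fun b _ hb => by
      rw [coeff_monomial, if_neg fun h => hb (Subtype.ext h)]) (by simp), coeff_monomial,
      if_pos rfl]
  have hsupp : P.support ⊆ multiExp r := by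
    refine support_sum.trans (biUnion_subset.2 fun e _ => ?_)
    exact support_monomial_subset.trans (by simp)
  refine ⟨P, ?_, hsupp, ?_, ?_⟩
  · intro h
    refine ht0 (funext fun e => ?_)
    rw [← hcoeff, h]; simp
  · rw [L1, wnorm_eq_sum hsupp, ← sum_coe_sort]
    have : ∀ e : multiExp r, (normRingSeminorm ℤ) (coeff e.1 P) *
        (e.1.prod fun _ k => (1 : ℝ) ^ k) ≤ 4 ^ (∑ h, r h) * s ^ (∑ h, r h) := by
      intro e
      simp only [one_pow, Finsupp.prod, prod_const_one, mul_one]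
      rw [hcoeff]
      exact (norm_le_pi_norm t e).trans htn'
    refine (sum_le_card_nsmul _ _ _ fun e _ => this e).trans ?_
    rw [nsmul_eq_mul, card_univ, hβ]
    calc (#(multiExp r) : ℝ) * (4 ^ (∑ h, r h) * s ^ (∑ h, r h)) ≤
        4 ^ (∑ h, r h) * (4 ^ (∑ h, r h) * s ^ (∑ h, r h)) := by gcongr
      _ = _ := by rw [← mul_pow, ← mul_pow]; ring
  · intro i hi
    refine hΛ (Matrix.ext fun a b => ?_)
    have h1 := congr_fun hAt (⟨i, hi⟩, a, b)
    simp only [Matrix.mulVec, dotProduct, Pi.zero_apply, A] at h1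
    rw [map_zero, Matrix.zero_apply, ← h1, hP, map_sum, coeff_sum, map_sum, Matrix.sum_apply]
    refine sum_congr rfl fun e _ => ?_
    have : (monomial e.1 (t e) : MvPolynomial (Fin N × Fin 3) ℤ) = t e • monomial e.1 1 := by
      rw [smul_monomial]; simp
    rw [this, map_zsmul, coeff_smul, map_zsmul, Matrix.smul_apply, smul_eq_mul, mul_comm]

/-- The exponents of the `k`-th variables of all the blocks. -/
noncomputable def blockExp {N : ℕ} (k : Fin 3) (e : Fin N × Fin 3 →₀ ℕ) : Fin N →₀ ℕ :=
  Finsupp.equivFunOnFinite.symm fun h => e (h, k)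

@[simp] lemma blockExp_apply {N : ℕ} (k : Fin 3) (e : Fin N × Fin 3 →₀ ℕ) (h : Fin N) :
    blockExp k e h = e (h, k) := rfl

lemma multiExp_ext {N : ℕ} {r : Fin N → ℕ} {e f : Fin N × Fin 3 →₀ ℕ} (he : e ∈ multiExp r)
    (hf : f ∈ multiExp r) (h1 : blockExp 1 e = blockExp 1 f) (h2 : blockExp 2 e = blockExp 2 f) :
    e = f := by
  ext ⟨h, k⟩
  have a := mem_multiExp.1 he h
  have b := mem_multiExp.1 hf h
  have c := DFunLike.congr_fun h1 h
  have d := DFunLike.congr_fun h2 h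
  simp only [Fin.sum_univ_three, blockExp_apply] at a b c d
  fin_cases k
  · simp; omega
  · exact c
  · exact d

lemma prod_three {N : ℕ} {A : Type*} [CommMonoid A] (e : Fin N × Fin 3 →₀ ℕ)
    (f : Fin N × Fin 3 → A) :
    (e.prod fun p k => f p ^ k) = ((blockExp 0 e).prod fun h k => f (h, 0) ^ k) *
      ((blockExp 1 e).prod fun h k => f (h, 1) ^ k) *
      ((blockExp 2 e).prod fun h k => f (h, 2) ^ k) := by
  simp only [Finsupp.prod_fintype _ _ (fun _ => pow_zero _), Fintype.prod_prod_type,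
    Fin.prod_univ_three, prod_mul_distrib, blockExp_apply]

/-- Integer points `w₁`, `w₂` and the last basis vector as the columns of a matrix. -/
def planeMatrix (w₁ w₂ : Fin 3 → ℤ) : Matrix (Fin 3) (Fin 3) ℤ :=
  Matrix.of fun j => ![w₁ j, w₂ j, if j = 2 then 1 else 0]

lemma exists_poly_of_coeff_eq_zero {N : ℕ} (r : Fin N → ℕ) (P : MvPolynomial (Fin N × Fin 3) ℤ)
    (hP : P ≠ 0) (hsupp : P.support ⊆ multiExp r) (small : (Fin N →₀ ℕ) → Prop)
    (w₁ w₂ m : Fin N → Fin 3 → ℤ) (hm2 : ∀ h, m h 2 ≠ 0)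
    (hD : ∀ h, w₁ h 0 * w₂ h 1 - w₁ h 1 * w₂ h 0 ≠ 0)
    (hw₁ : ∀ h, m h 0 * w₁ h 0 + m h 1 * w₁ h 1 + m h 2 * w₁ h 2 = 0)
    (hw₂ : ∀ h, m h 0 * w₂ h 0 + m h 1 * w₂ h 1 + m h 2 * w₂ h 2 = 0)
    (hF : ∀ e, small (blockExp 2 e) →
      coeff e (lsub (fun h => planeMatrix (w₁ h) (w₂ h)) P : MvPolynomial _ ℤ) = 0) :
    ∃ p : MvPolynomial (Fin N) ℤ, p ≠ 0 ∧ (∀ h, degreeOf h p ≤ r h) ∧ L1 p ≤ L1 P ∧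
      ∀ J, small J → coeff J (mtaylor (fun h => -((m h 0 : ℚ) / m h 2))
        (map (Int.castRingHom ℚ) p)) = 0 := by
  classical
  set ξ : Fin N → ℚ := fun h => -((m h 0 : ℚ) / m h 2) with hξ
  set η : Fin N → ℚ := fun h => (m h 1 : ℚ) / m h 2 with hη
  set D : Fin N → ℚ := fun h => w₁ h 0 * w₂ h 1 - w₁ h 1 * w₂ h 0 with hDdef
  have hD' : ∀ h, D h ≠ 0 := fun h => by simp only [hDdef]; exact_mod_cast hD h
  -- the substitution `(1, z, ξ - η z + t)` and its expression in terms of `w₁`, `w₂`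
  let ℓ : Fin N → MvPolynomial (Fin N) ℚ := fun h => C (ξ h) - C (η h) * X h
  let vec : Fin N × Fin 3 → MvPolynomial (Fin N) (MvPolynomial (Fin N) ℚ) := fun p =>
    ![1, C (X p.1), C (ℓ p.1) + X p.1] p.2
  let α : Fin N → MvPolynomial (Fin N) ℚ := fun h =>
    C (w₂ h 1 / D h) - C (w₂ h 0 / D h) * X h
  let β : Fin N → MvPolynomial (Fin N) ℚ := fun h =>
    C (w₁ h 0 / D h) * X h - C (w₁ h 1 / D h)
  let vec' : Fin N × Fin 3 → MvPolynomial (Fin N) (MvPolynomial (Fin N) ℚ) := fun p =>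
    ![C (α p.1), C (β p.1), X p.1] p.2
  have hcol : ∀ h j, (C ((C (w₁ h j : ℚ) * α h + C (w₂ h j : ℚ) * β h : MvPolynomial (Fin N) ℚ)) :
      MvPolynomial (Fin N) (MvPolynomial (Fin N) ℚ)) = C (![1, X h, ℓ h] j) := by
    intro h j
    congr 1
    have e1 : (w₁ h j : ℚ) * (w₂ h 1 / D h) - w₂ h j * (w₁ h 1 / D h) = ![1, 0, ξ h] j := by
      have := hD' h
      have h2 : (m h 2 : ℚ) ≠ 0 := by exact_mod_cast hm2 h
      have a1 : (m h 0 * w₁ h 0 + m h 1 * w₁ h 1 + m h 2 * w₁ h 2 : ℚ) = 0 := by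
        exact_mod_cast hw₁ h
      have a2 : (m h 0 * w₂ h 0 + m h 1 * w₂ h 1 + m h 2 * w₂ h 2 : ℚ) = 0 := by
        exact_mod_cast hw₂ h
      rw [← mul_div_assoc, ← mul_div_assoc, ← sub_div, div_eq_iff this]
      fin_cases j
      · simp [hDdef]; ring
      · simp; ring
      · simp only [hξ, hDdef, Fin.reduceFinMk, Matrix.cons_val]
        field_simp
        linear_combination (w₂ h 1 : ℚ) * a1 - (w₁ h 1 : ℚ) * a2
    have e2 : (w₂ h j : ℚ) * (w₁ h 0 / D h) - w₁ h j * (w₂ h 0 / D h) = ![0, 1, -η h] j := by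
      have := hD' h
      have h2 : (m h 2 : ℚ) ≠ 0 := by exact_mod_cast hm2 h
      have a1 : (m h 0 * w₁ h 0 + m h 1 * w₁ h 1 + m h 2 * w₁ h 2 : ℚ) = 0 := by
        exact_mod_cast hw₁ h
      have a2 : (m h 0 * w₂ h 0 + m h 1 * w₂ h 1 + m h 2 * w₂ h 2 : ℚ) = 0 := by
        exact_mod_cast hw₂ h
      rw [← mul_div_assoc, ← mul_div_assoc, ← sub_div, div_eq_iff this]
      fin_cases j
      · simp; ring
      · simp [hDdef]; ring
      · simp only [hη, hDdef, Fin.reduceFinMk, Matrix.cons_val]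
        field_simp
        linear_combination (-w₂ h 0 : ℚ) * a1 + (w₁ h 0 : ℚ) * a2
    have e3 : (C (w₁ h j : ℚ) * α h + C (w₂ h j : ℚ) * β h : MvPolynomial (Fin N) ℚ) =
        C ((w₁ h j : ℚ) * (w₂ h 1 / D h) - w₂ h j * (w₁ h 1 / D h)) +
        C ((w₂ h j : ℚ) * (w₁ h 0 / D h) - w₁ h j * (w₂ h 0 / D h)) * X h := by
      simp only [α, β, C_mul, C_sub]; ring
    rw [e3, e1, e2]
    fin_cases j
    · simp
    · simp
    · simp [ℓ]; ring
  have hvec : ∀ p : MvPolynomial (Fin N × Fin 3) ℤ, aeval vec p =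
      aeval vec' (lsub (fun h => planeMatrix (w₁ h) (w₂ h)) p : MvPolynomial _ ℤ) := by
    intro p
    suffices h : (aeval vec : MvPolynomial (Fin N × Fin 3) ℤ →ₐ[ℤ] _) =
        (aeval vec').comp (lsub fun h => planeMatrix (w₁ h) (w₂ h)) from DFunLike.congr_fun h p
    refine algHom_ext fun q => ?_
    obtain ⟨h, j⟩ := q
    rw [AlgHom.comp_apply, lsub, aeval_X, aeval_X, map_sum]
    simp only [aeval_monomial, Finsupp.prod_single_index, pow_zero, pow_one, Fin.sum_univ_three]
    have := hcol h j
    simp only [planeMatrix, vec, vec', Matrix.of_apply, Matrix.cons_val]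
    rw [C_add, C_mul, C_mul] at this
    simp only [map_intCast, eq_intCast] at this ⊢
    rw [this]
    fin_cases j <;> simp
  have halg : ∀ c : ℤ, algebraMap ℤ (MvPolynomial (Fin N) (MvPolynomial (Fin N) ℚ)) c =
      C (C (c : ℚ)) := fun c => by rw [eq_intCast]; simp
  have hzero : ∀ J, small J → coeff J (aeval vec P) = 0 := by
    intro J hJ
    rw [hvec, aeval_def, eval₂_eq, coeff_sum]
    set F : MvPolynomial (Fin N × Fin 3) ℤ := lsub (fun h => planeMatrix (w₁ h) (w₂ h)) P
    refine sum_eq_zero fun e he => ?_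
    have hpr : (∏ p ∈ e.support, vec' p ^ e p) = monomial (blockExp 2 e)
        (((blockExp 0 e).prod fun h k => α h ^ k) * ((blockExp 1 e).prod fun h k => β h ^ k)) := by
      have := prod_three e vec'
      rw [Finsupp.prod] at this
      rw [this, monomial_eq, C_mul, map_finsuppProd, map_finsuppProd]
      simp [vec']
    rw [hpr, halg, C_mul_monomial, coeff_monomial]
    split_ifs with h
    · exact absurd (hF e (h ▸ hJ)) (mem_support_iff.1 he)
    · rfl
  obtain ⟨b, hb, hmin⟩ := (P.support.image (blockExp 1)).exists_minimal
    (by simpa using (support_nonempty.2 hP))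
  obtain ⟨e₀, he₀, hb₀⟩ := mem_image.1 hb
  set T := P.support.filter fun e => blockExp 1 e = b with hT
  have hTP : T ⊆ P.support := filter_subset _ _
  set p : MvPolynomial (Fin N) ℤ := ∑ e ∈ T, monomial (blockExp 2 e) (coeff e P) with hp
  have hsup : p.support ⊆ T.image (blockExp 2) := by
    refine support_sum.trans (biUnion_subset.2 fun e he => ?_)
    exact support_monomial_subset.trans (by simpa using ⟨e, he, rfl⟩)
  refine ⟨p, ?_, fun h => ?_, ?_, fun J hJ => ?_⟩
  · have : coeff (blockExp 2 e₀) p = coeff e₀ P := by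
      rw [hp, coeff_sum, sum_eq_single e₀]
      · simp
      · intro e he hne
        rw [coeff_monomial, if_neg]
        intro h
        refine hne (multiExp_ext (hsupp (hTP he)) (hsupp he₀) ?_ h)
        rw [hb₀]; exact (mem_filter.1 he).2
      · intro h; exact absurd (mem_filter.2 ⟨he₀, hb₀⟩) h
    intro h0
    rw [h0, coeff_zero] at this
    exact (mem_support_iff.1 he₀) this.symm
  · refine degreeOf_le_iff.2 fun f hf => ?_
    obtain ⟨e, he, rfl⟩ := mem_image.1 (hsup hf)
    rw [blockExp_apply, ← mem_multiExp.1 (hsupp (hTP he)) h]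
    exact single_le_sum (f := fun k => e (h, k)) (fun _ _ => Nat.zero_le _) (mem_univ 2)
  · rw [L1, hp]
    refine (wnorm_sum_le (fun _ => zero_le_one) _ _).trans ?_
    rw [L1_eq_sum]
    refine le_trans (sum_le_sum fun e _ => ?_) (sum_le_sum_of_subset_of_nonneg hTP
      fun _ _ _ => abs_nonneg _)
    rw [wnorm_monomial]
    simp [normRingSeminorm_int]
  · have h1 : coeff b (coeff J (aeval vec P)) = 0 := by rw [hzero J hJ, coeff_zero]
    rw [← h1, hp, map_sum, map_sum, coeff_sum, aeval_def, eval₂_eq, coeff_sum, coeff_sum, hT,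
      sum_filter]
    refine sum_congr rfl fun e he => ?_
    have hpr : (∏ q ∈ e.support, vec q ^ e q) =
        C (monomial (blockExp 1 e) 1) *
          (blockExp 2 e).prod fun h k => (C (ℓ h) + X h : MvPolynomial (Fin N) _) ^ k := by
      have := prod_three e vec
      rw [Finsupp.prod] at this
      rw [this, monomial_eq, map_mul, map_finsuppProd]
      simp [vec]
    rw [hpr, halg, ← mul_assoc, ← C_mul, coeff_C_mul, C_mul_monomial, mul_one,
      coeff_monomial_mul']
    split_ifs with h2 h3 h3
    · rw [h2, tsub_self]
      have h4 : coeff 0 (coeff J ((blockExp 2 e).prod fun h k =>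
          (C (ℓ h) + X h : MvPolynomial (Fin N) (MvPolynomial (Fin N) ℚ)) ^ k)) =
          coeff J ((blockExp 2 e).prod fun h k =>
            (X h + C (ξ h) : MvPolynomial (Fin N) ℚ) ^ k) := by
        rw [← constantCoeff_eq, ← coeff_map, map_finsuppProd]
        simp [ℓ, add_comm]
      rw [h4, map_monomial, mtaylor, aeval_monomial, algebraMap_eq, coeff_C_mul]
      simp
    · exact absurd h2.le h3
    · exact absurd (le_antisymm h3 (hmin (mem_image_of_mem _ he) h3)) h2
    · rfl

lemma map_lsub {N : ℕ} {R S T : Type*} [CommRing R] [CommRing S] [CommRing T] [Algebra S R]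
    [Algebra S T] (φ : R →ₐ[S] T) (M : Fin N → Matrix (Fin 3) (Fin 3) R)
    (P : MvPolynomial (Fin N × Fin 3) S) :
    map φ.toRingHom (lsub M P : MvPolynomial (Fin N × Fin 3) R) =
      lsub (fun h => (M h).map φ) P := by
  suffices h : (mapAlgHom φ).comp (lsub M) = lsub (S := S) (fun h => (M h).map φ) from
    DFunLike.congr_fun h P
  refine algHom_ext fun q => ?_
  simp only [AlgHom.comp_apply, lsub, aeval_X, map_sum]
  refine sum_congr rfl fun k _ => ?_
  exact map_monomial _ _ _

lemma normRingSeminorm_real (x : ℝ) : normRingSeminorm ℝ x = |x| := rfl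

set_option maxHeartbeats 1000000 in
lemma coeff_lsub_eq_zero {O : Subalgebra ℤ ℝ} (L : Matrix (Fin 3) (Fin 3) O) (hdet : L.det ≠ 0) :
    ∃ C : ℝ, 1 ≤ C ∧ ∀ (N : ℕ) (r : Fin N → ℕ) (P : MvPolynomial (Fin N × Fin 3) ℤ)
      (w₁ w₂ : Fin N → Fin 3 → ℤ) (x : Fin N → ℝ) (c : Fin 3 → ℝ) (cm Θ : ℝ),
      P.support ⊆ multiExp r → (∀ h, 0 ≤ x h) → (∀ k, |c k| ≤ cm) →
      (∀ h k, |∑ j, (L k j : ℝ) * w₁ h j| ≤ Real.exp (c k * x h)) →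
      (∀ h k, |∑ j, (L k j : ℝ) * w₂ h j| ≤ Real.exp (c k * x h)) →
      (∀ i ∈ multiExp r, coeff i (lsub (fun _ => L.adjugate) P : MvPolynomial _ O) ≠ 0 →
        ∑ h, ∑ k, c k * i (h, k) * x h ≤ Θ) →
      ∀ e, C ^ (∑ h, r h) * L1 P * Real.exp (Θ + cm * ∑ h, e (h, 2) * x h) < 1 →
        coeff e (lsub (fun h => planeMatrix (w₁ h) (w₂ h)) P : MvPolynomial _ ℤ) = 0 := by
  classical
  set D : ℝ := (L.det : ℝ) with hD
  have hD0 : D ≠ 0 := by rw [hD]; exact_mod_cast hdet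
  set Λ : Matrix (Fin 3) (Fin 3) ℝ := L.map (O.val : O →ₐ[ℤ] ℝ) with hΛ
  have hΛ' : ∀ k j, Λ k j = (L k j : ℝ) := fun _ _ => rfl
  set A : Matrix (Fin 3) (Fin 3) ℝ := L.adjugate.map (O.val : O →ₐ[ℤ] ℝ) with hA
  have hAΛ : A * Λ = D • 1 := by
    have := congrArg (fun M : Matrix (Fin 3) (Fin 3) O => M.map (O.val : O →ₐ[ℤ] ℝ))
      (Matrix.adjugate_mul L)
    simp only [Matrix.map_mul] at this
    rw [hA, hΛ, this]
    ext i j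
    rw [Matrix.map_apply, Matrix.smul_apply, Matrix.smul_apply, smul_eq_mul, map_mul, smul_eq_mul,
      Matrix.one_apply, Matrix.one_apply]
    split_ifs <;> simp [hD]
  set s₁ : ℝ := 1 + ∑ j, ∑ k, |A j k| with hs₁
  set s₂ : ℝ := 1 + (2 + ∑ j, ∑ k, |Λ j k|) / |D| with hs₂
  have hs₁1 : 1 ≤ s₁ := by
    have : 0 ≤ ∑ j, ∑ k, |A j k| := sum_nonneg fun j _ => sum_nonneg fun k _ => abs_nonneg _
    linarith
  have hΛs : 0 ≤ ∑ j, ∑ k, |Λ j k| := sum_nonneg fun j _ => sum_nonneg fun k _ => abs_nonneg _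
  have hs₂1 : 1 ≤ s₂ := by
    have : 0 ≤ (2 + ∑ j, ∑ k, |Λ j k|) / |D| := by positivity
    linarith
  have hrow : ∀ (B : Matrix (Fin 3) (Fin 3) ℝ) j k, |B j k| ≤ ∑ j, ∑ k, |B j k| := by
    intro B j k
    refine (single_le_sum (f := fun k => |B j k|) (fun k _ => abs_nonneg _) (mem_univ k)).trans ?_
    exact single_le_sum (f := fun j => ∑ k, |B j k|)
      (fun j _ => sum_nonneg fun k _ => abs_nonneg _) (mem_univ j)
  have hrow' : ∀ (B : Matrix (Fin 3) (Fin 3) ℝ) j, ∑ k, |B j k| ≤ ∑ j, ∑ k, |B j k| :=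
    fun B j => single_le_sum (f := fun j => ∑ k, |B j k|)
      (fun j _ => sum_nonneg fun k _ => abs_nonneg _) (mem_univ j)
  refine ⟨4 * s₁ * s₂, by nlinarith, fun N r P w₁ w₂ x c cm Θ hP hx hcm hw₁ hw₂ hgood e he => ?_⟩
  set G : MvPolynomial (Fin N × Fin 3) ℝ := lsub (fun _ => A) P with hG
  have hGmap : G = map (O.val : O →ₐ[ℤ] ℝ).toRingHom
      (lsub (fun _ => L.adjugate) P : MvPolynomial _ O) := by
    rw [map_lsub]
  have hGsupp : G.support ⊆ multiExp r := support_lsub_subset _ hP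
  set K : Fin N → Matrix (Fin 3) (Fin 3) ℝ := fun h =>
    D⁻¹ • (Λ * (planeMatrix (w₁ h) (w₂ h)).map (Int.cast : ℤ → ℝ)) with hK
  set F : MvPolynomial (Fin N × Fin 3) ℤ := lsub (fun h => planeMatrix (w₁ h) (w₂ h)) P with hF
  have hFG : map (Int.castRingHom ℝ) F = lsub K G := by
    rw [hG, lsub_lsub]
    have h1 := map_lsub (Algebra.ofId ℤ ℝ) (fun h => planeMatrix (w₁ h) (w₂ h)) P
    have h2 : (Algebra.ofId ℤ ℝ).toRingHom = Int.castRingHom ℝ := RingHom.ext_int _ _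
    rw [h2] at h1
    rw [hF, h1]
    congr 1
    have : ∀ h, A * K h = (planeMatrix (w₁ h) (w₂ h)).map (Algebra.ofId ℤ ℝ) := by
      intro h
      rw [hK]
      simp only
      rw [Matrix.mul_smul, ← Matrix.mul_assoc, hAΛ, Matrix.smul_mul, Matrix.one_mul, smul_smul,
        inv_mul_cancel₀ hD0, one_smul]
      rfl
    simp only [this]
  set wt : Fin N × Fin 3 → ℝ := fun p => if p.2 = 2 then Real.exp (-(cm * x p.1)) else 1 with hwt
  have hwt0 : ∀ p, 0 ≤ wt p := fun p => by simp only [hwt]; split_ifs <;> positivity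
  set u : Fin N × Fin 3 → ℝ := fun p => s₂ * Real.exp (c p.2 * x p.1) with hu
  have hKu : ∀ h k, ∑ l, |K h k l| * wt (h, l) ≤ u (h, k) := by
    intro h k
    have e0 : |K h k 0| ≤ |D|⁻¹ * Real.exp (c k * x h) := by
      have : K h k 0 = D⁻¹ * ∑ j, (L k j : ℝ) * w₁ h j := by
        simp [hK, Matrix.mul_apply, planeMatrix, hΛ']
      rw [this, abs_mul, abs_inv]
      exact mul_le_mul_of_nonneg_left (hw₁ h k) (by positivity)
    have e1 : |K h k 1| ≤ |D|⁻¹ * Real.exp (c k * x h) := by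
      have : K h k 1 = D⁻¹ * ∑ j, (L k j : ℝ) * w₂ h j := by
        simp [hK, Matrix.mul_apply, planeMatrix, hΛ']
      rw [this, abs_mul, abs_inv]
      exact mul_le_mul_of_nonneg_left (hw₂ h k) (by positivity)
    have e2 : |K h k 2| ≤ |D|⁻¹ * ∑ j, ∑ k, |Λ j k| := by
      have : K h k 2 = D⁻¹ * Λ k 2 := by
        simp [hK, Matrix.mul_apply, planeMatrix]
      rw [this, abs_mul, abs_inv]
      exact mul_le_mul_of_nonneg_left (hrow Λ k 2) (by positivity)
    have e3 : Real.exp (-(cm * x h)) ≤ Real.exp (c k * x h) := by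
      refine Real.exp_le_exp.2 ?_
      have := mul_le_mul_of_nonneg_right (abs_le.1 (hcm k)).1 (hx h)
      linarith
    rw [Fin.sum_univ_three]
    simp only [hwt, hu, hs₂]
    simp only [Fin.reduceEq, if_true, if_false, mul_one]
    have e4 : |K h k 2| * Real.exp (-(cm * x h)) ≤
        (|D|⁻¹ * ∑ j, ∑ k, |Λ j k|) * Real.exp (c k * x h) :=
      mul_le_mul e2 e3 (Real.exp_pos _).le (by positivity)
    have e5 := Real.exp_pos (c k * x h)
    rw [div_eq_inv_mul]
    nlinarith
  have hN1 : (normRingSeminorm ℝ) 1 ≤ 1 := by simp [normRingSeminorm_real]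
  have hle : wnorm (normRingSeminorm ℝ) wt (map (Int.castRingHom ℝ) F) ≤
      wnorm (normRingSeminorm ℝ) u G := by
    rw [hFG]
    exact wnorm_lsub_le hN1 (fun c => le_rfl) hwt0 K hKu G
  have hGi : ∀ i, |coeff i G| ≤ s₁ ^ (∑ h, r h) * L1 P := by
    intro i
    have h1 := wnorm_lsub_le (S := ℤ) (R := ℝ) (ν := normRingSeminorm ℝ) (μ := normRingSeminorm ℤ)
      (wt := fun _ => 1) (u := fun _ => s₁) hN1 (fun c => by
        simp [normRingSeminorm_real, normRingSeminorm_int]) (fun _ => zero_le_one)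
      (fun _ : Fin N => A) (fun h j => by
        have := hrow' A j
        simp only [mul_one, normRingSeminorm_real]; linarith) P
    have h2 := le_wnorm (ν := normRingSeminorm ℝ) (wt := fun _ => 1) (fun _ => zero_le_one) G i
    simp only [one_pow, Finsupp.prod, prod_const_one, mul_one] at h2
    refine h2.trans (h1.trans_eq ?_)
    rw [L1, wnorm, wnorm, mul_sum]
    refine sum_congr rfl fun e he => ?_
    rw [prod_const_multiExp (hP he), prod_const_multiExp (hP he)]; ring
  have hui : ∀ i ∈ multiExp r, (i.prod fun p k => u p ^ k) =
      s₂ ^ (∑ h, r h) * Real.exp (∑ h, ∑ k, c k * i (h, k) * x h) := by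
    intro i hi
    simp only [hu, mul_pow]
    rw [Finsupp.prod_mul, prod_const_multiExp hi, Finsupp.prod_fintype _ _ (fun _ => pow_zero _),
      ← Fintype.sum_prod_type', Real.exp_sum]
    congr 1
    refine prod_congr rfl fun p _ => ?_
    rw [← Real.exp_nat_mul]; congr 1; ring
  have hGle : wnorm (normRingSeminorm ℝ) u G ≤
      4 ^ (∑ h, r h) * (s₁ ^ (∑ h, r h) * L1 P * (s₂ ^ (∑ h, r h) * Real.exp Θ)) := by
    have hL1 : 0 ≤ L1 P := wnorm_nonneg (fun _ => zero_le_one) _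
    have : ∀ i ∈ G.support, normRingSeminorm ℝ (coeff i G) * (i.prod fun p k => u p ^ k) ≤
        s₁ ^ (∑ h, r h) * L1 P * (s₂ ^ (∑ h, r h) * Real.exp Θ) := by
      intro i hi
      rw [hui i (hGsupp hi), normRingSeminorm_real]
      have hΘ : ∑ h, ∑ k, c k * i (h, k) * x h ≤ Θ := by
        refine hgood i (hGsupp hi) fun h0 => ?_
        rw [mem_support_iff, hGmap, coeff_map, h0, map_zero] at hi
        exact hi rfl
      have hs0 : 0 ≤ s₂ ^ (∑ h, r h) := by positivity
      have h3 := mul_le_mul_of_nonneg_left (Real.exp_le_exp.2 hΘ) hs0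
      have h4 : 0 ≤ s₂ ^ (∑ h, r h) * Real.exp (∑ h, ∑ k, c k * i (h, k) * x h) :=
        mul_nonneg hs0 (Real.exp_pos _).le
      have h5 : 0 ≤ s₁ ^ (∑ h, r h) * L1 P := mul_nonneg (by positivity) hL1
      exact mul_le_mul (hGi i) h3 h4 h5
    refine (sum_le_card_nsmul _ _ _ this).trans ?_
    rw [nsmul_eq_mul]
    refine mul_le_mul_of_nonneg_right ?_ (by positivity)
    exact_mod_cast (card_le_card hGsupp).trans (card_multiExp r)
  have hwe : (e.prod fun p k => wt p ^ k) = Real.exp (-(cm * ∑ h, e (h, 2) * x h)) := by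
    rw [Finsupp.prod_fintype _ _ (fun _ => pow_zero _), Fintype.prod_prod_type]
    simp only [Fin.prod_univ_three, hwt, Fin.reduceEq, if_true, if_false, one_pow, one_mul]
    rw [mul_sum, ← sum_neg_distrib, Real.exp_sum]
    refine prod_congr rfl fun h _ => ?_
    rw [← Real.exp_nat_mul]; congr 1; ring
  have hfin := (le_wnorm (ν := normRingSeminorm ℝ) hwt0 (map (Int.castRingHom ℝ) F) e).trans
    (hle.trans hGle)
  rw [hwe, coeff_map, normRingSeminorm_real, Real.exp_neg, ← div_eq_mul_inv,
    div_le_iff₀ (Real.exp_pos _)] at hfin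
  have hlt : |((coeff e F : ℤ) : ℝ)| < 1 := by
    refine lt_of_le_of_lt (hfin.trans_eq ?_) he
    rw [Real.exp_add, mul_pow, mul_pow]; ring
  have : |coeff e F| < 1 := by exact_mod_cast hlt
  exact Int.abs_lt_one_iff.1 this

lemma exists_lacunary {good : ℝ → Prop} (hg : ∀ x₀, ∃ x ≥ x₀, good x) (N : ℕ) (X K : ℝ)
    (hX : 0 < X) (hK : 1 ≤ K) :
    ∃ x : Fin N → ℝ, (∀ h, X ≤ x h) ∧ (∀ h, good (x h)) ∧ ∀ i j, i < j → K * x j ≤ x i := by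
  choose g hg1 hg2 using hg
  let y : ℕ → ℝ := fun n => Nat.rec (g X) (fun _ t => g (K * t)) n
  have hys : ∀ n, K * y n ≤ y (n + 1) := fun n => hg1 (K * y n)
  have hyX : ∀ n, X ≤ y n := by
    intro n
    induction n with
    | zero => exact hg1 X
    | succ n ih => nlinarith [hys n]
  have hmono : Monotone y := monotone_nat_of_le_succ fun n => by nlinarith [hys n, hyX n]
  have hgood : ∀ n, good (y n) := by
    intro n
    cases n with
    | zero => exact hg2 X
    | succ n => exact hg2 (K * y n)
  refine ⟨fun h => y (N - 1 - h), fun h => hyX _, fun h => hgood _, fun i j hij => ?_⟩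
  have hj := j.2
  have hij' : (i : ℕ) < j := hij
  have hn : N - 1 - j + 1 ≤ N - 1 - (i : ℕ) := by omega
  have hle : y (N - 1 - j + 1) ≤ y (N - 1 - i) := hmono hn
  exact (hys _).trans hle

/-- A plane spanned by two integer points `w₁`, `w₂` at which the linear forms with coefficient
matrix `L` are small at the scale `exp x`, and whose slope has a large denominator. -/
def SmallPlane (L : Matrix (Fin 3) (Fin 3) ℝ) (c : Fin 3 → ℝ) (κ x : ℝ) : Prop :=
  ∃ w₁ w₂ m : Fin 3 → ℤ, w₁ 0 * w₂ 1 - w₁ 1 * w₂ 0 ≠ 0 ∧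
    m 0 * w₁ 0 + m 1 * w₁ 1 + m 2 * w₁ 2 = 0 ∧ m 0 * w₂ 0 + m 1 * w₂ 1 + m 2 * w₂ 2 = 0 ∧
    m 2 ≠ 0 ∧ κ * x ≤ Real.log (-((m 0 : ℚ) / m 2)).den ∧
    (∀ k, |∑ j, L k j * w₁ j| ≤ Real.exp (c k * x)) ∧
    ∀ k, |∑ j, L k j * w₂ j| ≤ Real.exp (c k * x)

set_option maxHeartbeats 1000000 in
theorem exists_forall_not_smallPlane {O : Subalgebra ℤ ℝ} [Module.Finite ℤ O]
    (L : Matrix (Fin 3) (Fin 3) O) (hdet : L.det ≠ 0) (c : Fin 3 → ℝ) (δ κ : ℝ) (hδ : 0 < δ)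
    (hκ : 0 < κ) (hc : ∑ k, c k ≤ -δ) :
    ∃ x₀, ∀ x ≥ x₀, ¬ SmallPlane (L.map fun a => (a : ℝ)) c κ x := by
  classical
  by_contra! hcon
  set cm : ℝ := ∑ k, |c k| + 1 with hcm
  have hcm1 : 1 ≤ cm := by
    have : 0 ≤ ∑ k, |c k| := sum_nonneg fun k _ => abs_nonneg _
    linarith
  have hcmk : ∀ k, |c k| ≤ cm := fun k => by
    have : |c k| ≤ ∑ k, |c k| :=
      single_le_sum (f := fun k => |c k|) (fun k _ => abs_nonneg _) (mem_univ k)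
    linarith
  have hδcm : δ ≤ 3 * cm := by
    have : -∑ k, c k ≤ 3 * cm := by
      rw [Fin.sum_univ_three]
      have a := abs_le.1 (hcmk 0); have b := abs_le.1 (hcmk 1); have d := abs_le.1 (hcmk 2)
      linarith
    linarith
  obtain ⟨D, C₁, hD, hC₁, haux⟩ := exists_auxiliary L.adjugate
  obtain ⟨C₂, hC₂, hcoeff⟩ := coeff_lsub_eq_zero L hdet
  obtain ⟨N, hN0, hN⟩ : ∃ N : ℕ, 0 < N ∧ 144 * cm ^ 2 * D ≤ N * δ ^ 2 := by
    obtain ⟨N, hN⟩ := exists_nat_ge (144 * cm ^ 2 * D / δ ^ 2)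
    rw [div_le_iff₀ (by positivity)] at hN
    refine ⟨N + 1, Nat.succ_pos _, hN.trans ?_⟩
    push_cast
    nlinarith [sq_nonneg δ]
  have hNp : (1 : ℝ) ≤ N := by exact_mod_cast hN0
  set ε := δ / (72 * cm) with hε
  set ζ := δ / (36 * cm) with hζ
  have hε0 : 0 < ε := by positivity
  have hζ0 : 0 < ζ := by positivity
  have hζ1 : ζ ≤ 1 := by rw [hζ, div_le_one (by positivity)]; linarith
  have hεcm : ε * cm = δ / 72 := by rw [hε]; field_simp
  have hζcm : ζ * cm = δ / 36 := by rw [hζ]; field_simp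
  obtain ⟨ω, hω, hroth⟩ := rothLemma N ε hε0
  have hl1 : 0 ≤ Real.log C₁ := Real.log_nonneg hC₁
  have hl2 : 0 ≤ Real.log C₂ := Real.log_nonneg hC₂
  set X : ℝ := 18 * (Real.log C₁ + Real.log C₂) / δ + 2 * N * (Real.log C₁ + 1) / (ω * κ) + 1
    with hX
  have hX0 : 0 < X := by positivity
  have hX1 : 2 * (Real.log C₁ + Real.log C₂) < X * (δ / 9) := by
    have : 18 * (Real.log C₁ + Real.log C₂) / δ < X := by
      have : 0 ≤ 2 * N * (Real.log C₁ + 1) / (ω * κ) := by positivity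
      linarith
    rw [div_lt_iff₀ hδ] at this
    linarith
  have hX2 : 2 * N * (Real.log C₁ + 1) ≤ X * (ω * κ) := by
    rw [← div_le_iff₀ (by positivity)]
    have : 0 ≤ 18 * (Real.log C₁ + Real.log C₂) / δ := by positivity
    linarith
  obtain ⟨x, hxX, hxgood, hxx⟩ := exists_lacunary hcon N X (2 / ω + 1) hX0
    (by have : 0 < 2 / ω := by positivity
        linarith)
  have hx0 : ∀ h, 0 < x h := fun h => hX0.trans_le (hxX h)
  choose w₁ w₂ m hD2 hmw₁ hmw₂ hm2 hden hsw₁ hsw₂ using hxgood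
  set Y : ℝ := ∑ h, x h / ζ + 1 with hY
  have hxY : ∀ h, x h ≤ ζ * Y := by
    intro h
    have : x h / ζ ≤ ∑ h, x h / ζ := single_le_sum (f := fun h => x h / ζ)
      (fun h _ => (div_pos (hx0 h) hζ0).le) (mem_univ h)
    have : x h / ζ ≤ Y := by linarith
    rwa [div_le_iff₀ hζ0, mul_comm] at this
  have hY0 : 0 < Y := by
    have : 0 ≤ ∑ h, x h / ζ := sum_nonneg fun h _ => (div_pos (hx0 h) hζ0).le
    linarith
  have hxY' : ∀ h, x h ≤ Y := fun h => (hxY h).trans (mul_le_of_le_one_left hY0.le hζ1)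
  set r : Fin N → ℕ := fun h => ⌈Y / x h⌉₊ with hr
  have hrlow : ∀ h, Y ≤ r h * x h := fun h => by
    rw [← div_le_iff₀ (hx0 h)]; exact Nat.le_ceil _
  have hrup : ∀ h, r h * x h ≤ Y + x h := fun h => by
    have : (r h : ℝ) ≤ Y / x h + 1 := (Nat.ceil_lt_add_one (div_pos hY0 (hx0 h)).le).le
    calc (r h : ℝ) * x h ≤ (Y / x h + 1) * x h := mul_le_mul_of_nonneg_right this (hx0 h).le
      _ = Y + x h := by rw [add_mul, div_mul_cancel₀ _ (hx0 h).ne', one_mul]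
  have hr0 : ∀ h, 0 < r h := fun h => Nat.ceil_pos.2 (div_pos hY0 (hx0 h))
  have hr0' : ∀ h, (0 : ℝ) < r h := fun h => by exact_mod_cast hr0 h
  have hrX : ∀ h, r h * X ≤ 2 * Y := fun h => by
    have h1 := mul_le_mul_of_nonneg_left (hxX h) (hr0' h).le
    linarith [hrup h, hxY' h]
  have hrsum : (∑ h, (r h : ℝ)) * X ≤ 2 * N * Y := by
    rw [sum_mul]
    refine (sum_le_card_nsmul _ _ _ fun h _ => hrX h).trans_eq ?_
    rw [card_univ, Fintype.card_fin, nsmul_eq_mul]; ring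
  have hrr : ∀ i j, i < j → (r i : ℝ) ≤ ω * r j := by
    intro i j hij
    have h1 := hxx i j hij
    have h2 : 2 * x j ≤ ω * x i := by
      have h3 : ω * ((2 / ω + 1) * x j) ≤ ω * x i := mul_le_mul_of_nonneg_left h1 hω.le
      have h4 : ω * ((2 / ω + 1) * x j) = 2 * x j + ω * x j := by field_simp
      nlinarith [hx0 j]
    have h5 : (r i : ℝ) * x i ≤ 2 * Y := by linarith [hrup i, hxY' i]
    have h6 := hrlow j
    have h7 : (r i : ℝ) * x i * (2 * x j) ≤ (2 * (r j * x j)) * (ω * x i) :=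
      mul_le_mul (by linarith) h2 (by linarith [hx0 j])
        (by have := mul_pos (hr0' j) (hx0 j); linarith)
    have h8 : 0 < 2 * (x i * x j) := by have := mul_pos (hx0 i) (hx0 j); linarith
    refine le_of_mul_le_mul_right ?_ h8
    linarith
  -- the auxiliary polynomial
  set bad : Finset (Fin N × Fin 3 →₀ ℕ) :=
    {e ∈ multiExp r | -(N * δ / 6) < ∑ h, ∑ k, c k * (e (h, k) / r h)} with hbad
  have hbadcard : D * #bad ≤ #(multiExp r) := by
    have h1 := card_bad_le hN0 r hr0 c δ cm hδ hc hcmk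
    have h2 : (144 * cm ^ 2) * (D * #bad) ≤ (144 * cm ^ 2) * #(multiExp r) := by
      refine le_trans ?_ h1
      have := mul_le_mul_of_nonneg_left hN (Nat.cast_nonneg (α := ℝ) #bad)
      linarith
    exact le_of_mul_le_mul_left h2 (by positivity)
  obtain ⟨P, hP0, hPs, hPL, hPbad⟩ := haux N r bad hbadcard
  set small : (Fin N →₀ ℕ) → Prop := fun J => ∑ h, (J h : ℝ) * (1 / r h) ≤ ε with hsmall
  have hrsum' : ((∑ h, r h : ℕ) : ℝ) = ∑ h, (r h : ℝ) := by push_cast; rfl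
  have hF : ∀ e, small (blockExp 2 e) →
      coeff e (lsub (fun h => planeMatrix (w₁ h) (w₂ h)) P : MvPolynomial _ ℤ) = 0 := by
    intro e he
    refine hcoeff N r P w₁ w₂ x c cm (-(Y * (N * δ / 6)) + N * (ζ * Y * cm)) hPs
      (fun h => (hx0 h).le) hcmk hsw₁ hsw₂ (fun i hi hine => ?_) e ?_
    · have hib : ∑ h, ∑ k, c k * ((i (h, k) : ℝ) / r h) ≤ -(N * δ / 6) := by
        by_contra! hlt
        exact hine (hPbad i (mem_filter.2 ⟨hi, hlt⟩))
      have h1 : ∀ h, ∑ k, c k * i (h, k) * x h ≤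
          Y * ∑ k, c k * ((i (h, k) : ℝ) / r h) + ζ * Y * cm := by
        intro h
        have h2 : ∑ k, c k * i (h, k) * x h =
            (r h * x h) * ∑ k, c k * ((i (h, k) : ℝ) / r h) := by
          rw [mul_sum]
          refine sum_congr rfl fun k _ => ?_
          have := (hr0' h).ne'
          field_simp
        have h3 : ∑ k, c k * ((i (h, k) : ℝ) / r h) ≤ cm := by
          have h4 : ∑ k, (i (h, k) : ℝ) / r h = 1 := by
            rw [← sum_div, ← Nat.cast_sum, mem_multiExp.1 hi h, div_self (hr0' h).ne']
          calc ∑ k, c k * ((i (h, k) : ℝ) / r h) ≤ ∑ k, cm * ((i (h, k) : ℝ) / r h) := by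
                refine sum_le_sum fun k _ => mul_le_mul_of_nonneg_right
                  ((le_abs_self _).trans (hcmk k)) (by positivity)
            _ = cm := by rw [← mul_sum, h4, mul_one]
        have h5 : 0 ≤ r h * x h - Y := by linarith [hrlow h]
        have h6 : r h * x h - Y ≤ ζ * Y := by linarith [hrup h, hxY h]
        have h7 := mul_le_mul_of_nonneg_left h3 h5
        have h8 := mul_le_mul_of_nonneg_right h6 (by linarith : 0 ≤ cm)
        rw [h2]
        linarith
      refine (sum_le_sum fun h _ => h1 h).trans ?_
      rw [sum_add_distrib, ← mul_sum, sum_const, card_univ, Fintype.card_fin, nsmul_eq_mul]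
      have := mul_le_mul_of_nonneg_left hib hY0.le
      linarith
    · have h1 : ∑ h, (e (h, 2) : ℝ) * x h ≤ 2 * Y * ε := by
        have h2 : ∀ h, (e (h, 2) : ℝ) * x h ≤ 2 * Y * ((e (h, 2) : ℝ) * (1 / r h)) := by
          intro h
          have h3 : (e (h, 2) : ℝ) * x h = (r h * x h) * ((e (h, 2) : ℝ) * (1 / r h)) := by
            have := (hr0' h).ne'
            field_simp
          rw [h3]
          refine mul_le_mul_of_nonneg_right ?_ (by positivity)
          linarith [hrup h, hxY' h]
        refine (sum_le_sum fun h _ => h2 h).trans ?_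
        rw [← mul_sum]
        exact mul_le_mul_of_nonneg_left he (by positivity)
      have h4 : cm * ∑ h, (e (h, 2) : ℝ) * x h ≤ N * (Y * (δ / 36)) := by
        have h5 := mul_le_mul_of_nonneg_left h1 (by linarith : 0 ≤ cm)
        have h6 : cm * (2 * Y * ε) = Y * (δ / 36) := by
          rw [show cm * (2 * Y * ε) = 2 * Y * (ε * cm) by ring, hεcm]; ring
        have h7 : 0 < Y * (δ / 36) := by positivity
        nlinarith
      have h8 : (C₂ ^ ∑ h, r h) * L1 P ≤
          Real.exp ((∑ h, (r h : ℝ)) * (Real.log C₁ + Real.log C₂)) := by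
        have h9 : ∀ C : ℝ, 1 ≤ C → C ^ (∑ h, r h) = Real.exp ((∑ h, (r h : ℝ)) * Real.log C) := by
          intro C hC
          rw [← hrsum', Real.exp_nat_mul, Real.exp_log (by linarith)]
        rw [mul_add, Real.exp_add, ← h9 _ hC₁, ← h9 _ hC₂, mul_comm]
        exact mul_le_mul_of_nonneg_right hPL (by positivity)
      refine lt_of_le_of_lt (mul_le_mul_of_nonneg_right h8 (Real.exp_pos _).le) ?_
      rw [← Real.exp_add, Real.exp_lt_one_iff]
      have h10 : (∑ h, (r h : ℝ)) * (Real.log C₁ + Real.log C₂) < N * Y * (δ / 9) := by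
        refine lt_of_mul_lt_mul_right ?_ hX0.le
        have h11 := mul_le_mul_of_nonneg_right hrsum (by linarith :
          0 ≤ Real.log C₁ + Real.log C₂)
        have h12 : N * Y * (2 * (Real.log C₁ + Real.log C₂)) < N * Y * (X * (δ / 9)) :=
          mul_lt_mul_of_pos_left hX1 (by positivity)
        linarith
      have h13 : (N : ℝ) * (ζ * Y * cm) = N * Y * (δ / 36) := by
        rw [show (N : ℝ) * (ζ * Y * cm) = N * Y * (ζ * cm) by ring, hζcm]
      rw [h13]
      linarith
  obtain ⟨p, hp0, hpdeg, hpL, hpJ⟩ := exists_poly_of_coeff_eq_zero r P hP0 hPs small w₁ w₂ m hm2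
    hD2 hmw₁ hmw₂ hF
  obtain ⟨J, hJ, hJne⟩ := hroth r hr0 hrr (fun h => -((m h 0 : ℚ) / m h 2)) (κ * Y)
    (by positivity) (fun h => by
      have h1 := mul_le_mul_of_nonneg_left (hden h) (hr0' h).le
      have h2 := mul_le_mul_of_nonneg_left (hrlow h) hκ.le
      linarith) p hp0 hpdeg (by
      have h1 : Real.log (L1 p) ≤ (∑ h, (r h : ℝ)) * Real.log C₁ := by
        rw [← hrsum', ← Real.log_pow]
        exact Real.log_le_log (by linarith [one_le_L1 hp0]) (hpL.trans hPL)
      have h2 : (∑ h, (r h : ℝ)) * (Real.log C₁ + 1) ≤ ω * (κ * Y) := by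
        refine le_of_mul_le_mul_right ?_ hX0
        have h3 := mul_le_mul_of_nonneg_right hrsum (by linarith : 0 ≤ Real.log C₁ + 1)
        have h4 := mul_le_mul_of_nonneg_right hX2 hY0.le
        linarith
      linarith)
  exact hJne (hpJ J hJ.le)

/-- Differences of the squares of the coordinates. -/
def sqDiff (a : Fin 3 → ℝ) : Fin 3 → ℝ :=
  ![a 1 ^ 2 - a 2 ^ 2, a 2 ^ 2 - a 0 ^ 2, a 0 ^ 2 - a 1 ^ 2]

/-- The three linear forms in which the quadratic form with coefficients `sqDiff a` becomes
`L₁ L₃ - L₂ ^ 2`, up to a constant. -/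
def formMatrix (a : Fin 3 → ℝ) : Matrix (Fin 3) (Fin 3) ℝ :=
  Matrix.of fun k j => sqDiff a j *
    ![a j * (a 0 ^ 2 + a 1 ^ 2 + a 2 ^ 2 - 2 * a j ^ 2), ![a 1 * a 2, a 2 * a 0, a 0 * a 1] j,
      a j] k

lemma det_formMatrix (a : Fin 3 → ℝ) :
    (formMatrix a).det = -(2 * (sqDiff a 0 * sqDiff a 1 * sqDiff a 2) ^ 2) := by
  simp [Matrix.det_fin_three, formMatrix, sqDiff]
  ring

section height
variable {h : Fin 3 → ℤ}

lemma mul_eq_zero_of_sqrt_mul_int (hpos : ∀ i, 0 < h i)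
    (hsq : ∀ i j, i ≠ j → ¬ IsSquare (h i * h j)) {i j : Fin 3} (hij : i ≠ j) (u v : ℤ)
    (h0 : (u : ℝ) * (√(h i) * √(h j)) = v) : u = 0 := by
  by_contra hu
  have hi : (0 : ℝ) < h i := by exact_mod_cast hpos i
  have hj : (0 : ℝ) < h j := by exact_mod_cast hpos j
  have h1 : (u : ℝ) ^ 2 * (h i * h j) = v ^ 2 := by
    rw [← h0, mul_pow, mul_pow, Real.sq_sqrt hi.le, Real.sq_sqrt hj.le]
  have h2 : u ^ 2 * (h i * h j) = v ^ 2 := by exact_mod_cast h1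
  have h3 : u ∣ v := (Int.pow_dvd_pow_iff two_ne_zero).1 ⟨_, h2.symm⟩
  obtain ⟨t, rfl⟩ := h3
  refine hsq i j hij ⟨t, ?_⟩
  have : u ^ 2 ≠ 0 := pow_ne_zero _ hu
  exact mul_left_cancel₀ this (by rw [h2]; ring)

lemma sum_sqrt_ne_zero (hpos : ∀ i, 0 < h i)
    (hsq : ∀ i j, i ≠ j → ¬ IsSquare (h i * h j)) {m : Fin 3 → ℤ} (hm : m ≠ 0) :
    ∑ i, √(h i) * (m i : ℝ) ≠ 0 := by
  intro h0
  have hs : ∀ i, √(h i : ℝ) ^ 2 = h i := fun i =>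
    Real.sq_sqrt (by exact_mod_cast (hpos i).le)
  have hs0 : ∀ i, √(h i : ℝ) ≠ 0 := fun i =>
    (Real.sqrt_pos.2 (by exact_mod_cast hpos i)).ne'
  rw [Fin.sum_univ_three] at h0
  have key : ∀ i j k : Fin 3, i ≠ j →
      √(h i) * (m i : ℝ) + √(h j) * (m j : ℝ) + √(h k) * (m k : ℝ) = 0 → m i * m j = 0 := by
    intro i j k hij h0
    have := mul_eq_zero_of_sqrt_mul_int hpos hsq hij (2 * (m i * m j))
      (m k ^ 2 * h k - m i ^ 2 * h i - m j ^ 2 * h j) (by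
        push_cast
        linear_combination (√(h i) * (m i : ℝ) + √(h j) * (m j : ℝ) - √(h k) * (m k : ℝ)) * h0 -
          (m i : ℝ) ^ 2 * hs i - (m j : ℝ) ^ 2 * hs j + (m k : ℝ) ^ 2 * hs k)
    simpa using this
  have h01 := key 0 1 2 (by decide) h0
  have h02 := key 0 2 1 (by decide) (by linarith)
  have h12 := key 1 2 0 (by decide) (by linarith)
  have hz : ∀ i, √(h i) * (m i : ℝ) = 0 → m i = 0 := fun i hi => by
    have := (mul_eq_zero.1 hi).resolve_left (hs0 i)
    exact_mod_cast this
  apply hm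
  rcases mul_eq_zero.1 h01 with h | h
  · rcases mul_eq_zero.1 h12 with h' | h'
    · have := hz 2 (by simpa [h, h'] using h0)
      ext i; fin_cases i <;> simpa
    · have := hz 1 (by simpa [h, h'] using h0)
      ext i; fin_cases i <;> simpa
  · rcases mul_eq_zero.1 h02 with h' | h'
    · have := hz 2 (by simpa [h, h'] using h0)
      ext i; fin_cases i <;> simpa
    · have := hz 0 (by simpa [h, h'] using h0)
      ext i; fin_cases i <;> simpa

lemma one_le_abs_sum_sqrt_mul (hpos : ∀ i, 0 < h i)
    (hsq : ∀ i j, i ≠ j → ¬ IsSquare (h i * h j)) {m : Fin 3 → ℤ} (hm : m ≠ 0) :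
    1 ≤ |∑ i, √(h i) * (m i : ℝ)| * (∑ i, √(h i) * |(m i : ℝ)|) ^ 3 := by
  have hs : ∀ i, √(h i : ℝ) ^ 2 = h i := fun i =>
    Real.sq_sqrt (by exact_mod_cast (hpos i).le)
  set x : Fin 3 → ℝ := fun i => √(h i) * (m i : ℝ) with hx
  have hx2 : ∀ i, x i ^ 2 = ((h i * m i ^ 2 : ℤ) : ℝ) := fun i => by
    simp only [hx]; rw [mul_pow, hs]; push_cast; ring
  have hne : ∀ s : Fin 3 → ℤ, (∀ i, s i ≠ 0) → ∑ i, x i * s i ≠ 0 := by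
    intro s hs'
    have := sum_sqrt_ne_zero hpos hsq (m := fun i => m i * s i) (fun h0 => hm (funext fun i => by
      have := congr_fun h0 i
      simpa [hs' i] using this))
    convert this using 2 with i
    push_cast; simp only [hx]; ring
  have hle : ∀ s : Fin 3 → ℤ, (∀ i, |(s i : ℝ)| = 1) → |∑ i, x i * s i| ≤
      ∑ i, √(h i) * |(m i : ℝ)| := by
    intro s hs'
    refine (abs_sum_le_sum_abs _ _).trans (le_of_eq (sum_congr rfl fun i _ => ?_))
    rw [abs_mul, hs', mul_one, abs_mul, abs_of_nonneg (Real.sqrt_nonneg _)]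
  set A := ∑ i, √(h i) * |(m i : ℝ)|
  have n0 := hne ![1, 1, 1] (by decide)
  have n1 := hne ![1, 1, -1] (by decide)
  have n2 := hne ![1, -1, 1] (by decide)
  have n3 := hne ![-1, 1, 1] (by decide)
  have l1 := hle ![1, 1, -1] (fun i => by fin_cases i <;> simp)
  have l2 := hle ![1, -1, 1] (fun i => by fin_cases i <;> simp)
  have l3 := hle ![-1, 1, 1] (fun i => by fin_cases i <;> simp)
  simp only [Fin.sum_univ_three, Matrix.cons_val, Int.cast_one, Int.cast_neg, mul_one] at *
  set b : Fin 3 → ℤ := fun i => h i * m i ^ 2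
  have hprod : (x 0 + x 1 + x 2) * ((x 0 + x 1 + x 2 * -1) * (x 0 + x 1 * -1 + x 2) *
      (x 0 * -1 + x 1 + x 2)) =
      ((2 * (b 0 * b 1 + b 0 * b 2 + b 1 * b 2) - b 0 ^ 2 - b 1 ^ 2 - b 2 ^ 2 : ℤ) : ℝ) := by
    push_cast
    rw [← hx2 0, ← hx2 1, ← hx2 2]; ring
  have hne0 := mul_ne_zero n0 (mul_ne_zero (mul_ne_zero n1 n2) n3)
  rw [hprod] at hne0
  have h1 : (1 : ℝ) ≤ |((2 * (b 0 * b 1 + b 0 * b 2 + b 1 * b 2) - b 0 ^ 2 - b 1 ^ 2 - b 2 ^ 2 :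
      ℤ) : ℝ)| := by
    have : (2 * (b 0 * b 1 + b 0 * b 2 + b 1 * b 2) - b 0 ^ 2 - b 1 ^ 2 - b 2 ^ 2 : ℤ) ≠ 0 := by
      exact_mod_cast hne0
    exact_mod_cast Int.one_le_abs this
  rw [← hprod, abs_mul, abs_mul, abs_mul] at h1
  refine h1.trans (mul_le_mul_of_nonneg_left ?_ (abs_nonneg _))
  have hA := (abs_nonneg _).trans l1
  calc _ ≤ A * A * A := by gcongr
    _ = A ^ 3 := by ring

lemma exists_large_den (hpos : ∀ i, 0 < h i)
    (hsq : ∀ i j, i ≠ j → ¬ IsSquare (h i * h j)) {m : Fin 3 → ℤ} {k : Fin 3} (hk : m k ≠ 0)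
    (hmax : ∀ i, |m i| ≤ |m k|) :
    ∃ i, i ≠ k ∧ 1 ≤ |∑ i, √(h i) * (m i : ℝ)| * (∑ i, √(h i)) ^ 3 *
      (((m i : ℚ) / m k).den : ℝ) ^ 6 := by
  set D : Fin 3 → ℕ := fun i => ((m i : ℚ) / m k).den with hD
  have hk' : (m k : ℚ) ≠ 0 := by exact_mod_cast hk
  have hDk : ∀ i, D i ∣ (m k).natAbs := fun i => by
    have := Rat.den_dvd (m i) (m k)
    rw [Rat.divInt_eq_div] at this
    exact Int.natCast_dvd.1 this
  have hcard : (univ.erase k).card = 2 := by simp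
  obtain ⟨i, hi, himax⟩ := exists_max_image (univ.erase k) D (card_pos.1 (by omega))
  set g := (univ.erase k).lcm D
  have hgi : g ≤ D i ^ 2 := by
    rw [← hcard]
    exact (Nat.le_of_dvd (prod_pos fun i _ => Rat.den_pos _)
      (lcm_dvd fun i hi => dvd_prod_of_mem _ hi)).trans (prod_le_pow_card _ _ _ himax)
  have hgm : g ∣ (m k).natAbs := lcm_dvd fun i _ => hDk i
  have hgd : ∀ j, D j ∣ g := fun j => by
    by_cases hj : j = k
    · subst hj; simp [hD, hk']
    · exact dvd_lcm (by simp [hj])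
  have hg0 : (0 : ℝ) < g := by
    rcases Nat.eq_zero_or_pos g with h | h
    · rw [h, zero_dvd_iff, Int.natAbs_eq_zero] at hgm; exact absurd hgm hk
    · exact_mod_cast h
  have hgle : (g : ℝ) ≤ |(m k : ℝ)| := by
    have : g ≤ (m k).natAbs := Nat.le_of_dvd (Int.natAbs_pos.2 hk) hgm
    rw [← Int.cast_abs, Int.abs_eq_natAbs]
    exact_mod_cast this
  have hkR : (0 : ℝ) < |(m k : ℝ)| := hg0.trans_le hgle
  have hex : ∀ j, ∃ t : ℤ, (t : ℝ) = g / m k * m j := fun j => by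
    obtain ⟨t, ht⟩ := hgd j
    refine ⟨((m j : ℚ) / m k).num * t, ?_⟩
    have h1 := Rat.mul_den_eq_num ((m j : ℚ) / m k)
    have h2 : (((((m j : ℚ) / m k).num * t : ℤ) : ℚ) : ℝ) = ((g / m k * m j : ℚ) : ℝ) := by
      congr 1
      rw [ht]; push_cast; rw [← h1]; simp only [hD]; ring
    push_cast at h2 ⊢
    exact h2
  choose p hp using hex
  have hpk : (p k : ℝ) = g := by
    rw [hp]; have : (m k : ℝ) ≠ 0 := by exact_mod_cast hk
    field_simp
  have hp0 : p ≠ 0 := fun h0 => by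
    rw [h0] at hpk; simp at hpk; linarith
  have hle := one_le_abs_sum_sqrt_mul hpos hsq hp0
  have hpa : ∀ j, |(p j : ℝ)| ≤ g := fun j => by
    rw [hp, abs_mul, abs_div, abs_of_pos hg0]
    have : |(m j : ℝ)| ≤ |(m k : ℝ)| := by exact_mod_cast hmax j
    rw [div_mul_eq_mul_div, div_le_iff₀ hkR]
    gcongr
  have hsum : |∑ i, √(h i) * (p i : ℝ)| ≤ |∑ i, √(h i) * (m i : ℝ)| := by
    have : ∑ i, √(h i) * (p i : ℝ) = g / m k * ∑ i, √(h i) * (m i : ℝ) := by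
      rw [mul_sum]; exact sum_congr rfl fun j _ => by rw [hp]; ring
    rw [this, abs_mul, abs_div, abs_of_pos hg0]
    exact mul_le_of_le_one_left (abs_nonneg _) ((div_le_one hkR).2 hgle)
  refine ⟨i, ne_of_mem_erase hi, hle.trans ?_⟩
  have hgi' : (g : ℝ) ≤ (D i : ℝ) ^ 2 := by exact_mod_cast hgi
  calc _ ≤ |∑ i, √(h i) * (m i : ℝ)| * (∑ j, √(h j) * (D i : ℝ) ^ 2) ^ 3 := by
        gcongr with j _
        exact (hpa j).trans hgi'
    _ = _ := by rw [← sum_mul]; ring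
end height

lemma exists_perm_zero_two :
    ∀ i k : Fin 3, i ≠ k → ∃ π : Equiv.Perm (Fin 3), π 0 = i ∧ π 2 = k := by
  decide

lemma minor_ne_zero {π : Equiv.Perm (Fin 3)} {w₁ w₂ m : Fin 3 → ℤ} (hm : m (π 2) ≠ 0)
    (h₁ : ∑ i, m i * w₁ i = 0) (h₂ : ∑ i, m i * w₂ i = 0)
    (hw : ∃ i j, w₁ i * w₂ j ≠ w₁ j * w₂ i) :
    w₁ (π 0) * w₂ (π 1) - w₁ (π 1) * w₂ (π 0) ≠ 0 := by
  intro h0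
  rw [← Equiv.sum_comp π, Fin.sum_univ_three] at h₁ h₂
  have h02 : w₁ (π 0) * w₂ (π 2) - w₁ (π 2) * w₂ (π 0) = 0 := by
    refine (mul_eq_zero.1 (?_ : m (π 2) * _ = 0)).resolve_left hm
    linear_combination w₁ (π 0) * h₂ - w₂ (π 0) * h₁ - m (π 1) * h0
  have h12 : w₁ (π 1) * w₂ (π 2) - w₁ (π 2) * w₂ (π 1) = 0 := by
    refine (mul_eq_zero.1 (?_ : m (π 2) * _ = 0)).resolve_left hm
    linear_combination w₁ (π 1) * h₂ - w₂ (π 1) * h₁ + m (π 0) * h0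
  obtain ⟨i, j, hij⟩ := hw
  apply hij
  obtain ⟨i, rfl⟩ := π.surjective i
  obtain ⟨j, rfl⟩ := π.surjective j
  fin_cases i <;> fin_cases j <;> simp <;> linarith

/-- The lattice planes orthogonal to an integer point almost orthogonal to `(√h₀, √h₁, √h₂)`
contain no two independent points small with respect to `formMatrix`. -/
theorem no_small_plane {h : Fin 3 → ℤ} (hpos : ∀ i, 0 < h i)
    (hsq : ∀ i j, i ≠ j → ¬ IsSquare (h i * h j)) (c : Fin 3 → ℝ) (hc : ∑ k, c k < 0) (C : ℝ)
    {a : Fin 3 → ℝ} (ha : a = fun i => √(h i)) :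
    ∃ T₀, ∀ T ≥ T₀, ∀ w₁ w₂ y : Fin 3 → ℤ, (∃ i j, w₁ i * w₂ j ≠ w₁ j * w₂ i) →
      ∑ i, sqDiff a i * y i * w₁ i = 0 → ∑ i, sqDiff a i * y i * w₂ i = 0 → y ≠ 0 →
      |∑ j, formMatrix a 2 j * y j| ≤ C / T →
      (∀ k, |∑ j, formMatrix a k j * w₁ j| ≤ C * T ^ c k) →
      ¬ ∀ k, |∑ j, formMatrix a k j * w₂ j| ≤ C * T ^ c k := by
  have ha2 : ∀ i, a i ^ 2 = h i := fun i => by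
    rw [ha]; exact Real.sq_sqrt (by exact_mod_cast (hpos i).le)
  have ha0 : ∀ i, 0 < a i := fun i => by
    rw [ha]; exact Real.sqrt_pos.2 (by exact_mod_cast hpos i)
  have hinj : ∀ i j, i ≠ j → h i ≠ h j := fun i j hij he => hsq i j hij ⟨h i, by rw [he]⟩
  obtain ⟨d, hd, hd0⟩ : ∃ d : Fin 3 → ℤ, (∀ i, (d i : ℝ) = sqDiff a i) ∧ ∀ i, d i ≠ 0 := by
    refine ⟨![h 1 - h 2, h 2 - h 0, h 0 - h 1], fun i => ?_, fun i => ?_⟩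
    · fin_cases i <;> simp [sqDiff, ha2]
    · fin_cases i <;> simp [sub_ne_zero] <;> exact hinj _ _ (by decide)
  set O := Algebra.adjoin ℤ (Set.range a)
  have hint : ∀ x ∈ Set.range a, IsIntegral ℤ x := by
    rintro _ ⟨i, rfl⟩
    refine IsIntegral.of_pow two_pos ?_
    rw [ha2]; exact isIntegral_algebraMap (R := ℤ) (x := h i)
  have : Module.Finite ℤ O :=
    Algebra.finite_adjoin_of_finite_of_isIntegral (Set.finite_range a) hint
  have hO : ∀ i, a i ∈ O := fun i => Algebra.subset_adjoin ⟨i, rfl⟩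
  have hdO : ∀ i, sqDiff a i ∈ O := fun i => by
    rw [← hd]; exact intCast_mem O (d i)
  have hmem : ∀ k j, formMatrix a k j ∈ O := fun k j => by
    refine mul_mem (hdO j) ?_
    have h2 : (2 : ℝ) ∈ O := by exact_mod_cast natCast_mem O 2
    fin_cases k
    · exact mul_mem (hO j) (sub_mem (add_mem (add_mem (pow_mem (hO 0) 2) (pow_mem (hO 1) 2))
        (pow_mem (hO 2) 2)) (mul_mem h2 (pow_mem (hO j) 2)))
    · fin_cases j <;> exact mul_mem (hO _) (hO _)
    · exact hO j
  have hdet : (formMatrix a).det ≠ 0 := by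
    rw [det_formMatrix, ← hd, ← hd, ← hd]
    have h0 := hd0 0; have h1 := hd0 1; have h2 := hd0 2
    simp [h0, h1, h2]
  set η : ℝ := -(∑ k, c k) / 6 with hη
  have hη0 : 0 < η := by rw [hη]; linarith
  have hP : ∀ π : Equiv.Perm (Fin 3), ∃ x₀, ∀ x ≥ x₀,
      ¬ SmallPlane ((formMatrix a).submatrix id π) (fun k => c k + η) (1 / 12) x := by
    intro π
    set M : Matrix (Fin 3) (Fin 3) O :=
      Matrix.of fun k j => ⟨formMatrix a k (π j), hmem k (π j)⟩ with hM
    have hmap : (M.map fun b => (b : ℝ)) = (formMatrix a).submatrix id π := by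
      ext k j; simp [hM]
    have hMdet : M.det ≠ 0 := fun h0 => by
      have h1 := RingHom.map_det (algebraMap O ℝ) M
      rw [h0, map_zero] at h1
      have h2 : (algebraMap O ℝ).mapMatrix M = (formMatrix a).submatrix id π := hmap
      rw [h2, Matrix.det_permute'] at h1
      rcases mul_eq_zero.1 h1.symm with h | h
      · rcases Int.units_eq_one_or (Equiv.Perm.sign π) with h' | h' <;> simp [h'] at h
      · exact hdet h
    rw [← hmap]
    refine exists_forall_not_smallPlane M hMdet _ (3 * η) _ (by linarith) (by norm_num) ?_
    rw [sum_add_distrib]; simp; linarith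
  choose x₀ hx₀ using hP
  obtain ⟨X, hX⟩ : ∃ X, ∀ π, x₀ π ≤ X :=
    ⟨univ.sup' univ_nonempty x₀, fun π => le_sup' _ (mem_univ π)⟩
  set A : ℝ := ∑ i, √(h i)
  have hlim : ∀ᶠ T : ℝ in Filter.atTop, 1 < T ∧ X ≤ Real.log T ∧ C ≤ T ^ η ∧
      C * A ^ 3 ≤ T ^ (1 / 2 : ℝ) :=
    (Filter.eventually_gt_atTop 1).and ((Real.tendsto_log_atTop.eventually_ge_atTop X).and
      (((tendsto_rpow_atTop hη0).eventually_ge_atTop C).and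
      ((tendsto_rpow_atTop (by norm_num)).eventually_ge_atTop (C * A ^ 3))))
  obtain ⟨T₀, hT₀⟩ := Filter.eventually_atTop.1 hlim
  refine ⟨T₀, fun T hT w₁ w₂ y hw hw₁ hw₂ hy hys hs₁ hs₂ => ?_⟩
  obtain ⟨hT1, hTX, hTη, hTA⟩ := hT₀ T hT
  have hTpos : 0 < T := by linarith
  set m : Fin 3 → ℤ := fun i => d i * y i with hm
  have horth : ∀ w : Fin 3 → ℤ, ∑ i, sqDiff a i * y i * w i = 0 → ∑ i, m i * w i = 0 := by
    intro w hw
    simp only [← hd] at hw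
    exact_mod_cast hw
  obtain ⟨k, -, hkmax⟩ := exists_max_image univ (fun i => |m i|) univ_nonempty
  have hk : m k ≠ 0 := fun h0 => hy <| funext fun i => by
    have := hkmax i (mem_univ i)
    rw [h0, abs_zero, abs_nonpos_iff] at this
    exact (mul_eq_zero.1 this).resolve_left (hd0 i)
  obtain ⟨i, hik, hden⟩ := exists_large_den hpos hsq hk fun i => hkmax i (mem_univ i)
  have hsum : ∑ i, √(h i) * (m i : ℝ) = ∑ j, formMatrix a 2 j * y j := by
    refine sum_congr rfl fun j _ => ?_
    simp only [hm, formMatrix, Matrix.of_apply, Matrix.cons_val, ← hd]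
    rw [ha]; push_cast; ring
  rw [hsum] at hden
  set q := ((m i : ℚ) / m k).den
  have hq0 : (0 : ℝ) < q := by exact_mod_cast Rat.den_pos _
  have hA : 0 ≤ A := sum_nonneg fun i _ => Real.sqrt_nonneg _
  have hq : T ^ (1 / 2 : ℝ) ≤ (q : ℝ) ^ 6 := by
    have h1 : 1 ≤ T ^ (1 / 2 : ℝ) / T * (q : ℝ) ^ 6 := by
      refine hden.trans ?_
      gcongr
      calc _ ≤ C / T * A ^ 3 := by gcongr
        _ = C * A ^ 3 / T := by ring
        _ ≤ _ := by gcongr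
    have h2 : T = T ^ (1 / 2 : ℝ) * T ^ (1 / 2 : ℝ) := by
      rw [← Real.rpow_add hTpos]; norm_num
    have h3 : 0 < T ^ (1 / 2 : ℝ) := by positivity
    rw [div_mul_eq_mul_div, le_div_iff₀ hTpos, one_mul] at h1
    refine le_of_mul_le_mul_left (h2.symm.le.trans h1) h3
  have hlog : 1 / 12 * Real.log T ≤ Real.log q := by
    have := Real.log_le_log (by positivity) hq
    rw [Real.log_rpow hTpos, Real.log_pow] at this
    push_cast at this; linarith
  obtain ⟨π, hπ0, hπ2⟩ := exists_perm_zero_two i k hik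
  have hsmall : ∀ w : Fin 3 → ℤ, (∀ k, |∑ j, formMatrix a k j * w j| ≤ C * T ^ c k) →
      ∀ k, |∑ j, (formMatrix a).submatrix id π k j * ((w ∘ π) j : ℤ)| ≤
        Real.exp ((c k + η) * Real.log T) := by
    intro w hw k
    have h1 : ∑ j, (formMatrix a).submatrix id π k j * (((w ∘ π) j : ℤ) : ℝ) =
        ∑ j, formMatrix a k j * w j := Equiv.sum_comp π fun j => formMatrix a k j * (w j : ℝ)
    rw [h1, mul_comm (c k + η), ← Real.rpow_def_of_pos hTpos, Real.rpow_add hTpos,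
      mul_comm (T ^ c k)]
    exact (hw k).trans (by gcongr)
  refine hx₀ π (Real.log T) ((hX π).trans hTX) ⟨w₁ ∘ π, w₂ ∘ π, m ∘ π,
    minor_ne_zero (m := m) (by rwa [hπ2]) (horth _ hw₁) (horth _ hw₂) hw, ?_, ?_, ?_, ?_,
    hsmall _ hs₁, hsmall _ hs₂⟩
  · have := horth _ hw₁
    rwa [← Equiv.sum_comp π, Fin.sum_univ_three] at this
  · have := horth _ hw₂
    rwa [← Equiv.sum_comp π, Fin.sum_univ_three] at this
  · simpa [hπ2] using hk
  · simp only [Function.comp_apply, hπ0, hπ2]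
    exact hlog

/-- The linear forms with coefficients `formMatrix a`. -/
def linForm (a : Fin 3 → ℝ) (k : Fin 3) (v : Fin 3 → ℤ) : ℝ := ∑ j, formMatrix a k j * v j

/-- The bilinear form with coefficients `sqDiff a`. -/
def bilForm (a : Fin 3 → ℝ) (v w : Fin 3 → ℤ) : ℝ := ∑ i, sqDiff a i * v i * w i

/-- The cross product of `v` and `w`, as a vector for the quadratic form with coefficients `d`. -/
def crossVec (d v w : Fin 3 → ℤ) : Fin 3 → ℤ :=
  ![(v 1 * w 2 - v 2 * w 1) * (d 1 * d 2), (v 2 * w 0 - v 0 * w 2) * (d 2 * d 0),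
    (v 0 * w 1 - v 1 * w 0) * (d 0 * d 1)]

/-- The product of the entries of `sqDiff a`. -/
def sqDiffProd (a : Fin 3 → ℝ) : ℝ := sqDiff a 0 * sqDiff a 1 * sqDiff a 2

section identities
variable (a : Fin 3 → ℝ)

lemma linForm_smul_add (k : Fin 3) (v w : Fin 3 → ℤ) (t : ℤ) :
    linForm a k (v + t • w) = linForm a k v + t * linForm a k w := by
  simp only [linForm, mul_sum, ← sum_add_distrib]
  exact sum_congr rfl fun j _ => by simp; ring

lemma linForm_eq_mul {v w : Fin 3 → ℤ} {t : ℝ} (h : ∀ i, (v i : ℝ) = t * w i) (k : Fin 3) :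
    linForm a k v = t * linForm a k w := by
  simp only [linForm, mul_sum, h]
  exact sum_congr rfl fun j _ => by ring

lemma bilForm_eq_linForm (v w : Fin 3 → ℤ) :
    2 * (sqDiffProd a * bilForm a v w) = linForm a 0 v * linForm a 2 w +
      linForm a 2 v * linForm a 0 w - 2 * (linForm a 1 v * linForm a 1 w) := by
  simp [sqDiffProd, bilForm, linForm, formMatrix, sqDiff, Fin.sum_univ_three]
  ring

lemma coord_eq_linForm (v : Fin 3 → ℤ) (j : Fin 3) :
    2 * (sqDiffProd a * v j) = linForm a 0 v * a j +
      linForm a 2 v * (a j * (a 0 ^ 2 + a 1 ^ 2 + a 2 ^ 2 - 2 * a j ^ 2)) -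
      2 * (linForm a 1 v * ![a 1 * a 2, a 2 * a 0, a 0 * a 1] j) := by
  fin_cases j <;>
  · simp [sqDiffProd, linForm, formMatrix, sqDiff, Fin.sum_univ_three]
    ring

variable {a} {d : Fin 3 → ℤ}

lemma linForm_crossVec_zero (hd : ∀ i, (d i : ℝ) = sqDiff a i) (v w : Fin 3 → ℤ) :
    linForm a 0 (crossVec d v w) =
      linForm a 1 v * linForm a 0 w - linForm a 0 v * linForm a 1 w := by
  simp [crossVec, hd, linForm, formMatrix, sqDiff, Fin.sum_univ_three]
  ring

lemma linForm_crossVec_one (hd : ∀ i, (d i : ℝ) = sqDiff a i) (v w : Fin 3 → ℤ) :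
    2 * linForm a 1 (crossVec d v w) =
      linForm a 2 v * linForm a 0 w - linForm a 0 v * linForm a 2 w := by
  simp [crossVec, hd, linForm, formMatrix, sqDiff, Fin.sum_univ_three]
  ring

lemma linForm_crossVec_two (hd : ∀ i, (d i : ℝ) = sqDiff a i) (v w : Fin 3 → ℤ) :
    linForm a 2 (crossVec d v w) =
      linForm a 2 v * linForm a 1 w - linForm a 1 v * linForm a 2 w := by
  simp [crossVec, hd, linForm, formMatrix, sqDiff, Fin.sum_univ_three]
  ring
end identities

/-- The scaled sum of squares of the first two linear forms. -/
noncomputable def normForm (a : Fin 3 → ℝ) (T s : ℝ) (v : Fin 3 → ℤ) : ℝ :=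
  (T ^ (s - 1) * linForm a 0 v) ^ 2 + (T ^ (-s) * linForm a 1 v) ^ 2

/-- `v` is a shortest nonzero vector of the lattice orthogonal to `n`. -/
def IsShortest (a : Fin 3 → ℝ) (n : Fin 3 → ℤ) (T s : ℝ) (v : Fin 3 → ℤ) : Prop :=
  bilForm a n v = 0 ∧ v ≠ 0 ∧
    ∀ w, bilForm a n w = 0 → w ≠ 0 → normForm a T s v ≤ normForm a T s w

lemma normForm_eq_mul {a : Fin 3 → ℝ} {v w : Fin 3 → ℤ} {t : ℝ} (h : ∀ i, (v i : ℝ) = t * w i)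
    (T s : ℝ) : normForm a T s v = t ^ 2 * normForm a T s w := by
  simp only [normForm, linForm_eq_mul a h]; ring

lemma bilForm_eq_mul {a : Fin 3 → ℝ} {v w : Fin 3 → ℤ} {t : ℝ} (h : ∀ i, (v i : ℝ) = t * w i)
    (n : Fin 3 → ℤ) : bilForm a n v = t * bilForm a n w := by
  simp only [bilForm, mul_sum, h]
  exact sum_congr rfl fun j _ => by ring

lemma normForm_nonneg (a : Fin 3 → ℝ) (T s : ℝ) (v : Fin 3 → ℤ) : 0 ≤ normForm a T s v := by
  unfold normForm; positivity

section lattice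
variable {a : Fin 3 → ℝ} {n : Fin 3 → ℤ} {T s : ℝ}

lemma linForm_two_eq (hn : linForm a 0 n ≠ 0) {v : Fin 3 → ℤ} (hv : bilForm a n v = 0) :
    linForm a 2 v = (2 * (linForm a 1 n * linForm a 1 v) - linForm a 2 n * linForm a 0 v) /
      linForm a 0 n := by
  have := bilForm_eq_linForm a n v
  rw [hv] at this
  rw [eq_div_iff hn]; linarith

lemma exists_coord_bound (hn : linForm a 0 n ≠ 0) (hV : sqDiffProd a ≠ 0) :
    ∃ K, 0 ≤ K ∧ ∀ v, bilForm a n v = 0 → ∀ j,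
      |(v j : ℝ)| ≤ K * (|linForm a 0 v| + |linForm a 1 v|) := by
  set γ : Fin 3 → ℝ := fun j => a j * (a 0 ^ 2 + a 1 ^ 2 + a 2 ^ 2 - 2 * a j ^ 2)
  set β : Fin 3 → ℝ := ![a 1 * a 2, a 2 * a 0, a 0 * a 1]
  set p : Fin 3 → ℝ := fun j => (a j - linForm a 2 n / linForm a 0 n * γ j) / (2 * sqDiffProd a)
  set q : Fin 3 → ℝ := fun j =>
    (2 * linForm a 1 n / linForm a 0 n * γ j - 2 * β j) / (2 * sqDiffProd a)
  have hp : ∀ j, |p j| ≤ ∑ i, (|p i| + |q i|) := fun j =>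
    (le_add_of_nonneg_right (abs_nonneg _)).trans
      (single_le_sum (f := fun i => |p i| + |q i|) (fun i _ => by positivity) (mem_univ j))
  have hq : ∀ j, |q j| ≤ ∑ i, (|p i| + |q i|) := fun j =>
    (le_add_of_nonneg_left (abs_nonneg _)).trans
      (single_le_sum (f := fun i => |p i| + |q i|) (fun i _ => by positivity) (mem_univ j))
  refine ⟨∑ i, (|p i| + |q i|), by positivity, fun v hv j => ?_⟩
  have h1 : (v j : ℝ) = p j * linForm a 0 v + q j * linForm a 1 v := by
    have := coord_eq_linForm a v j
    rw [linForm_two_eq hn hv] at this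
    have h2 : (v j : ℝ) = (2 * (sqDiffProd a * v j)) / (2 * sqDiffProd a) := by
      field_simp
    rw [h2, this]
    simp only [p, q, γ, β]
    field_simp
    ring
  rw [h1, mul_add]
  refine (abs_add_le _ _).trans ?_
  rw [abs_mul, abs_mul]
  gcongr
  · exact hp j
  · exact hq j

lemma abs_linForm_le (hT : 0 < T) {v : Fin 3 → ℤ} {K : ℝ} (hK : 0 ≤ K)
    (h : normForm a T s v ≤ K ^ 2) :
    |linForm a 0 v| ≤ K * T ^ (1 - s) ∧ |linForm a 1 v| ≤ K * T ^ s := by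
  unfold normForm at h
  have h1 : |T ^ (s - 1) * linForm a 0 v| ≤ K := abs_le_of_sq_le_sq
    (by nlinarith [sq_nonneg (T ^ (-s) * linForm a 1 v)]) hK
  have h2 : |T ^ (-s) * linForm a 1 v| ≤ K := abs_le_of_sq_le_sq
    (by nlinarith [sq_nonneg (T ^ (s - 1) * linForm a 0 v)]) hK
  rw [abs_mul, abs_of_pos (Real.rpow_pos_of_pos hT _)] at h1 h2
  constructor
  · rw [show 1 - s = -(s - 1) by ring, Real.rpow_neg hT.le, ← div_eq_mul_inv,
      le_div_iff₀ (by positivity), mul_comm]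
    exact h1
  · rw [Real.rpow_neg hT.le, inv_mul_le_iff₀ (by positivity)] at h2
    linarith

lemma normForm_pos (hn : linForm a 0 n ≠ 0) (hV : sqDiffProd a ≠ 0) (hT : 0 < T)
    {v : Fin 3 → ℤ} (hv : bilForm a n v = 0) (hv0 : v ≠ 0) :
    0 < normForm a T s v := by
  refine (normForm_nonneg a T s v).lt_of_ne fun h0 => hv0 ?_
  obtain ⟨K, -, hK⟩ := exists_coord_bound hn hV
  obtain ⟨h1, h2⟩ := abs_linForm_le (s := s) hT le_rfl (by rw [← h0]; norm_num)
  funext j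
  have := hK v hv j
  have h3 : |linForm a 0 v| = 0 := le_antisymm (by linarith) (abs_nonneg _)
  have h4 : |linForm a 1 v| = 0 := le_antisymm (by linarith) (abs_nonneg _)
  rw [h3, h4, add_zero, mul_zero, abs_nonpos_iff] at this
  exact_mod_cast this

lemma exists_bilForm_eq_zero {d : Fin 3 → ℤ} (hd : ∀ i, (d i : ℝ) = sqDiff a i) :
    ∃ v, bilForm a n v = 0 ∧ v ≠ 0 := by
  have key : ∀ v : Fin 3 → ℤ, d 0 * n 0 * v 0 + d 1 * n 1 * v 1 + d 2 * n 2 * v 2 = 0 →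
      bilForm a n v = 0 := fun v hv => by
    simp only [bilForm, Fin.sum_univ_three, ← hd]; exact_mod_cast hv
  by_cases h : d 0 * n 0 = 0
  · exact ⟨![1, 0, 0], key _ (by simp [h]), fun h => by simpa using congr_fun h 0⟩
  · exact ⟨![d 1 * n 1, -(d 0 * n 0), 0], key _ (by simp; ring), fun h' => by
      have := congr_fun h' 1
      simp at this; simp [this] at h⟩

lemma exists_isShortest (hn : linForm a 0 n ≠ 0) (hV : sqDiffProd a ≠ 0) (hT : 0 < T)
    {d : Fin 3 → ℤ} (hd : ∀ i, (d i : ℝ) = sqDiff a i) (s : ℝ) :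
    ∃ v, IsShortest a n T s v := by
  obtain ⟨v₀, hv₀, hv₀'⟩ := exists_bilForm_eq_zero (n := n) hd
  obtain ⟨K, hK0, hK⟩ := exists_coord_bound hn hV
  set S := {v | bilForm a n v = 0 ∧ v ≠ 0 ∧ normForm a T s v ≤ normForm a T s v₀}
  have hfin : S.Finite := by
    set Q := √(normForm a T s v₀)
    obtain ⟨B, hB⟩ := exists_nat_ge (K * (Q * T ^ (1 - s) + Q * T ^ s))
    refine (Set.finite_Icc (fun _ => -(B : ℤ)) fun _ : Fin 3 => (B : ℤ)).subset ?_
    rintro v ⟨hv, -, hle⟩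
    obtain ⟨h1, h2⟩ := abs_linForm_le (s := s) hT (Real.sqrt_nonneg _)
      (hle.trans_eq (Real.sq_sqrt (normForm_nonneg _ _ _ _)).symm)
    have h3 : ∀ j, |v j| ≤ (B : ℤ) := fun j => by
      have : |(v j : ℝ)| ≤ B := (hK v hv j).trans (le_trans (by gcongr) hB)
      exact_mod_cast this
    exact ⟨fun j => (abs_le.1 (h3 j)).1, fun j => (abs_le.1 (h3 j)).2⟩
  obtain ⟨v, ⟨hv, hv0, hle⟩, hmin⟩ := Set.exists_min_image S (normForm a T s) hfin
    ⟨v₀, hv₀, hv₀', le_rfl⟩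
  refine ⟨v, hv, hv0, fun w hw hw0 => ?_⟩
  rcases le_total (normForm a T s w) (normForm a T s v₀) with h | h
  · exact hmin w ⟨hw, hw0, h⟩
  · exact hle.trans h

lemma IsShortest.exists_sum_mul_eq_one (hn : linForm a 0 n ≠ 0) (hV : sqDiffProd a ≠ 0) (hT : 0 < T)
    {v : Fin 3 → ℤ} (hv : IsShortest a n T s v) :
    ∃ u : Fin 3 → ℤ, ∑ i, u i * v i = 1 := by
  obtain ⟨g, hg⟩ := (IsPrincipalIdealRing.principal (Ideal.span (Set.range v))).principal
  have hdvd : ∀ i, ∃ t, v i = g * t := fun i => by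
    have : v i ∈ Ideal.span (Set.range v) := Ideal.subset_span ⟨i, rfl⟩
    rw [hg] at this
    exact Ideal.mem_span_singleton.1 this
  choose w hw using hdvd
  have hgmem : g ∈ Ideal.span (Set.range v) := by
    rw [hg]; exact Ideal.mem_span_singleton_self g
  obtain ⟨u, hu⟩ := (Ideal.mem_span_range_iff_exists_fun).1 hgmem
  have hg0 : g ≠ 0 := fun h => hv.2.1 (funext fun i => by simp [hw, h])
  have hwv : ∀ i, (v i : ℝ) = (g : ℝ) * w i := fun i => by rw [hw i]; push_cast; ring
  have hgR : (g : ℝ) ≠ 0 := by exact_mod_cast hg0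
  have hw0 : w ≠ 0 := fun h => hv.2.1 (funext fun i => by simp [hw, h])
  have hwΓ : bilForm a n w = 0 := by
    have := hv.1
    rw [bilForm_eq_mul hwv] at this
    exact (mul_eq_zero.1 this).resolve_left hgR
  have h1 := hv.2.2 w hwΓ hw0
  rw [normForm_eq_mul hwv] at h1
  have hpos := normForm_pos (s := s) hn hV hT hwΓ hw0
  have h2 : (g : ℝ) ^ 2 ≤ 1 := by
    by_contra! h; nlinarith
  have h3 : g ^ 2 ≤ 1 := by exact_mod_cast h2
  have h4 : g = 1 ∨ g = -1 := by
    have : |g| ≤ 1 := by nlinarith [sq_abs g, abs_nonneg g]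
    have := abs_le.1 this
    omega
  rcases h4 with rfl | rfl
  · exact ⟨u, hu⟩
  · exact ⟨-u, by simp [hu]⟩

lemma exists_abs_add_mul_le (x : ℝ) {y : ℝ} (hy : 0 < y) : ∃ t : ℤ, |x + t * y| ≤ y / 2 := by
  refine ⟨-round (x / y), ?_⟩
  have := abs_sub_round (x / y)
  have h : x + ((-round (x / y) : ℤ) : ℝ) * y = (x / y - round (x / y)) * y := by
    push_cast; field_simp; ring
  rw [h, abs_mul, abs_of_pos hy]
  nlinarith

lemma IsShortest.exists_second (hn : linForm a 0 n ≠ 0) (hV : sqDiffProd a ≠ 0) (hT : 0 < T)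
    {d : Fin 3 → ℤ} (hd : ∀ i, (d i : ℝ) = sqDiff a i)
    {v : Fin 3 → ℤ} (hv : IsShortest a n T s v) :
    ∃ w, bilForm a n w = 0 ∧ (∃ i j, v i * w j ≠ v j * w i) ∧
      normForm a T s v * normForm a T s w ≤ 2 * (sqDiffProd a * linForm a 0 n / T) ^ 2 ∧
      normForm a T s v ≤ normForm a T s w := by
  obtain ⟨u, hu⟩ := hv.exists_sum_mul_eq_one hn hV hT
  have hpos := normForm_pos (s := s) hn hV hT hv.1 hv.2.1
  have hint : ∀ w : Fin 3 → ℤ, bilForm a n w =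
      ((d 0 * n 0 * w 0 + d 1 * n 1 * w 1 + d 2 * n 2 * w 2 : ℤ) : ℝ) := fun w => by
    simp [bilForm, Fin.sum_univ_three, ← hd]
  have hv' : d 0 * n 0 * v 0 + d 1 * n 1 * v 1 + d 2 * n 2 * v 2 = 0 := by
    have := hv.1
    rw [hint] at this; exact_mod_cast this
  rw [Fin.sum_univ_three] at hu
  set w₀ : Fin 3 → ℤ := ![d 1 * n 1 * u 2 - d 2 * n 2 * u 1, d 2 * n 2 * u 0 - d 0 * n 0 * u 2,
    d 0 * n 0 * u 1 - d 1 * n 1 * u 0] with hw₀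
  set ip : (Fin 3 → ℤ) → ℝ := fun w => T ^ (s - 1) * linForm a 0 v * (T ^ (s - 1) * linForm a 0 w) +
    T ^ (-s) * linForm a 1 v * (T ^ (-s) * linForm a 1 w) with hip
  obtain ⟨t, ht⟩ := exists_abs_add_mul_le (ip w₀) hpos
  set w := w₀ + t • v with hw
  have hwc : w 0 = d 1 * n 1 * u 2 - d 2 * n 2 * u 1 + t * v 0 ∧
      w 1 = d 2 * n 2 * u 0 - d 0 * n 0 * u 2 + t * v 1 ∧
      w 2 = d 0 * n 0 * u 1 - d 1 * n 1 * u 0 + t * v 2 := ⟨rfl, rfl, rfl⟩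
  have hipw : ip w = ip w₀ + t * normForm a T s v := by
    simp only [hip, hw, linForm_smul_add, normForm]; ring
  rw [← hipw] at ht
  have hwΓ : bilForm a n w = 0 := by
    rw [hint]
    have : d 0 * n 0 * w 0 + d 1 * n 1 * w 1 + d 2 * n 2 * w 2 = 0 := by
      rw [hwc.1, hwc.2.1, hwc.2.2]; linear_combination t * hv'
    exact_mod_cast this
  have hcross : ∀ i, (crossVec d v w i : ℝ) = sqDiffProd a * n i := by
    have h0 : crossVec d v w 0 = d 0 * d 1 * d 2 * n 0 := by
      simp [crossVec, hwc.1, hwc.2.1, hwc.2.2]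
      linear_combination d 0 * d 1 * d 2 * n 0 * hu - d 1 * d 2 * u 0 * hv'
    have h1 : crossVec d v w 1 = d 0 * d 1 * d 2 * n 1 := by
      simp [crossVec, hwc.1, hwc.2.1, hwc.2.2]
      linear_combination d 0 * d 1 * d 2 * n 1 * hu - d 2 * d 0 * u 1 * hv'
    have h2 : crossVec d v w 2 = d 0 * d 1 * d 2 * n 2 := by
      simp [crossVec, hwc.1, hwc.2.1, hwc.2.2]
      linear_combination d 0 * d 1 * d 2 * n 2 * hu - d 0 * d 1 * u 2 * hv'
    have hp : (sqDiffProd a : ℝ) = ((d 0 * d 1 * d 2 : ℤ) : ℝ) := by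
      simp [sqDiffProd, hd]
    intro i
    rw [hp, ← Int.cast_mul]
    fin_cases i
    · exact congrArg _ h0
    · exact congrArg _ h1
    · exact congrArg _ h2
  have hX := linForm_eq_mul a hcross 0
  rw [linForm_crossVec_zero hd] at hX
  have hind : ∃ i j, v i * w j ≠ v j * w i := by
    by_contra! hpar
    have h0 : crossVec d v w = 0 := by
      funext i
      fin_cases i <;> simp [crossVec, hpar 1 2, hpar 2 0, hpar 0 1]
    refine mul_ne_zero hV hn (hX.symm.trans ?_)
    have := linForm_crossVec_zero hd v w
    rw [← this, h0]; simp [linForm]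
  have hw0 : w ≠ 0 := by
    rintro h0
    obtain ⟨i, j, hij⟩ := hind
    rw [h0] at hij; simp at hij
  have hle := hv.2.2 w hwΓ hw0
  refine ⟨w, hwΓ, hind, ?_, hle⟩
  have hlag : normForm a T s v * normForm a T s w =
      ip w ^ 2 + (sqDiffProd a * linForm a 0 n / T) ^ 2 := by
    have h1 : T ^ (s - 1) * T ^ (-s) = 1 / T := by
      rw [← Real.rpow_add hT, show s - 1 + -s = -1 by ring, Real.rpow_neg_one, one_div]
    have h2 : (T ^ (s - 1) * T ^ (-s) * (linForm a 1 v * linForm a 0 w -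
        linForm a 0 v * linForm a 1 w)) ^ 2 = (sqDiffProd a * linForm a 0 n / T) ^ 2 := by
      rw [h1, hX]; ring
    rw [← h2]
    simp only [hip, normForm]; ring
  have h3 : ip w ^ 2 ≤ (normForm a T s v / 2) ^ 2 := sq_le_sq' (by linarith [(abs_le.1 ht).1])
    (abs_le.1 ht).2
  nlinarith
end lattice

section parallel
variable {a : Fin 3 → ℝ} {n : Fin 3 → ℤ} {T s : ℝ} {d : Fin 3 → ℤ}

lemma parallel_of_crossVec_eq_zero (hd0 : ∀ i, d i ≠ 0) {v w : Fin 3 → ℤ}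
    (h : crossVec d v w = 0) (i j : Fin 3) : v i * w j = v j * w i := by
  have h0 : (v 1 * w 2 - v 2 * w 1) * (d 1 * d 2) = 0 := congr_fun h 0
  have h1 : (v 2 * w 0 - v 0 * w 2) * (d 2 * d 0) = 0 := congr_fun h 1
  have h2 : (v 0 * w 1 - v 1 * w 0) * (d 0 * d 1) = 0 := congr_fun h 2
  have h0 := (mul_eq_zero.1 h0).resolve_right (mul_ne_zero (hd0 _) (hd0 _))
  have h1 := (mul_eq_zero.1 h1).resolve_right (mul_ne_zero (hd0 _) (hd0 _))
  have h2 := (mul_eq_zero.1 h2).resolve_right (mul_ne_zero (hd0 _) (hd0 _))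
  fin_cases i <;> fin_cases j <;> simp <;> linarith

lemma parallel_of_crossVec_small (hd : ∀ i, (d i : ℝ) = sqDiff a i) (hd0 : ∀ i, d i ≠ 0)
    (hn : linForm a 0 n ≠ 0) (hq : bilForm a n n = sqDiffProd a) {v w : Fin 3 → ℤ}
    (hv : bilForm a n v = 0) (hw : bilForm a n w = 0)
    (hs : |sqDiffProd a| * linForm a 0 (crossVec d v w) ^ 2 < linForm a 0 n ^ 2) (i j : Fin 3) :
    v i * w j = v j * w i := by
  have hint : ∀ u w : Fin 3 → ℤ, bilForm a u w =
      ((d 0 * u 0 * w 0 + d 1 * u 1 * w 1 + d 2 * u 2 * w 2 : ℤ) : ℝ) := fun u w => by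
    simp [bilForm, Fin.sum_univ_three, ← hd]
  have hv' := hint n v
  have hw' := hint n w
  rw [hv, eq_comm, Int.cast_eq_zero] at hv'
  rw [hw, eq_comm, Int.cast_eq_zero] at hw'
  set x := crossVec d v w with hx
  set t := linForm a 0 x / linForm a 0 n with ht
  have hx0 : x 0 = (v 1 * w 2 - v 2 * w 1) * (d 1 * d 2) := rfl
  have hx1 : x 1 = (v 2 * w 0 - v 0 * w 2) * (d 2 * d 0) := rfl
  have hx2 : x 2 = (v 0 * w 1 - v 1 * w 0) * (d 0 * d 1) := rfl
  have h01 : x 0 * n 1 = x 1 * n 0 := by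
    rw [hx0, hx1]; linear_combination w 2 * d 2 * hv' - v 2 * d 2 * hw'
  have h12 : x 1 * n 2 = x 2 * n 1 := by
    rw [hx1, hx2]; linear_combination w 0 * d 0 * hv' - v 0 * d 0 * hw'
  have h20 : x 2 * n 0 = x 0 * n 2 := by
    rw [hx2, hx0]; linear_combination w 1 * d 1 * hv' - v 1 * d 1 * hw'
  have hpar : ∀ i j, x i * n j = x j * n i := by
    intro i j
    fin_cases i <;> fin_cases j <;> simp <;> linarith
  have hxt : ∀ i, (x i : ℝ) = t * n i := fun i => by
    rw [ht, div_mul_eq_mul_div, eq_div_iff hn]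
    simp only [linForm, mul_sum, sum_mul]
    refine sum_congr rfl fun j _ => ?_
    have : (x i : ℝ) * n j = x j * n i := by exact_mod_cast hpar i j
    linear_combination formMatrix a 0 j * this
  have hQ : bilForm a x x = t ^ 2 * sqDiffProd a := by
    rw [← hq]
    simp only [bilForm, mul_sum, hxt]
    exact sum_congr rfl fun j _ => by ring
  have hlt : |t ^ 2 * sqDiffProd a| < 1 := by
    rw [abs_mul, abs_of_nonneg (sq_nonneg t), ht, div_pow, div_mul_eq_mul_div,
      div_lt_one (by positivity)]
    linarith
  have hV : sqDiffProd a ≠ 0 := by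
    have h0 := hd0 0; have h1 := hd0 1; have h2 := hd0 2
    simp [sqDiffProd, ← hd, h0, h1, h2]
  have ht0 : t = 0 := by
    rw [← hQ, hint] at hlt
    have h1 : d 0 * x 0 * x 0 + d 1 * x 1 * x 1 + d 2 * x 2 * x 2 = 0 :=
      Int.abs_lt_one_iff.1 (by exact_mod_cast hlt)
    rw [hint, h1, Int.cast_zero, eq_comm] at hQ
    exact pow_eq_zero_iff two_ne_zero |>.1 ((mul_eq_zero.1 hQ).resolve_right hV)
  refine parallel_of_crossVec_eq_zero hd0 (funext fun i => ?_) i j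
  have := hxt i
  rw [ht0, zero_mul] at this; exact_mod_cast this

lemma exists_eq_mul_of_parallel {v w : Fin 3 → ℤ} (hw : w ≠ 0)
    (h : ∀ i j, v i * w j = v j * w i) : ∃ t : ℝ, ∀ i, (v i : ℝ) = t * w i := by
  obtain ⟨j, hj⟩ := Function.ne_iff.1 hw
  have hj' : (w j : ℝ) ≠ 0 := by exact_mod_cast hj
  refine ⟨v j / w j, fun i => ?_⟩
  rw [div_mul_eq_mul_div, eq_div_iff hj']
  exact_mod_cast h i j

lemma IsShortest.of_parallel {s' : ℝ} {v w : Fin 3 → ℤ} (hv : IsShortest a n T s v)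
    (hw : IsShortest a n T s' w) (hpos : 0 < normForm a T s w)
    (h : ∀ i j, v i * w j = v j * w i) : IsShortest a n T s' v := by
  obtain ⟨t, ht⟩ := exists_eq_mul_of_parallel hw.2.1 h
  refine ⟨hv.1, hv.2.1, fun u hu hu0 => le_trans ?_ (hw.2.2 u hu hu0)⟩
  have h1 := hv.2.2 w hw.1 hw.2.1
  rw [normForm_eq_mul ht] at h1 ⊢
  have ht1 : t ^ 2 ≤ 1 := by by_contra! hc; nlinarith
  nlinarith [normForm_nonneg a T s' w]

/-- Either some scale has no very short vector, or one vector is very short at all scales. -/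
lemma exists_shortest_dichotomy (hd : ∀ i, (d i : ℝ) = sqDiff a i) (hd0 : ∀ i, d i ≠ 0)
    (hT : 1 ≤ T) {κ : ℝ} (hκ : 0 < κ) (hTκ : 4 * |sqDiffProd a| < T ^ (2 * κ))
    (hn : T ≤ linForm a 0 n) (hq : bilForm a n n = sqDiffProd a) :
    (∃ j ∈ Icc 5 20, ∃ v, IsShortest a n T ((j : ℕ) * κ) v ∧
      (T ^ (-κ)) ^ 2 ≤ normForm a T (j * κ) v) ∨
    ∃ v, v ≠ 0 ∧ bilForm a n v = 0 ∧ normForm a T (5 * κ) v ≤ (T ^ (-κ)) ^ 2 ∧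
      normForm a T (20 * κ) v ≤ (T ^ (-κ)) ^ 2 := by
  have hT0 : 0 < T := by linarith
  have hn0 : linForm a 0 n ≠ 0 := by linarith
  have hV : sqDiffProd a ≠ 0 := by
    have h0 := hd0 0; have h1 := hd0 1; have h2 := hd0 2
    simp [sqDiffProd, ← hd, h0, h1, h2]
  by_contra! hcon
  obtain ⟨hall, hnone⟩ := hcon
  obtain ⟨v, hv⟩ := exists_isShortest hn0 hV hT0 hd ((5 : ℕ) * κ)
  have key : ∀ i : ℕ, i ≤ 15 → IsShortest a n T ((5 + i : ℕ) * κ) v := by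
    intro i
    induction i with
    | zero => exact fun _ => hv
    | succ i ih =>
      intro hi
      have hvi := ih (by omega)
      obtain ⟨w, hw⟩ := exists_isShortest hn0 hV hT0 hd ((5 + (i + 1) : ℕ) * κ)
      have hqv := hall (5 + i) (mem_Icc.2 (by omega)) v hvi
      have hqw := hall (5 + (i + 1)) (mem_Icc.2 (by omega)) w hw
      obtain ⟨hXv, hYv⟩ := abs_linForm_le hT0 (by positivity) hqv.le
      obtain ⟨hXw, hYw⟩ := abs_linForm_le hT0 (by positivity) hqw.le
      refine hvi.of_parallel hw (normForm_pos hn0 hV hT0 hw.1 hw.2.1)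
        (parallel_of_crossVec_small hd hd0 hn0 hq hvi.1 hw.1 ?_)
      set s : ℝ := (5 + i : ℕ) * κ with hs
      have hs' : ((5 + (i + 1) : ℕ) : ℝ) * κ = s + κ := by rw [hs]; push_cast; ring
      rw [hs'] at hXw hYw
      have hX : |linForm a 0 (crossVec d v w)| ≤ 2 * T ^ (1 - κ) := by
        rw [linForm_crossVec_zero hd]
        refine (abs_sub _ _).trans ?_
        rw [abs_mul, abs_mul]
        have h1 : |linForm a 1 v| * |linForm a 0 w| ≤ T ^ (1 - κ) := by
          calc _ ≤ T ^ (-κ) * T ^ s * (T ^ (-κ) * T ^ (1 - (s + κ))) := by gcongr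
            _ = T ^ (1 - 3 * κ) := by
              simp only [← Real.rpow_add hT0]; congr 1; ring
            _ ≤ _ := Real.rpow_le_rpow_of_exponent_le hT (by linarith)
        have h2 : |linForm a 0 v| * |linForm a 1 w| ≤ T ^ (1 - κ) := by
          calc _ ≤ T ^ (-κ) * T ^ (1 - s) * (T ^ (-κ) * T ^ (s + κ)) := by gcongr
            _ = T ^ (1 - κ) := by
              simp only [← Real.rpow_add hT0]; congr 1; ring
        linarith
      have hsq : linForm a 0 (crossVec d v w) ^ 2 ≤ 4 * T ^ (2 - 2 * κ) := by
        rw [← sq_abs]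
        calc _ ≤ (2 * T ^ (1 - κ)) ^ 2 := by gcongr
          _ = 4 * (T ^ (1 - κ) * T ^ (1 - κ)) := by ring
          _ = _ := by rw [← Real.rpow_add hT0]; congr 2; ring
      calc _ ≤ |sqDiffProd a| * (4 * T ^ (2 - 2 * κ)) := by gcongr
        _ = 4 * |sqDiffProd a| * T ^ (2 - 2 * κ) := by ring
        _ < T ^ (2 * κ) * T ^ (2 - 2 * κ) := by gcongr
        _ = T ^ 2 := by
          rw [← Real.rpow_add hT0, show 2 * κ + (2 - 2 * κ) = ((2 : ℕ) : ℝ) by push_cast; ring,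
            Real.rpow_natCast]
        _ ≤ _ := by gcongr
  have h5 := hall 5 (by simp) v (by simpa using key 0 (by norm_num))
  have h20 := hall 20 (by simp) v (by simpa using key 15 (by norm_num))
  push_cast at h5 h20
  linarith [hnone v hv.2.1 hv.1 h5.le]
end parallel

lemma abs_mul_le_rpow {T x y A B p q r : ℝ} (hT : 1 ≤ T) (hx : |x| ≤ A * T ^ p)
    (hy : |y| ≤ B * T ^ q) (hr : p + q ≤ r) : |x * y| ≤ A * B * T ^ r := by
  have hT0 : 0 < T := by linarith
  have hA : 0 ≤ A := nonneg_of_mul_nonneg_left ((abs_nonneg x).trans hx) (by positivity)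
  have hB : 0 ≤ B := nonneg_of_mul_nonneg_left ((abs_nonneg y).trans hy) (by positivity)
  rw [abs_mul]
  calc _ ≤ A * T ^ p * (B * T ^ q) := by gcongr
    _ = A * B * T ^ (p + q) := by rw [Real.rpow_add hT0]; ring
    _ ≤ _ := by gcongr

lemma le_mul_rpow {T x A B p r : ℝ} (hT : 1 ≤ T) (hx : |x| ≤ A * T ^ p) (hAB : A ≤ B)
    (hr : p ≤ r) : |x| ≤ B * T ^ r := by
  have hT0 : 0 < T := by linarith
  have hA : 0 ≤ A := nonneg_of_mul_nonneg_left ((abs_nonneg x).trans hx) (by positivity)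
  have hB : 0 ≤ B := hA.trans hAB
  calc _ ≤ A * T ^ p := hx
    _ ≤ B * T ^ r := by gcongr

section cone
variable {a : Fin 3 → ℝ} {n : Fin 3 → ℤ} {T ρ C : ℝ}

lemma abs_linForm_two_le (hT : 1 ≤ T) (hX : T ≤ linForm a 0 n)
    (hY : |linForm a 1 n| ≤ T ^ (-(2 * ρ))) (hZ : |linForm a 2 n| ≤ C / T)
    {v : Fin 3 → ℤ} (hv : bilForm a n v = 0) {A p q r : ℝ}
    (hXv : |linForm a 0 v| ≤ A * T ^ p) (hYv : |linForm a 1 v| ≤ A * T ^ q)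
    (hp : p - 2 ≤ r) (hq : q - 2 * ρ - 1 ≤ r) : |linForm a 2 v| ≤ A * (2 + C) * T ^ r := by
  have hT0 : 0 < T := by linarith
  rw [div_eq_mul_inv, ← Real.rpow_neg_one] at hZ
  have h1 : |linForm a 1 n * linForm a 1 v| ≤ 1 * A * T ^ (r + 1) :=
    abs_mul_le_rpow hT (by rwa [one_mul]) hYv (by linarith)
  have h2 : |linForm a 2 n * linForm a 0 v| ≤ C * A * T ^ (r + 1) :=
    abs_mul_le_rpow hT hZ hXv (by linarith)
  rw [linForm_two_eq (by linarith : linForm a 0 n ≠ 0) hv, abs_div,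
    abs_of_pos (by linarith : 0 < linForm a 0 n), div_le_iff₀ (by linarith)]
  have h3 : A * (2 + C) * T ^ (r + 1) = A * (2 + C) * T ^ r * T := by
    rw [Real.rpow_add hT0, Real.rpow_one]; ring
  have h4 : |2 * (linForm a 1 n * linForm a 1 v) - linForm a 2 n * linForm a 0 v| ≤
      A * (2 + C) * T ^ (r + 1) := by
    refine (abs_sub _ _).trans ?_
    rw [abs_mul, abs_two]; linarith
  have h5 : 0 ≤ A * (2 + C) * T ^ r := by
    refine nonneg_of_mul_nonneg_left ?_ hT0
    rw [← h3]; exact (abs_nonneg _).trans h4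
  calc _ ≤ A * (2 + C) * T ^ r * T := h4.trans_eq h3
    _ ≤ _ := by gcongr

lemma bilForm_self_crossVec {d : Fin 3 → ℤ} (hd : ∀ i, (d i : ℝ) = sqDiff a i) (v w : Fin 3 → ℤ) :
    bilForm a v (crossVec d v w) = 0 ∧ bilForm a w (crossVec d v w) = 0 := by
  constructor <;>
  · simp [bilForm, crossVec, Fin.sum_univ_three, ← hd]
    ring

lemma bilForm_comm (v w : Fin 3 → ℤ) : bilForm a v w = bilForm a w v :=
  sum_congr rfl fun i _ => by ring

set_option maxHeartbeats 1000000 in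
/-- There are no integer points of `bilForm a n n = sqDiffProd a` far out and very close to the
line on which the last two linear forms vanish. -/
theorem no_near_line {h : Fin 3 → ℤ} (hpos : ∀ i, 0 < h i)
    (hsq : ∀ i j, i ≠ j → ¬ IsSquare (h i * h j)) (ha : a = fun i => √(h i)) (hρ : 0 < ρ) (C : ℝ) :
    ∃ T₀, ∀ T ≥ T₀, ∀ n : Fin 3 → ℤ, bilForm a n n = sqDiffProd a → T ≤ linForm a 0 n →
      linForm a 0 n ≤ C * T → |linForm a 1 n| ≤ T ^ (-(2 * ρ)) → ¬ |linForm a 2 n| ≤ C / T := by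
  have ha2 : ∀ i, a i ^ 2 = h i := fun i => by
    rw [ha]; exact Real.sq_sqrt (by exact_mod_cast (hpos i).le)
  have hinj : ∀ i j, i ≠ j → h i ≠ h j := fun i j hij he => hsq i j hij ⟨h i, by rw [he]⟩
  obtain ⟨d, hd, hd0⟩ : ∃ d : Fin 3 → ℤ, (∀ i, (d i : ℝ) = sqDiff a i) ∧ ∀ i, d i ≠ 0 := by
    refine ⟨![h 1 - h 2, h 2 - h 0, h 0 - h 1], fun i => ?_, fun i => ?_⟩
    · fin_cases i <;> simp [sqDiff, ha2]
    · fin_cases i <;> simp [sub_ne_zero] <;> exact hinj _ _ (by decide)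
  have hV : sqDiffProd a ≠ 0 := by
    have h0 := hd0 0; have h1 := hd0 1; have h2 := hd0 2
    simp [sqDiffProd, ← hd, h0, h1, h2]
  set κ := ρ / 20 with hκ
  have hκ0 : 0 < κ := by positivity
  set K := |sqDiffProd a| * C with hK
  set D := max (2 * K * (2 + C) + 2 * K + C) (4 * (1 + C) ^ 2) with hD
  have hdual : ∀ j : ℕ, ∃ T₀, 5 ≤ j → ∀ T ≥ T₀, ∀ w₁ w₂ y : Fin 3 → ℤ,
      (∃ i j, w₁ i * w₂ j ≠ w₁ j * w₂ i) →
      ∑ i, sqDiff a i * y i * w₁ i = 0 → ∑ i, sqDiff a i * y i * w₂ i = 0 → y ≠ 0 →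
      |∑ j, formMatrix a 2 j * y j| ≤ D / T →
      (∀ k, |∑ j, formMatrix a k j * w₁ j| ≤
        D * T ^ ![1 - j * κ + κ, j * κ + κ, -1 - j * κ + κ] k) →
      ¬ ∀ k, |∑ j, formMatrix a k j * w₂ j| ≤
        D * T ^ ![1 - j * κ + κ, j * κ + κ, -1 - j * κ + κ] k := by
    intro j
    by_cases hj : 5 ≤ j
    · obtain ⟨T₀, h0⟩ := no_small_plane hpos hsq
        ![1 - j * κ + κ, j * κ + κ, -1 - j * κ + κ] (by
          have : (5 : ℝ) ≤ j := by exact_mod_cast hj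
          simp [Fin.sum_univ_three]; nlinarith) D ha
      exact ⟨T₀, fun _ => h0⟩
    · exact ⟨0, fun h => absurd h hj⟩
  choose T₁ hT₁ using hdual
  obtain ⟨T₂, hT₂⟩ := no_small_plane hpos hsq ![1 + 4 * κ, -ρ, -1 + 4 * κ] (by
    simp [Fin.sum_univ_three]; linarith) D ha
  obtain ⟨T₃, hT₃⟩ := Filter.eventually_atTop.1 ((Filter.eventually_ge_atTop (1 : ℝ)).and
    ((tendsto_rpow_atTop (by positivity : 0 < 2 * κ)).eventually_gt_atTop (4 * |sqDiffProd a|)))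
  obtain ⟨T₄, hT₄⟩ : ∃ T₄, ∀ j ∈ Icc 5 20, T₁ j ≤ T₄ :=
    ⟨(Icc 5 20).sup' ⟨5, by simp⟩ T₁, fun j hj => le_sup' T₁ hj⟩
  refine ⟨max (max T₂ T₃) T₄, fun T hT n hq hX hX' hY hZ => ?_⟩
  simp only [ge_iff_le, max_le_iff] at hT
  obtain ⟨⟨hTT₂, hTT₃⟩, hTT₄⟩ := hT
  obtain ⟨hT1, hTκ⟩ := hT₃ T hTT₃
  have hT0 : 0 < T := by linarith
  have hn0 : linForm a 0 n ≠ 0 := by linarith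
  have hn : n ≠ 0 := fun h => hn0 (by simp [h, linForm])
  have hC : 1 ≤ C := by by_contra! hc; nlinarith
  have hK0 : 0 ≤ K := by positivity
  have hDC : C ≤ D := le_trans (by nlinarith) (le_max_left _ _)
  rcases exists_shortest_dichotomy hd hd0 hT1 hκ0 hTκ hX hq with
    ⟨j, hj, v, hv, hqv⟩ | ⟨v, hv0, hv, hv5, hv20⟩
  · have hj5 := (mem_Icc.1 hj).1
    obtain ⟨w, hw, hind, hprod, hle⟩ := hv.exists_second hn0 hV hT0 hd
    have hqw : normForm a T (j * κ) w ≤ (2 * K * T ^ κ) ^ 2 := by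
      have h1 : (sqDiffProd a * linForm a 0 n / T) ^ 2 ≤ K ^ 2 := by
        have hp : 0 < linForm a 0 n := by linarith
        rw [← sq_abs, abs_div, abs_mul, abs_of_pos hT0, abs_of_pos hp]
        refine pow_le_pow_left₀ (by positivity) ?_ 2
        rw [div_le_iff₀ hT0, hK, mul_assoc]
        gcongr
      have h2 : (T ^ (-κ)) ^ 2 * normForm a T (j * κ) w ≤ 2 * K ^ 2 :=
        (mul_le_mul_of_nonneg_right hqv (normForm_nonneg _ _ _ _)).trans (by linarith)
      rw [Real.rpow_neg hT0.le, inv_pow, inv_mul_le_iff₀ (by positivity)] at h2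
      nlinarith [sq_nonneg (K * T ^ κ)]
    have hsmall : ∀ u, bilForm a n u = 0 → normForm a T (j * κ) u ≤ (2 * K * T ^ κ) ^ 2 →
        ∀ k, |∑ i, formMatrix a k i * u i| ≤
          D * T ^ ![1 - j * κ + κ, j * κ + κ, -1 - j * κ + κ] k := by
      intro u hu hqu
      obtain ⟨h1, h2⟩ := abs_linForm_le hT0 (by positivity) hqu
      rw [mul_assoc (2 * K), ← Real.rpow_add hT0] at h1 h2
      have hj20 : (j : ℝ) ≤ 20 := by exact_mod_cast (mem_Icc.1 hj).2
      have h3 := abs_linForm_two_le (r := -1 - j * κ + κ) hT1 hX hY hZ hu h1 h2 (by linarith)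
        (by nlinarith)
      have hD1 : 2 * K ≤ D := le_trans (by nlinarith) (le_max_left _ _)
      have hD2 : 2 * K * (2 + C) ≤ D := le_trans (by nlinarith) (le_max_left _ _)
      intro k
      fin_cases k
      · exact le_mul_rpow hT1 h1 hD1 (by simp; linarith)
      · exact le_mul_rpow hT1 h2 hD1 (by simp; linarith)
      · exact le_mul_rpow hT1 h3 hD2 le_rfl
    exact hT₁ j hj5 T ((hT₄ j hj).trans hTT₄) v w n hind hv.1 hw hn
      (hZ.trans (by gcongr)) (hsmall v hv.1 (hle.trans hqw)) (hsmall w hw hqw)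
  · obtain ⟨-, hYv⟩ := abs_linForm_le hT0 (by positivity) hv5
    obtain ⟨hXv, -⟩ := abs_linForm_le hT0 (by positivity) hv20
    rw [← Real.rpow_add hT0, ← one_mul (T ^ _)] at hXv hYv
    have hXv := le_mul_rpow (r := 1 - ρ) hT1 hXv le_rfl (by linarith)
    have hYv := le_mul_rpow (r := 4 * κ) hT1 hYv le_rfl (by linarith)
    have hZv := abs_linForm_two_le (r := -1 - ρ) hT1 hX hY hZ hv hXv hYv (by linarith)
      (by linarith)
    have hX1 : |linForm a 0 n| ≤ C * T ^ (1 : ℝ) := by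
      rwa [Real.rpow_one, abs_of_pos (by linarith)]
    have hY1 : |linForm a 1 n| ≤ 1 * T ^ (-(2 * ρ)) := by rwa [one_mul]
    have hZ1 : |linForm a 2 n| ≤ C * T ^ (-1 : ℝ) := by
      rwa [Real.rpow_neg_one, ← div_eq_mul_inv]
    have hD3 : 4 * (1 + C) ^ 2 ≤ D := le_max_right _ _
    refine hT₂ T hTT₂ n (crossVec d n v) v ?_ ?_ ?_ hv0 ?_ ?_ ?_
    · by_contra! hpar
      obtain ⟨t, ht⟩ := exists_eq_mul_of_parallel hn fun i j =>
        ((mul_comm _ _).trans (hpar j i)).trans (mul_comm _ _)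
      have h1 := (bilForm_self_crossVec hd n v).1
      rw [bilForm_eq_mul ht, hq] at h1
      have ht0 := (mul_eq_zero.1 h1).resolve_right hV
      have h2 : crossVec d n v = 0 := funext fun i => by
        have := ht i
        rw [ht0, zero_mul] at this; exact_mod_cast this
      obtain ⟨r, hr⟩ := exists_eq_mul_of_parallel (v := v) hn fun i j => by
        linear_combination -(parallel_of_crossVec_eq_zero hd0 h2 i j)
      rw [bilForm_eq_mul hr, hq] at hv
      have hr0 := (mul_eq_zero.1 hv).resolve_right hV
      exact hv0 (funext fun i => by
        have := hr i
        rw [hr0, zero_mul] at this; exact_mod_cast this)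
    · exact (bilForm_comm v n).trans hv
    · exact (bilForm_self_crossVec hd n v).2
    · have := le_mul_rpow (r := -1) hT1 hZv (by nlinarith : 1 * (2 + C) ≤ D) (by linarith)
      rwa [Real.rpow_neg_one, ← div_eq_mul_inv] at this
    · intro k
      fin_cases k
      · exact le_mul_rpow hT1 hX1 hDC (by simp; linarith)
      · exact le_mul_rpow hT1 hY1 (by linarith) (by simp; linarith)
      · exact le_mul_rpow hT1 hZ1 hDC (by simp; linarith)
    · have e0 : |linForm a 0 (crossVec d n v)| ≤ D * T ^ (1 + 4 * κ) := by
        rw [linForm_crossVec_zero hd]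
        have g1 := abs_mul_le_rpow (r := 1 + 4 * κ) hT1 hY1 hXv (by linarith)
        have g2 := abs_mul_le_rpow (r := 1 + 4 * κ) hT1 hX1 hYv (by linarith)
        have hp : 0 < T ^ (1 + 4 * κ) := by positivity
        refine (abs_sub _ _).trans ((add_le_add g1 g2).trans ?_)
        rw [← add_mul]; gcongr; nlinarith
      have e1 : |linForm a 1 (crossVec d n v)| ≤ D * T ^ (-ρ) := by
        have h1 := linForm_crossVec_one hd n v
        have g1 := abs_mul_le_rpow (r := -ρ) hT1 hZ1 hXv (by linarith)
        have g2 := abs_mul_le_rpow (r := -ρ) hT1 hX1 hZv (by linarith)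
        have g3 := (abs_sub _ _).trans (add_le_add g1 g2)
        rw [← h1, abs_mul, abs_two, ← add_mul] at g3
        have g4 : (C * 1 + C * (1 * (2 + C))) * T ^ (-ρ) ≤ D * T ^ (-ρ) := by
          gcongr; nlinarith
        linarith [abs_nonneg (linForm a 1 (crossVec d n v))]
      have e2 : |linForm a 2 (crossVec d n v)| ≤ D * T ^ (-1 + 4 * κ) := by
        rw [linForm_crossVec_two hd]
        have g1 := abs_mul_le_rpow (r := -1 + 4 * κ) hT1 hZ1 hYv (by linarith)
        have g2 := abs_mul_le_rpow (r := -1 + 4 * κ) hT1 hY1 hZv (by linarith)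
        refine (abs_sub _ _).trans ((add_le_add g1 g2).trans ?_)
        rw [← add_mul]; gcongr; nlinarith
      intro k
      fin_cases k
      · exact e0
      · exact e1
      · exact e2
end cone

lemma abs_sub_le_of_sq {n x b : ℝ} (hn : 0 ≤ n) (hx : 0 < x) (h : |n ^ 2 - x ^ 2| ≤ b) :
    |n - x| ≤ b / x := by
  rw [le_div_iff₀ hx]
  calc |n - x| * x ≤ |n - x| * |n + x| := by
        gcongr; rw [abs_of_nonneg (by linarith)]; linarith
    _ = |n ^ 2 - x ^ 2| := by rw [← abs_mul]; congr 1; ring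
    _ ≤ b := h

lemma sum_formMatrix_mul (a : Fin 3 → ℝ) :
    (∑ j, formMatrix a 0 j * a j = 2 * sqDiffProd a) ∧ ∑ j, formMatrix a 1 j * a j = 0 := by
  constructor <;>
  · simp [sqDiffProd, formMatrix, sqDiff, Fin.sum_univ_three]
    ring

lemma bilForm_self_of_circle {a : Fin 3 → ℝ} {n : Fin 3 → ℤ} {r R : ℝ}
    (h : ∀ i, (n i : ℝ) ^ 2 = r + 2 * R * a i ^ 2 - a i ^ 4) : bilForm a n n = sqDiffProd a := by
  simp only [bilForm, Fin.sum_univ_three, mul_assoc, ← sq, h]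
  simp [sqDiffProd, sqDiff]
  ring

/-- Three lattice points in distinct columns, no two of whose offsets multiply to a square, do not
lie together on a large circle. -/
theorem exists_forall_not_three_points {h : Fin 3 → ℤ} (hpos : ∀ i, 0 < h i)
    (hsq : ∀ i j, i ≠ j → ¬ IsSquare (h i * h j)) (h01 : h 0 < h 1) (h12 : h 1 < h 2) {ρ : ℝ}
    (hρ : 0 < ρ) (hρ' : ρ ≤ 1 / 2) : ∃ R₀ : ℕ, ∀ R ≥ R₀, ∀ N : ℕ,
      |(N : ℝ) - (R : ℝ) ^ 2| ≤ (R : ℝ) ^ ((1 : ℝ) / 2 - ρ) →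
      ¬ ∀ i, ∃ n : ℕ, ((R : ℤ) - h i) ^ 2 + (n : ℤ) ^ 2 = (N : ℤ) := by
  set a : Fin 3 → ℝ := fun i => √(h i) with ha
  have ha2 : ∀ i, a i ^ 2 = h i := fun i => Real.sq_sqrt (by exact_mod_cast (hpos i).le)
  have ha1 : ∀ i, 1 ≤ a i := fun i => Real.one_le_sqrt.2 (by exact_mod_cast hpos i)
  set V := sqDiffProd a with hVdef
  have hV : 1 ≤ V := by
    have : V = (((h 1 - h 2) * (h 2 - h 0) * (h 0 - h 1) : ℤ) : ℝ) := by
      rw [hVdef]; simp [sqDiffProd, sqDiff, ha2]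
    rw [this]
    have h1 : 0 < (h 1 - h 2) * (h 2 - h 0) * (h 0 - h 1) :=
      mul_pos_of_neg_of_neg (mul_neg_of_neg_of_pos (by linarith) (by linarith)) (by linarith)
    exact_mod_cast h1
  set K := ∑ k, ∑ j, |formMatrix a k j| * (1 + (h j : ℝ) ^ 2) with hK
  have hK0 : 0 ≤ K := by positivity
  set C := 4 * V + K + V ^ 2 + 1 with hC
  obtain ⟨T₀, hT₀⟩ := no_near_line hpos hsq ha (half_pos hρ) C
  have hlim : ∀ᶠ R : ℕ in Filter.atTop, 1 ≤ √(R : ℝ) ∧ T₀ ≤ √(R : ℝ) ∧ K ≤ √(R : ℝ) ∧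
      K ≤ √(R : ℝ) ^ ρ := by
    have h1 : Filter.Tendsto (fun R : ℕ => √(R : ℝ)) Filter.atTop Filter.atTop :=
      Real.tendsto_sqrt_atTop.comp tendsto_natCast_atTop_atTop
    exact (h1.eventually_ge_atTop _).and ((h1.eventually_ge_atTop _).and
      ((h1.eventually_ge_atTop _).and (((tendsto_rpow_atTop hρ).comp h1).eventually_ge_atTop _)))
  obtain ⟨R₀, hR₀⟩ := Filter.eventually_atTop.1 hlim
  refine ⟨R₀, fun R hR N hN hn => ?_⟩
  obtain ⟨hT1, hTT₀, hTK, hTρ⟩ := hR₀ R hR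
  set T := √(R : ℝ) with hT
  have hT0 : 0 < T := by linarith
  have hRT : (R : ℝ) = T ^ 2 := (Real.sq_sqrt (Nat.cast_nonneg R)).symm
  choose n hn using hn
  set r : ℝ := N - (R : ℝ) ^ 2 with hr
  have hrT : |r| ≤ T ^ (1 - 2 * ρ) := by
    refine hN.trans_eq ?_
    rw [hRT, ← Real.rpow_natCast, ← Real.rpow_mul hT0.le]
    congr 1; push_cast; ring
  have hn2 : ∀ i, (n i : ℝ) ^ 2 = r + 2 * R * a i ^ 2 - a i ^ 4 := fun i => by
    have : (((R : ℤ) - h i) ^ 2 + (n i : ℤ) ^ 2 : ℝ) = (N : ℤ) := by exact_mod_cast hn i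
    push_cast at this
    rw [show a i ^ 4 = (a i ^ 2) ^ 2 by ring, ha2, hr]
    linarith
  have hTρ1 : 1 ≤ T ^ (1 - 2 * ρ) := Real.one_le_rpow hT1 (by linarith)
  set e : Fin 3 → ℝ := fun i => n i - √2 * T * a i with he
  have hs2 : 1 ≤ √(2 : ℝ) := Real.one_le_sqrt.2 (by norm_num)
  have heb : ∀ i, |e i| ≤ (1 + (h i : ℝ) ^ 2) * T ^ (-(2 * ρ)) := fun i => by
    have hx : 0 < √2 * T * a i := by have := ha1 i; positivity
    have h1 : |(n i : ℝ) ^ 2 - (√2 * T * a i) ^ 2| ≤ (1 + (h i : ℝ) ^ 2) * T ^ (1 - 2 * ρ) := by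
      have h2 : (n i : ℝ) ^ 2 - (√2 * T * a i) ^ 2 = r - (h i : ℝ) ^ 2 := by
        rw [hn2, ← ha2, hRT]
        linear_combination (-(T ^ 2 * a i ^ 2)) * Real.sq_sqrt (zero_le_two (α := ℝ))
      rw [h2]
      refine (abs_sub r _).trans ?_
      rw [abs_of_nonneg (sq_nonneg (h i : ℝ)), add_mul, one_mul]
      exact add_le_add hrT (le_mul_of_one_le_right (sq_nonneg _) hTρ1)
    refine (abs_sub_le_of_sq (Nat.cast_nonneg _) hx h1).trans ?_
    rw [div_le_iff₀ hx]
    have h3 : T ^ (1 - 2 * ρ) = T ^ (-(2 * ρ)) * T := by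
      rw [show 1 - 2 * ρ = -(2 * ρ) + 1 by ring, Real.rpow_add hT0, Real.rpow_one]
    have h4 : T ≤ √2 * T * a i := by
      calc T = 1 * T * 1 := by ring
        _ ≤ _ := by gcongr; exact ha1 i
    rw [h3, ← mul_assoc]
    gcongr
  have hlin : ∀ k, |linForm a k (fun i => (n i : ℤ)) -
      √2 * T * ∑ j, formMatrix a k j * a j| ≤ K * T ^ (-(2 * ρ)) := fun k => by
    have h1 : linForm a k (fun i => (n i : ℤ)) - √2 * T * ∑ j, formMatrix a k j * a j =
        ∑ j, formMatrix a k j * e j := by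
      simp only [linForm, mul_sum, ← sum_sub_distrib, he]
      exact sum_congr rfl fun j _ => by push_cast; ring
    rw [h1]
    calc _ ≤ ∑ j, |formMatrix a k j| * ((1 + (h j : ℝ) ^ 2) * T ^ (-(2 * ρ))) := by
          refine (abs_sum_le_sum_abs _ _).trans (sum_le_sum fun j _ => ?_)
          rw [abs_mul]; gcongr; exact heb j
      _ = (∑ j, |formMatrix a k j| * (1 + (h j : ℝ) ^ 2)) * T ^ (-(2 * ρ)) := by
          rw [sum_mul]; exact sum_congr rfl fun j _ => by ring
      _ ≤ _ := by
          gcongr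
          exact single_le_sum (f := fun k => ∑ j, |formMatrix a k j| * (1 + (h j : ℝ) ^ 2))
            (fun k _ => by positivity) (mem_univ k)
  have hl0 := hlin 0
  have hl1 := hlin 1
  rw [(sum_formMatrix_mul a).1] at hl0
  rw [(sum_formMatrix_mul a).2, mul_zero, sub_zero] at hl1
  have hTneg : T ^ (-(2 * ρ)) ≤ 1 := Real.rpow_le_one_of_one_le_of_nonpos hT1 (by linarith)
  obtain ⟨hl, hu⟩ := abs_le.1 (hl0.trans (mul_le_of_le_one_right hK0 hTneg))
  have hs2' : √(2 : ℝ) ≤ 2 := Real.sqrt_le_iff.2 (by norm_num)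
  have hX : T ≤ linForm a 0 (fun i => (n i : ℤ)) := by
    have : 2 * T ≤ √2 * T * (2 * V) := by
      calc 2 * T = 1 * T * (2 * 1) := by ring
        _ ≤ _ := by gcongr
    linarith
  have hX' : linForm a 0 (fun i => (n i : ℤ)) ≤ C * T := by
    have h1 : √2 * T * (2 * V) ≤ 2 * T * (2 * V) := by gcongr
    have h2 : K ≤ K * T := le_mul_of_one_le_right hK0 hT1
    have h3 : 0 ≤ (V ^ 2 + 1) * T := by positivity
    rw [hC]; linarith
  have hY : |linForm a 1 (fun i => (n i : ℤ))| ≤ T ^ (-(2 * (ρ / 2))) := by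
    calc _ ≤ T ^ ρ * T ^ (-(2 * ρ)) := hl1.trans (by gcongr)
      _ = _ := by rw [← Real.rpow_add hT0]; congr 1; ring
  have hq : bilForm a (fun i => (n i : ℤ)) (fun i => (n i : ℤ)) = V :=
    bilForm_self_of_circle fun i => by push_cast; exact hn2 i
  refine hT₀ T hTT₀ _ hq hX hX' hY ?_
  have h1 := bilForm_eq_linForm a (fun i => (n i : ℤ)) (fun i => (n i : ℤ))
  rw [hq] at h1
  have hY1 := hY.trans (Real.rpow_le_one_of_one_le_of_nonpos hT1 (by linarith))
  have hY2 : linForm a 1 (fun i => (n i : ℤ)) ^ 2 ≤ 1 := by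
    rw [← sq_abs]; exact pow_le_one₀ (abs_nonneg _) hY1
  have hXpos : 0 < linForm a 0 (fun i => (n i : ℤ)) := by linarith
  have h2 : linForm a 2 (fun i => (n i : ℤ)) =
      (V ^ 2 + linForm a 1 (fun i => (n i : ℤ)) ^ 2) / linForm a 0 (fun i => (n i : ℤ)) := by
    rw [eq_div_iff hXpos.ne']
    linarith
  rw [h2, abs_of_nonneg (by positivity)]
  gcongr
  linarith

/-- If `h * k` is a square, two points in the columns with offsets `h` and `k` on a large circle
determine the circle. -/
theorem exists_forall_eq_neg_mul {h k : ℤ} (hh : 0 < h) (hk : 0 < k) (hne : h ≠ k)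
    (hs : IsSquare (h * k))
    {ρ : ℝ} (hρ : 0 < ρ) : ∃ R₀ : ℕ, ∀ R ≥ R₀, ∀ N : ℕ,
      |(N : ℝ) - (R : ℝ) ^ 2| ≤ (R : ℝ) ^ ((1 : ℝ) / 2 - ρ) →
      (∃ n : ℕ, ((R : ℤ) - h) ^ 2 + (n : ℤ) ^ 2 = (N : ℤ)) →
      (∃ n : ℕ, ((R : ℤ) - k) ^ 2 + (n : ℤ) ^ 2 = (N : ℤ)) → (N : ℤ) - R ^ 2 = -(h * k) := by
  obtain ⟨s, hs⟩ := hs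
  set A : ℝ := |(k * (k - h) : ℝ)| with hA
  have hlim : ∀ᶠ R : ℕ in Filter.atTop, 1 ≤ R ∧ 2 + 2 * (h : ℝ) ^ 2 ≤ R ∧
      A * (1 + h * k) < (R : ℝ) ^ min ρ (1 / 2) / 2 := by
    have h1 : Filter.Tendsto (fun R : ℕ => (R : ℝ)) Filter.atTop Filter.atTop :=
      tendsto_natCast_atTop_atTop
    exact (Filter.eventually_ge_atTop 1).and ((h1.eventually_ge_atTop _).and
      ((((tendsto_rpow_atTop (lt_min hρ (by norm_num))).comp h1).atTop_div_const
        two_pos).eventually_gt_atTop _))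
  obtain ⟨R₀, hR₀⟩ := Filter.eventually_atTop.1 hlim
  refine ⟨R₀, ?_⟩
  rintro R hR N hN ⟨n, hn⟩ ⟨m, hm⟩
  obtain ⟨hR1, hR2, hR3⟩ := hR₀ R hR
  have hR1' : (1 : ℝ) ≤ R := by exact_mod_cast hR1
  have hR0 : (0 : ℝ) < R := by linarith
  by_contra hrhk
  set r : ℤ := N - R ^ 2 with hr
  have hrR : |(r : ℝ)| ≤ (R : ℝ) ^ (1 / 2 - min ρ (1 / 2)) := by
    refine le_trans (le_of_eq (by rw [hr]; push_cast; rfl)) (hN.trans ?_)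
    exact Real.rpow_le_rpow_of_exponent_le hR1' (by linarith [min_le_left ρ (1 / 2)])
  set τ := min ρ (1 / 2)
  have hτ0 : 0 < τ := lt_min hρ (by norm_num)
  have hτ1 : τ ≤ 1 / 2 := min_le_right _ _
  have hfac : (k * n - |s| * m) * (k * n + |s| * m) = k * (k - h) * (r + h * k) := by
    have : |s| * |s| = h * k := by rw [abs_mul_abs_self, hs]
    rw [hr]
    linear_combination k ^ 2 * hn - (m : ℤ) ^ 2 * this - h * k * hm
  have hr0 : r + h * k ≠ 0 := fun h0 => hrhk (by linarith)
  have hne0 : (k * n - |s| * m) * (k * n + |s| * m) ≠ 0 := by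
    rw [hfac]
    exact mul_ne_zero (mul_ne_zero hk.ne' (sub_ne_zero.2 hne.symm)) hr0
  have hsum : k * n + |s| * m ≤ |k * (k - h)| * |r + h * k| := by
    have h1 : 1 ≤ |k * n - |s| * m| := Int.one_le_abs (left_ne_zero_of_mul hne0)
    rw [← abs_mul, ← hfac, abs_mul]
    exact (le_abs_self _).trans (le_mul_of_one_le_left (abs_nonneg _) h1)
  have hkn : (n : ℤ) ≤ |k * (k - h)| * |r + h * k| := by
    have h1 : (n : ℤ) ≤ k * n := le_mul_of_one_le_left (Nat.cast_nonneg n) hk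
    have h2 : 0 ≤ |s| * m := mul_nonneg (abs_nonneg s) (Nat.cast_nonneg m)
    linarith
  have hhkR : (1 : ℝ) ≤ h * k := by exact_mod_cast Int.add_one_le_iff.2 (mul_pos hh hk)
  have hhR : (1 : ℝ) ≤ h := by exact_mod_cast hh
  have hτR : 1 ≤ (R : ℝ) ^ (1 / 2 - τ) := Real.one_le_rpow hR1' (by linarith)
  have hn1 : (n : ℝ) ≤ A * (1 + h * k) * (R : ℝ) ^ (1 / 2 - τ) := by
    calc (n : ℝ) ≤ A * |(r : ℝ) + h * k| := by rw [hA]; exact_mod_cast hkn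
      _ ≤ A * ((R : ℝ) ^ (1 / 2 - τ) + h * k * (R : ℝ) ^ (1 / 2 - τ)) := by
          gcongr
          refine (abs_add_le _ _).trans (add_le_add hrR ?_)
          rw [abs_of_nonneg (by linarith)]
          exact le_mul_of_one_le_right (by linarith) hτR
      _ = _ := by ring
  have hrR' : |(r : ℝ)| ≤ R := by
    calc _ ≤ (R : ℝ) ^ (1 / 2 - τ) := hrR
      _ ≤ (R : ℝ) ^ (1 : ℝ) := Real.rpow_le_rpow_of_exponent_le hR1' (by linarith)
      _ = R := Real.rpow_one _
  have hn2 : (n : ℝ) ^ 2 = 2 * R * h + r - (h : ℝ) ^ 2 := by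
    have h1 : ((R : ℝ) - h) ^ 2 + (n : ℝ) ^ 2 = N := by exact_mod_cast hn
    rw [hr]; push_cast; linarith
  have hhalf : (R : ℝ) / 2 ≤ (n : ℝ) ^ 2 := by
    have h1 : (R : ℝ) ≤ R * h := le_mul_of_one_le_right hR0.le hhR
    rw [hn2]; linarith [neg_le_of_abs_le hrR']
  have hlt : (n : ℝ) < (R : ℝ) ^ ((1 : ℝ) / 2) / 2 := by
    refine hn1.trans_lt ?_
    rw [show (1 : ℝ) / 2 = τ + (1 / 2 - τ) by ring, Real.rpow_add hR0, add_sub_cancel,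
      mul_div_right_comm]
    exact mul_lt_mul_of_pos_right hR3 (by linarith)
  rw [← Real.sqrt_eq_rpow] at hlt
  have h1 : (n : ℝ) ^ 2 < (√R / 2) ^ 2 := pow_lt_pow_left₀ hlt (Nat.cast_nonneg n) two_ne_zero
  rw [div_pow, Real.sq_sqrt hR0.le] at h1
  linarith

lemma exists_triple_mul_ne {l : ℕ} (hl : 5 ≤ l) {h : Fin l → ℤ} (hmono : StrictMono h)
    (hpos : ∀ i, 0 < h i) (s : ℤ) :
    ∃ i j k, i < j ∧ j < k ∧ h i * h j ≠ s ∧ h j * h k ≠ s ∧ h i * h k ≠ s := by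
  have hinj : ∀ i j k : Fin l, j ≠ k → h i * h j = s → h i * h k ≠ s := fun i j k hjk h1 h2 =>
    hjk (hmono.injective (mul_left_cancel₀ (hpos i).ne' (h1.trans h2.symm)))
  have key : ∀ a b c d e : Fin l, a < b → b < c → c < d → d < e →
      ∃ i j k, i < j ∧ j < k ∧ h i * h j ≠ s ∧ h j * h k ≠ s ∧ h i * h k ≠ s := by
    intro a b c d e hab hbc hcd hde
    by_contra! hcon
    have hac := hab.trans hbc
    have had := hac.trans hcd
    have hae := had.trans hde
    have hbd := hbc.trans hcd
    have hbe := hbd.trans hde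
    have hce := hcd.trans hde
    by_cases h1 : h a * h b = s
    · have h2 := hinj a b c hbc.ne h1
      have h3 := hinj a b d hbd.ne h1
      have h4 := hinj a b e hbe.ne h1
      have h5 := hcon a c d hac hcd h2
      have h6 := hcon a c e hac hce h2
      have h7 := hcon a d e had hde h3
      have h8 := hinj c d e hde.ne
      have h9 := hinj d c e hce.ne
      rw [mul_comm (h d)] at h9
      tauto
    · by_cases h2 : h a * h c = s
      · have h3 := hinj a c b hbc.ne' h2
        have h4 := hinj a c d hcd.ne h2
        have h7 := hinj a c e hce.ne h2
        have h5 := hcon a b d hab hbd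
        have h6 := hcon a b e hab hbe
        have h8 := hinj b d e hde.ne
        tauto
      · have h3 := hcon a b c hab hbc h1
        have h4 : h b * h c = s := by tauto
        have h5 := hinj b c d hcd.ne h4
        have h6 := hinj b c e hce.ne h4
        have h7 := hcon a b d hab hbd h1 h5
        have h8 := hcon a b e hab hbe h1 h6
        exact hinj a d e hde.ne h7 h8
  exact key ⟨0, by omega⟩ ⟨1, by omega⟩ ⟨2, by omega⟩ ⟨3, by omega⟩ ⟨4, by omega⟩
    (Fin.mk_lt_mk.2 zero_lt_one) (Fin.mk_lt_mk.2 (by norm_num)) (Fin.mk_lt_mk.2 (by norm_num))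
    (Fin.mk_lt_mk.2 (by norm_num))

lemma exists_radius_bound {l : ℕ} (hl : 5 ≤ l) {h : Fin l → ℤ} (hmono : StrictMono h)
    (hpos : ∀ i, 0 < h i) {ρ : ℝ} (hρ : 0 < ρ) (hρ' : ρ ≤ 1 / 2) :
    ∃ R₁ : ℕ, ∀ R ≥ R₁, ∀ N : ℕ, |(N : ℝ) - (R : ℝ) ^ 2| ≤ (R : ℝ) ^ ((1 : ℝ) / 2 - ρ) →
      ¬ ∀ i, ∃ n : ℕ, ((R : ℤ) - h i) ^ 2 + (n : ℤ) ^ 2 = (N : ℤ) := by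
  have hpair : ∀ p : Fin l × Fin l, ∀ᶠ R : ℕ in Filter.atTop, p.1 ≠ p.2 →
      IsSquare (h p.1 * h p.2) → ∀ N : ℕ,
      |(N : ℝ) - (R : ℝ) ^ 2| ≤ (R : ℝ) ^ ((1 : ℝ) / 2 - ρ) →
      (∀ i, ∃ n : ℕ, ((R : ℤ) - h i) ^ 2 + (n : ℤ) ^ 2 = (N : ℤ)) →
      (N : ℤ) - R ^ 2 = -(h p.1 * h p.2) := fun p => by
    by_cases hp : p.1 ≠ p.2 ∧ IsSquare (h p.1 * h p.2)
    · obtain ⟨R₀, hR₀⟩ := exists_forall_eq_neg_mul (hpos p.1) (hpos p.2)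
        (hmono.injective.ne hp.1) hp.2 hρ
      exact Filter.eventually_atTop.2 ⟨R₀, fun R hR _ _ N hN hn => hR₀ R hR N hN (hn _) (hn _)⟩
    · exact Filter.Eventually.of_forall fun R h1 h2 => (hp ⟨h1, h2⟩).elim
  have htriple : ∀ p : Fin l × Fin l × Fin l, ∀ᶠ R : ℕ in Filter.atTop, p.1 < p.2.1 →
      p.2.1 < p.2.2 → ¬ IsSquare (h p.1 * h p.2.1) → ¬ IsSquare (h p.2.1 * h p.2.2) →
      ¬ IsSquare (h p.1 * h p.2.2) → ∀ N : ℕ,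
      |(N : ℝ) - (R : ℝ) ^ 2| ≤ (R : ℝ) ^ ((1 : ℝ) / 2 - ρ) →
      ¬ ∀ i, ∃ n : ℕ, ((R : ℤ) - h i) ^ 2 + (n : ℤ) ^ 2 = (N : ℤ) := fun ⟨i, j, k⟩ => by
    by_cases hp : i < j ∧ j < k ∧ ¬ IsSquare (h i * h j) ∧ ¬ IsSquare (h j * h k) ∧
        ¬ IsSquare (h i * h k)
    · obtain ⟨hij, hjk, h1, h2, h3⟩ := hp
      obtain ⟨R₀, hR₀⟩ := exists_forall_not_three_points (h := h ∘ ![i, j, k])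
        (fun _ => hpos _) (fun x y hxy => by
          fin_cases x <;> fin_cases y <;> simp_all [mul_comm])
        (hmono hij) (hmono hjk) hρ hρ'
      exact Filter.eventually_atTop.2
        ⟨R₀, fun R hR _ _ _ _ _ N hN hn => hR₀ R hR N hN fun _ => hn _⟩
    · exact Filter.Eventually.of_forall fun R h1 h2 h3 h4 h5 => (hp ⟨h1, h2, h3, h4, h5⟩).elim
  obtain ⟨R₁, hR₁⟩ := Filter.eventually_atTop.1
    ((Filter.eventually_all.2 hpair).and (Filter.eventually_all.2 htriple))
  refine ⟨R₁, fun R hR N hN hn => ?_⟩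
  obtain ⟨hp, ht⟩ := hR₁ R hR
  obtain ⟨i, j, k, hij, hjk, h1, h2, h3⟩ :=
    exists_triple_mul_ne hl hmono hpos ((R : ℤ) ^ 2 - N)
  refine ht (i, j, k) hij hjk (fun hs => h1 ?_) (fun hs => h2 ?_) (fun hs => h3 ?_) N hN hn
  · linarith [hp (i, j) hij.ne hs N hN hn]
  · linarith [hp (j, k) hjk.ne hs N hN hn]
  · linarith [hp (i, k) (hij.trans hjk).ne hs N hN hn]

end

/-- Finiteness of the set of `N` admitting `R` with `|N - R²| ≤ R^(1/2-ρ)` and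
lattice points `(R - hᵢ, nᵢ)` on the circle of radius `√N` for all `1 ≤ i ≤ l`,
when `l ≥ 5`, `0 < h₁ < … < h_l`, `0 < ρ ≤ 1/2` and `2ρ(l-1) > 1`. -/
theorem stmt_5 (l : ℕ) (hl : 5 ≤ l) (h : Fin l → ℤ)
    (hmono : StrictMono h) (hpos : ∀ i, 0 < h i)
    (ρ : ℝ) (hρ0 : 0 < ρ) (hρ1 : ρ ≤ 1 / 2) (hρl : 1 < 2 * ρ * ((l : ℝ) - 1)) :
    {N : ℕ | ∃ R : ℕ,
        |(N : ℝ) - (R : ℝ) ^ 2| ≤ (R : ℝ) ^ ((1 : ℝ) / 2 - ρ) ∧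
        ∀ i : Fin l, ∃ n : ℕ,
          ((R : ℤ) - h i) ^ 2 + (n : ℤ) ^ 2 = (N : ℤ)}.Finite := by
  obtain ⟨R₁, hR₁⟩ := exists_radius_bound hl hmono hpos hρ0 hρ1
  refine (Set.Finite.biUnion (Set.finite_Iio R₁) fun R _ =>
    Set.finite_Iic ⌊(R : ℝ) ^ 2 + (R : ℝ) ^ ((1 : ℝ) / 2 - ρ)⌋₊).subset ?_
  rintro N ⟨R, hN, hn⟩
  have hR : R < R₁ := lt_of_not_ge fun hR => hR₁ R hR N hN hn
  refine Set.mem_biUnion hR (Nat.le_floor ?_)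
  linarith [le_of_abs_le hN]
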